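/- arXiv:2509.06273 — 4 statements merged into one kernel-verified Lean document; each statement's English description precedes it below -/
import Mathlib

section
/- (Theorem 1.2) The generalized independent urn occupation measure satisfies conditional negative association: let μ^occ denote the law of (B_1^occ,…,B_n^occ) ∈ ℕ^n. For every subset T ⊆ [n] and every choice of values b_i ∈ {0,1} (i ∈ T), writing C = {x ∈ ℕ^n : x_i = b_i for all i ∈ T}, and for all increasing events A, B ⊆ ℕ^n such that no coordinate j ∈ [n] affects both A and B, one has μ^occ(A ∩ B ∩ C) · μ^occ(C) ≤ μ^occ(A ∩ C) · μ^occ(B ∩ C). -/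
/-!
(Theorem 1.2) The generalized independent urn occupation measure satisfies
conditional negative association.
-/

open Finset
open scoped Classical

noncomputable section

/-- The weight of an assignment `σ` of `m` balls to `n` urns. -/
def urnWeight {m n : ℕ} (p : Fin m → Fin n → ℝ) (σ : Fin m → Fin n) : ℝ :=
  ∏ i, p i (σ i)

/-- `B_j(σ)`: the number of balls in urn `j`. -/
def ballCount {m n : ℕ} (σ : Fin m → Fin n) (j : Fin n) : ℕ :=
  (Finset.univ.filter fun i => σ i = j).card

/-- The occupation vector `(B_1^occ, …, B_n^occ) ∈ ℕ^n`. -/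
def occVector {m n : ℕ} (σ : Fin m → Fin n) : Fin n → ℕ :=
  fun j => if 1 ≤ ballCount σ j then 1 else 0

/-- The urn occupation measure `μ^occ` of an event `E ⊆ ℕ^n`. -/
def muOcc {m n : ℕ} (p : Fin m → Fin n → ℝ) (E : Set (Fin n → ℕ)) : ℝ :=
  ∑ σ : Fin m → Fin n, if occVector σ ∈ E then urnWeight p σ else 0

/-- Coordinate `j` affects the event `A ⊆ ℕ^n`. -/
def Affects {n : ℕ} (j : Fin n) (A : Set (Fin n → ℕ)) : Prop :=
  ∃ x ∈ A, ∃ y ∉ A, ∀ i, i ≠ j → x i = y i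

set_option linter.all false


namespace Urn

variable {ι α : Type} [Fintype ι] [DecidableEq ι] [Fintype α] [DecidableEq α]

/-- expectation under product weights -/
def Ex (p : ι → α → ℝ) (Φ : (ι → α) → ℝ) : ℝ := ∑ σ : ι → α, (∏ i, p i (σ i)) * Φ σ

/-- ball `i` is sent to the dump urn `o` -/
def del (o : α) (p : ι → α → ℝ) (i : ι) : ι → α → ℝ := Function.update p i (Pi.single o 1)

/-- remove the columns `I` of row `i` -/
def zr (I : Finset α) (p : ι → α → ℝ) (i : ι) : ι → α → ℝ :=
  Function.update p i (fun j => if j ∈ I then 0 else p i j)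

def cv (T : Finset α) (σ : ι → α) : ℝ := if ∀ t ∈ T, ∃ i, σ i = t then 1 else 0

def cnt (I : Finset α) (σ : ι → α) : ℕ := (univ.filter fun i => σ i ∈ I).card

def ct (I : Finset α) (a : ℕ) (σ : ι → α) : ℝ := if cnt I σ = a then 1 else 0

def sh (f : ℕ → ℝ) : ℕ → ℝ
  | 0 => 0
  | (a + 1) => f a

def Le (f g : ℕ → ℝ) : Prop := ∀ x y, y ≤ x → f x * g y ≤ f y * g x

def V (p : ι → α → ℝ) (I T : Finset α) (Φ : (ι → α) → ℝ) (a : ℕ) : ℝ :=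
  Ex p (fun σ => cv T σ * ct I a σ * Φ σ)

def U (p : ι → α → ℝ) (I T : Finset α) (a : ℕ) : ℝ := V p I T (fun _ => 1) a

lemma Ex_add (p : ι → α → ℝ) (Φ Ψ : (ι → α) → ℝ) :
    Ex p (fun σ => Φ σ + Ψ σ) = Ex p Φ + Ex p Ψ := by
  simp [Ex, mul_add, sum_add_distrib]

lemma Ex_smul (p : ι → α → ℝ) (c : ℝ) (Φ : (ι → α) → ℝ) :
    Ex p (fun σ => c * Φ σ) = c * Ex p Φ := by
  simp only [Ex, mul_sum]; refine sum_congr rfl fun σ _ => by ring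

lemma Ex_sum {κ : Type} (s : Finset κ) (p : ι → α → ℝ) (Φ : κ → (ι → α) → ℝ) :
    Ex p (fun σ => ∑ k ∈ s, Φ k σ) = ∑ k ∈ s, Ex p (Φ k) := by
  simp only [Ex, mul_sum]; rw [sum_comm]

lemma Ex_mono {p : ι → α → ℝ} (hp : ∀ i j, 0 ≤ p i j) {Φ Ψ : (ι → α) → ℝ}
    (h : ∀ σ, (∏ i, p i (σ i)) ≠ 0 → Φ σ ≤ Ψ σ) : Ex p Φ ≤ Ex p Ψ := by
  refine sum_le_sum fun σ _ => ?_
  by_cases h0 : (∏ i, p i (σ i)) = 0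
  · simp [h0]
  · exact mul_le_mul_of_nonneg_left (h σ h0) (prod_nonneg fun i _ => hp _ _)

lemma Ex_congr {p : ι → α → ℝ} {Φ Ψ : (ι → α) → ℝ}
    (h : ∀ σ, (∏ i, p i (σ i)) ≠ 0 → Φ σ = Ψ σ) : Ex p Φ = Ex p Ψ := by
  refine sum_congr rfl fun σ _ => ?_
  by_cases h0 : (∏ i, p i (σ i)) = 0
  · simp [h0]
  · rw [h σ h0]

lemma Ex_nonneg {p : ι → α → ℝ} (hp : ∀ i j, 0 ≤ p i j) {Φ : (ι → α) → ℝ}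
    (h : ∀ σ, 0 ≤ Φ σ) : 0 ≤ Ex p Φ :=
  sum_nonneg fun σ _ => mul_nonneg (prod_nonneg fun i _ => hp _ _) (h σ)

/-- vanishing transfers to products -/
lemma Ex_zero_mul {p : ι → α → ℝ} (hp : ∀ i j, 0 ≤ p i j) {Φ : (ι → α) → ℝ}
    (h : ∀ σ, 0 ≤ Φ σ) (h0 : Ex p Φ = 0) (Ψ : (ι → α) → ℝ) :
    Ex p (fun σ => Φ σ * Ψ σ) = 0 := by
  have := (sum_eq_zero_iff_of_nonneg (fun σ _ =>
    mul_nonneg (prod_nonneg fun i _ => hp _ _) (h σ))).1 h0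
  refine sum_eq_zero fun σ hσ => ?_
  have := this σ hσ
  rw [← mul_assoc, this, zero_mul]

lemma del_supp {o : α} {p : ι → α → ℝ} {i : ι} {σ : ι → α}
    (h : (∏ k, del o p i k (σ k)) ≠ 0) : σ i = o := by
  by_contra hne
  apply h
  refine prod_eq_zero (mem_univ i) ?_
  simp [del, Pi.single_apply, hne]

lemma supp_ne {p : ι → α → ℝ} {σ : ι → α}
    (h : (∏ k, p k (σ k)) ≠ 0) (k : ι) : p k (σ k) ≠ 0 := by
  intro h0; exact h (prod_eq_zero (mem_univ k) h0)

lemma del_congr {o : α} {p : ι → α → ℝ} {i : ι} {Φ Ψ : (ι → α) → ℝ}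
    (h : ∀ σ, σ i = o → Φ σ = Ψ σ) : Ex (del o p i) Φ = Ex (del o p i) Ψ :=
  Ex_congr fun σ hσ => h σ (del_supp hσ)

lemma del_nonneg {o : α} {p : ι → α → ℝ} (hp : ∀ i j, 0 ≤ p i j) (i : ι) :
    ∀ k j, 0 ≤ del o p i k j := by
  intro k j
  unfold del
  by_cases hk : k = i
  · subst hk; simp [Pi.single_apply]; split_ifs <;> norm_num
  · simp [hk, hp]

lemma zr_nonneg {I : Finset α} {p : ι → α → ℝ} (hp : ∀ i j, 0 ≤ p i j) (i : ι) :
    ∀ k j, 0 ≤ zr I p i k j := by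
  intro k j
  unfold zr
  by_cases hk : k = i
  · subst hk; simp; split_ifs <;> simp [hp]
  · simp [hk, hp]

lemma del_zr (o : α) (I : Finset α) (p : ι → α → ℝ) (i : ι) :
    del o (zr I p i) i = del o p i := by
  simp [del, zr]

/-- expansion along ball `i` -/
lemma Ex_expand (o : α) (p : ι → α → ℝ) (i : ι) (Φ : (ι → α) → ℝ) :
    Ex p Φ = ∑ j, p i j * Ex (del o p i) (fun σ => Φ (Function.update σ i j)) := by
  have key : ∀ (q : ι → α → ℝ) (Ψ : (ι → α) → ℝ), Ex q Ψ =
      ∑ j, q i j * ∑ τ : {k // k ≠ i} → α, (∏ k, q k.1 (τ k)) *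
        Ψ ((Equiv.funSplitAt i α).symm (j, τ)) := by
    intro q Ψ
    unfold Ex
    rw [← (Equiv.funSplitAt i α).symm.sum_comp, Fintype.sum_prod_type]
    refine sum_congr rfl fun j _ => ?_
    rw [mul_sum]
    refine sum_congr rfl fun τ _ => ?_
    rw [← mul_assoc]
    congr 1
    rw [Fintype.prod_eq_mul_prod_subtype_ne _ i]
    congr 1
    · simp [Equiv.funSplitAt, Equiv.piSplitAt]
    · refine prod_congr rfl fun k _ => ?_
      simp [Equiv.funSplitAt, Equiv.piSplitAt, k.2]
  rw [key p Φ]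
  refine sum_congr rfl fun j _ => ?_
  congr 1
  rw [key]
  rw [sum_eq_single o]
  · simp only [del, Function.update_self, Pi.single_eq_same, one_mul]
    refine sum_congr rfl fun τ _ => ?_
    congr 1
    · refine prod_congr rfl fun k _ => ?_
      rw [Function.update_of_ne k.2]
    · congr 1
      ext k
      by_cases hk : k = i
      · subst hk; simp [Equiv.funSplitAt, Equiv.piSplitAt]
      · simp [Equiv.funSplitAt, Equiv.piSplitAt, hk]
  · intro b _ hb
    simp [del, Pi.single_apply, hb]
  · simp

lemma cv_nonneg (T : Finset α) (σ : ι → α) : 0 ≤ cv T σ := by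
  unfold cv; split_ifs <;> norm_num

lemma ct_nonneg (I : Finset α) (a : ℕ) (σ : ι → α) : 0 ≤ ct I a σ := by
  unfold ct; split_ifs <;> norm_num

lemma cv_update {o : α} {T : Finset α} (ho : o ∉ T) {σ : ι → α} {i : ι} (hi : σ i = o) (j : α) :
    cv T (Function.update σ i j) = cv (T.erase j) σ := by
  unfold cv
  congr 1
  apply propext
  constructor
  · intro h t ht
    obtain ⟨hne, ht⟩ := mem_erase.1 ht
    obtain ⟨k, hk⟩ := h t ht
    by_cases hki : k = i
    · subst hki; simp at hk; exact absurd hk.symm hne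
    · exact ⟨k, by simpa [hki] using hk⟩
  · intro h t ht
    by_cases htj : t = j
    · exact ⟨i, by simp [htj]⟩
    · obtain ⟨k, hk⟩ := h t (mem_erase.2 ⟨htj, ht⟩)
      have hki : k ≠ i := by
        rintro rfl; rw [hi] at hk; exact ho (hk ▸ ht)
      exact ⟨k, by simpa [hki] using hk⟩

lemma cnt_update_mem {o : α} {I : Finset α} (ho : o ∉ I) {σ : ι → α} {i : ι} (hi : σ i = o)
    {j : α} (hj : j ∈ I) : cnt I (Function.update σ i j) = cnt I σ + 1 := by
  unfold cnt
  rw [← card_insert_of_notMem (a := i) (by simp [hi, ho])]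
  congr 1
  ext k
  by_cases hk : k = i
  · subst hk; simp [hj]
  · simp [hk]

lemma cnt_update_not {o : α} {I : Finset α} (ho : o ∉ I) {σ : ι → α} {i : ι} (hi : σ i = o)
    {j : α} (hj : j ∉ I) : cnt I (Function.update σ i j) = cnt I σ := by
  unfold cnt
  congr 1
  ext k
  by_cases hk : k = i
  · subst hk; simp [hj, hi, ho]
  · simp [hk]

lemma V_expand {o : α} {I T : Finset α} (hoI : o ∉ I) (hoT : o ∉ T) (p : ι → α → ℝ) (i : ι)
    (Φ : (ι → α) → ℝ) (a : ℕ) :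
    V p I T Φ a = ∑ j, p i j * (if j ∈ I then
      sh (V (del o p i) I (T.erase j) (fun σ => Φ (Function.update σ i j))) a
      else V (del o p i) I (T.erase j) (fun σ => Φ (Function.update σ i j)) a) := by
  unfold V
  rw [Ex_expand o p i]
  refine sum_congr rfl fun j _ => ?_
  congr 1
  split_ifs with hj
  · cases a with
    | zero =>
      simp only [sh]
      rw [← show Ex (del o p i) (fun _ => 0) = 0 by simp [Ex]]
      refine del_congr fun σ hσ => ?_
      simp [ct, cnt_update_mem hoI hσ hj]
    | succ a =>
      simp only [sh]
      refine del_congr fun σ hσ => ?_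
      simp [ct, cnt_update_mem hoI hσ hj, cv_update hoT hσ]
  · refine del_congr fun σ hσ => ?_
    simp [ct, cnt_update_not hoI hσ hj, cv_update hoT hσ]

lemma V_nonneg {p : ι → α → ℝ} (hp : ∀ i j, 0 ≤ p i j) {I T : Finset α} {Φ : (ι → α) → ℝ}
    (h : ∀ σ, 0 ≤ Φ σ) (a : ℕ) : 0 ≤ V p I T Φ a :=
  Ex_nonneg hp fun σ => mul_nonneg (mul_nonneg (cv_nonneg _ _) (ct_nonneg _ _ _)) (h σ)

lemma U_nonneg {p : ι → α → ℝ} (hp : ∀ i j, 0 ≤ p i j) (I T : Finset α) (a : ℕ) :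
    0 ≤ U p I T a := V_nonneg hp (fun _ => zero_le_one) a

lemma sh_nonneg {f : ℕ → ℝ} (h : ∀ a, 0 ≤ f a) (a : ℕ) : 0 ≤ sh f a := by
  cases a <;> simp [sh, h]

/-- `U` along ball `i`. -/
lemma U_expand {o : α} {I T : Finset α} (hoI : o ∉ I) (hoT : o ∉ T) (hIT : Disjoint I T)
    (p : ι → α → ℝ) (i : ι) (a : ℕ) :
    U p I T a = ∑ j, p i j * (if j ∈ I then sh (U (del o p i) I T) a
      else U (del o p i) I (T.erase j) a) := by
  unfold U
  rw [V_expand hoI hoT p i]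
  refine sum_congr rfl fun j _ => ?_
  congr 1
  split_ifs with hj
  · rw [erase_eq_of_notMem (Finset.disjoint_left.1 hIT hj)]
  · rfl


lemma Le_refl (f : ℕ → ℝ) : Le f f := fun x y _ => by rw [mul_comm]

lemma Le_sum_right {κ : Type} (s : Finset κ) {f : ℕ → ℝ} {c : κ → ℝ} {g : κ → ℕ → ℝ}
    (hc : ∀ k ∈ s, 0 ≤ c k) (h : ∀ k ∈ s, Le f (g k)) : Le f (fun a => ∑ k ∈ s, c k * g k a) := by
  intro x y hxy
  simp only [mul_sum]
  refine sum_le_sum fun k hk => ?_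
  have := mul_le_mul_of_nonneg_left (h k hk x y hxy) (hc k hk)
  linarith

lemma Le_sum_left {κ : Type} (s : Finset κ) {f : ℕ → ℝ} {c : κ → ℝ} {g : κ → ℕ → ℝ}
    (hc : ∀ k ∈ s, 0 ≤ c k) (h : ∀ k ∈ s, Le (g k) f) : Le (fun a => ∑ k ∈ s, c k * g k a) f := by
  intro x y hxy
  simp only [sum_mul]
  refine sum_le_sum fun k hk => ?_
  have := mul_le_mul_of_nonneg_left (h k hk x y hxy) (hc k hk)
  linarith

lemma Le_trans {f h g : ℕ → ℝ} (hf : ∀ a, 0 ≤ f a) (hg : ∀ a, 0 ≤ g a) (hgh : ∀ a, g a ≤ h a)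
    (h1 : Le f h) (h2 : Le h g) : Le f g := by
  intro x y hxy
  have hh : 0 ≤ h y := (hg y).trans (hgh y)
  rcases hh.eq_or_lt with h0 | h0
  · have : g y = 0 := le_antisymm (by rw [h0]; exact hgh y) (hg y)
    rw [this, mul_zero]; exact mul_nonneg (hf _) (hg _)
  · have a1 := mul_le_mul_of_nonneg_right (h1 x y hxy) (hg y)
    have a2 := mul_le_mul_of_nonneg_left (h2 x y hxy) (hf y)
    refine le_of_mul_le_mul_right ?_ h0
    linarith

lemma Le_sh {f g : ℕ → ℝ} (h : Le f g) : Le (sh f) (sh g) := by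
  intro x y hxy
  cases y with
  | zero => simp [sh]
  | succ y =>
    cases x with
    | zero => omega
    | succ x => exact h x y (by omega)

lemma sh_le {f g : ℕ → ℝ} (h : ∀ a, f a ≤ g a) (a : ℕ) : sh f a ≤ sh g a := by
  cases a <;> simp [sh, h]

/-- indicator that ball `i` is in `I` -/
def ii (I : Finset α) (i : ι) (σ : ι → α) : ℝ := if σ i ∈ I then 1 else 0

lemma V_ii {o : α} {I T : Finset α} (hoI : o ∉ I) (hoT : o ∉ T) (hIT : Disjoint I T)
    (p : ι → α → ℝ) (i : ι) (Φ : (ι → α) → ℝ) (a : ℕ) :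
    V p I T (fun σ => ii I i σ * Φ σ) a =
      ∑ j ∈ I, p i j * sh (V (del o p i) I T (fun σ => Φ (Function.update σ i j))) a := by
  rw [V_expand hoI hoT p i, ← Finset.sum_subset (subset_univ I)]
  · refine sum_congr rfl fun j hj => ?_
    rw [if_pos hj, erase_eq_of_notMem (Finset.disjoint_left.1 hIT hj)]
    simp [ii, hj]
  · intro j _ hj
    simp [ii, hj, V, Ex]

lemma sum_ii (I : Finset α) (σ : ι → α) : ∑ i, ii I i σ = cnt I σ := by
  simp [ii, cnt]

lemma sum_V_ii (p : ι → α → ℝ) (I T : Finset α) (Φ : (ι → α) → ℝ) (a : ℕ) :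
    ∑ i, V p I T (fun σ => ii I i σ * Φ σ) a = a * V p I T Φ a := by
  unfold V
  rw [← Ex_sum, ← Ex_smul]
  refine Ex_congr fun σ _ => ?_
  rw [← mul_sum, ← sum_mul, sum_ii]
  unfold ct
  split_ifs with h
  · rw [h]; ring
  · simp

def Act (o : α) (n : ℕ) (p : ι → α → ℝ) : Prop :=
  ∃ A : Finset ι, A.card ≤ n ∧ ∀ i ∉ A, p i = Pi.single o 1

def zB (j : α) (B : Finset ι) (p : ι → α → ℝ) : ι → α → ℝ :=
  fun i l => if i ∈ B ∧ l = j then 0 else p i l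

def z1 (j : α) (k : ι) (p : ι → α → ℝ) : ι → α → ℝ :=
  Function.update p k (Function.update (p k) j 0)

lemma zB_insert (j : α) (B : Finset ι) (k : ι) (p : ι → α → ℝ) :
    zB j (insert k B) p = z1 j k (zB j B p) := by
  ext i l
  unfold zB z1
  by_cases hi : i = k
  · subst hi
    by_cases hl : l = j
    · subst hl; simp
    · simp [hl]
  · simp [hi]

lemma zB_nonneg {p : ι → α → ℝ} (hp : ∀ i j, 0 ≤ p i j) (j : α) (B : Finset ι) :
    ∀ i l, 0 ≤ zB j B p i l := by
  intro i l; unfold zB; split_ifs <;> simp [hp]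

lemma zB_act {o j : α} (hj : j ≠ o) (B : Finset ι) {p : ι → α → ℝ} {n : ℕ} (h : Act o n p) :
    Act o n (zB j B p) := by
  obtain ⟨A, hA, h⟩ := h
  refine ⟨A, hA, fun i hi => ?_⟩
  ext l
  unfold zB
  split_ifs with h1
  · rw [h1.2]; simp [Pi.single_apply, hj]
  · rw [h i hi]

lemma U_z1 {o j : α} {I T : Finset α} (hoI : o ∉ I) (hoT : o ∉ T) (hIT : Disjoint I T)
    (hjT : j ∉ T) (hjI : j ∉ I) (p : ι → α → ℝ) (k : ι) (a : ℕ) :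
    U p I T a = p k j * U (del o p k) I T a + U (z1 j k p) I T a := by
  rw [U_expand hoI hoT hIT p k, U_expand hoI hoT hIT (z1 j k p) k]
  have : del o (z1 j k p) k = del o p k := by simp [del, z1]
  rw [this, ← add_sum_erase _ _ (mem_univ j), ← add_sum_erase (univ : Finset α) (fun l => z1 j k p k l * _) (mem_univ j)]
  simp only [if_neg hjI, erase_eq_of_notMem hjT]
  have : z1 j k p k j = 0 := by simp [z1]
  rw [this, zero_mul, zero_add]
  congr 1
  refine sum_congr rfl fun l hl => ?_
  have : z1 j k p k l = p k l := by simp [z1, ne_of_mem_erase hl]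
  rw [this]

lemma Ex_zB (j : α) (p : ι → α → ℝ) (Φ : (ι → α) → ℝ) :
    Ex (zB j univ p) Φ = Ex p (fun σ => if ∃ i, σ i = j then 0 else Φ σ) := by
  unfold Ex
  refine sum_congr rfl fun σ _ => ?_
  beta_reduce
  split_ifs with h
  · obtain ⟨i, hi⟩ := h
    rw [prod_eq_zero (mem_univ i) (by simp [zB, hi])]; simp
  · congr 1
    refine prod_congr rfl fun i _ => ?_
    unfold zB
    rw [if_neg]
    rintro ⟨_, h1⟩; exact h ⟨i, h1⟩

lemma U_insert (j : α) (p : ι → α → ℝ) (I T : Finset α) (a : ℕ) :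
    U p I (insert j T) a = U p I T a - U (zB j univ p) I T a := by
  rw [eq_sub_iff_add_eq]
  unfold U V
  rw [Ex_zB, ← Ex_add]
  refine Ex_congr fun σ _ => ?_
  unfold cv
  simp only [forall_mem_insert]
  by_cases h : ∃ i, σ i = j
  · simp [h]
  · simp [h]

lemma Ex_point {o : α} (p : ι → α → ℝ) (hp : ∀ i, p i = Pi.single o 1) (Φ : (ι → α) → ℝ) :
    Ex p Φ = Φ (fun _ => o) := by
  unfold Ex
  rw [sum_eq_single (fun _ => o)]
  · simp [hp]
  · intro σ _ h
    obtain ⟨i, hi⟩ := Function.ne_iff.1 h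
    rw [prod_eq_zero (mem_univ i) (by simp [hp, Pi.single_apply, hi]), zero_mul]
  · simp

structure Lev (o : α) (I : Finset α) (n : ℕ) (p : ι → α → ℝ) : Prop where
  lc : ∀ L, o ∉ L → Disjoint I L → Le (U p I L) (sh (U p I L))
  p3 : ∀ L, o ∉ L → Disjoint I L → ∀ j, j ∉ L → j ≠ o → j ∉ I → Le (U p I (insert j L)) (U p I L)
  p2 : ∀ L, o ∉ L → Disjoint I L → ∀ j, j ∉ L → j ≠ o → j ∉ I →
    Le (U p I L) (sh (U p I (insert j L)))

lemma Lev.e1 {o : α} {I : Finset α} {n : ℕ} {p : ι → α → ℝ} (h : Lev o I n p) {L : Finset α}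
    (hoL : o ∉ L) (hIL : Disjoint I L) {l : α} (hl : l ∉ I) : Le (U p I L) (U p I (L.erase l)) := by
  by_cases hlL : l ∈ L
  · have := h.p3 (L.erase l) (fun h => hoL (mem_of_mem_erase h))
      (hIL.mono_right (erase_subset _ _)) l (notMem_erase _ _) (by rintro rfl; exact hoL hlL) hl
    rwa [insert_erase hlL] at this
  · rw [erase_eq_of_notMem hlL]; exact Le_refl _

lemma Lev.e2 {o : α} {I : Finset α} {n : ℕ} {p : ι → α → ℝ} (h : Lev o I n p) {L : Finset α}
    (hoL : o ∉ L) (hIL : Disjoint I L) {l : α} (hl : l ∉ I) :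
    Le (U p I (L.erase l)) (sh (U p I L)) := by
  by_cases hlL : l ∈ L
  · have := h.p2 (L.erase l) (fun h => hoL (mem_of_mem_erase h))
      (hIL.mono_right (erase_subset _ _)) l (notMem_erase _ _) (by rintro rfl; exact hoL hlL) hl
    rwa [insert_erase hlL] at this
  · rw [erase_eq_of_notMem hlL]; exact h.lc L hoL hIL

lemma del_act {o : α} {n : ℕ} {p : ι → α → ℝ} {A : Finset ι} (hA : A.card ≤ n + 1)
    (h : ∀ i ∉ A, p i = Pi.single o 1) {k : ι} (hk : k ∈ A) : Act o n (del o p k) := by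
  refine ⟨A.erase k, by rw [card_erase_of_mem hk]; omega, fun i hi => ?_⟩
  by_cases hik : i = k
  · subst hik; simp [del]
  · simp only [del, Function.update_of_ne hik]
    exact h i fun hiA => hi (mem_erase.2 ⟨hik, hiA⟩)

lemma stepB {o : α} {I : Finset α} (hoI : o ∉ I) {n : ℕ} {p : ι → α → ℝ}
    (hp : ∀ i j, 0 ≤ p i j) (k : ι) (hk : Lev o I n (del o p k)) {L : Finset α}
    (hoL : o ∉ L) (hIL : Disjoint I L) : Le (U p I L) (sh (U (del o p k) I L)) := by
  have : U p I L = fun a => ∑ j, p k j * ((fun j => if j ∈ I then sh (U (del o p k) I L)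
      else U (del o p k) I (L.erase j)) j a) := by
    ext a
    rw [U_expand hoI hoL hIL p k]
    refine sum_congr rfl fun j _ => ?_
    simp only
    split_ifs <;> rfl
  rw [this]
  refine Le_sum_left _ (fun j _ => hp k j) fun j _ => ?_
  split_ifs with hj
  · exact Le_refl _
  · exact hk.e2 hoL hIL hj

lemma step3 {o : α} {I : Finset α} (hoI : o ∉ I) {n : ℕ} {p : ι → α → ℝ}
    (hp : ∀ i j, 0 ≤ p i j) (k : ι) (hk : Lev o I n (del o p k)) {L : Finset α}
    (hoL : o ∉ L) (hIL : Disjoint I L) : Le (U (del o p k) I L) (U p I L) := by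
  have : U p I L = fun a => ∑ j, p k j * ((fun j => if j ∈ I then sh (U (del o p k) I L)
      else U (del o p k) I (L.erase j)) j a) := by
    ext a
    rw [U_expand hoI hoL hIL p k]
    refine sum_congr rfl fun j _ => ?_
    simp only
    split_ifs <;> rfl
  rw [this]
  refine Le_sum_right _ (fun j _ => hp k j) fun j _ => ?_
  split_ifs with hj
  · exact hk.lc L hoL hIL
  · exact hk.e1 hoL hIL hj

lemma Act.mono {o : α} {n m : ℕ} (hnm : n ≤ m) {p : ι → α → ℝ} (h : Act o n p) : Act o m p := by
  obtain ⟨A, hA, h⟩ := h; exact ⟨A, hA.trans hnm, h⟩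

theorem lev {o : α} {I : Finset α} (hoI : o ∉ I) (n : ℕ) : ∀ p : ι → α → ℝ,
    (∀ i j, 0 ≤ p i j) → Act o n p → Lev o I n p := by
  induction n with
  | zero =>
    rintro p hp ⟨A, hA, h⟩
    have hA : A = ∅ := by simpa using hA
    subst hA
    have hU : ∀ L, o ∉ L → ∀ a, U p I L (a + 1) = 0 := by
      intro L hoL a
      unfold U V
      rw [Ex_point p (fun i => h i (by simp))]
      have : ct I (a + 1) (fun _ : ι => o) = 0 := by simp [ct, cnt, hoI]
      rw [this]; ring
    have hI : ∀ L j, j ≠ o → ∀ a, U p I (insert j L) a = 0 := by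
      intro L j hj a
      unfold U V
      rw [Ex_point p (fun i => h i (by simp))]
      have : cv (insert j L) (fun _ : ι => o) = 0 := by
        unfold cv; rw [if_neg]; intro h'
        obtain ⟨_, h''⟩ := h' j (mem_insert_self _ _)
        exact hj h''.symm
      rw [this]; ring
    refine ⟨fun L hoL hIL => ?_, fun L hoL hIL j hjL hj hjI => ?_, fun L hoL hIL j hjL hj hjI => ?_⟩
    · intro x y hxy
      cases y with
      | zero => simpa [sh] using mul_nonneg (U_nonneg hp _ _ _) (sh_nonneg (U_nonneg hp _ _) _)
      | succ y =>
        cases x with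
        | zero => omega
        | succ x => simp [hU L hoL]
    · intro x y hxy
      simp [hI L j hj]
    · intro x y hxy
      have : ∀ x, sh (U p I (insert j L)) x = 0 := by
        intro x; cases x <;> simp [sh, hI L j hj]
      simp [this]
  | succ n ih =>
    -- S3 for all active sets of size at most n+1
    have S3 : ∀ p : ι → α → ℝ, (∀ i j, 0 ≤ p i j) → Act o (n + 1) p → ∀ L, o ∉ L → Disjoint I L →
        ∀ k, Le (U (del o p k) I L) (U p I L) := by
      rintro p hp ⟨A, hA, h⟩ L hoL hIL k
      by_cases hk : k ∈ A
      · exact step3 hoI hp k (ih _ (del_nonneg hp k) (del_act hA h hk)) hoL hIL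
      · have : del o p k = p := by rw [del, ← h k hk, Function.update_eq_self]
        rw [this]; exact Le_refl _
    have S3a : ∀ p : ι → α → ℝ, (∀ i j, 0 ≤ p i j) → Act o (n + 1) p → ∀ L, o ∉ L → Disjoint I L →
        ∀ j, j ∉ L → j ≠ o → j ∉ I → ∀ B : Finset ι,
        Le (U p I L) (U (zB j B p) I L) ∧ ∀ a, U (zB j B p) I L a ≤ U p I L a := by
      intro p hp hact L hoL hIL j hjL hj hjI B
      induction B using Finset.induction_on with
      | empty =>
        have : zB j (∅ : Finset ι) p = p := by ext; simp [zB]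
        rw [this]; exact ⟨Le_refl _, fun _ => le_rfl⟩
      | insert k B hk ihB =>
        set q := zB j B p with hq
        have hq0 : ∀ i l, 0 ≤ q i l := zB_nonneg hp j B
        have hqa : Act o (n + 1) q := zB_act hj B hact
        have hr0 : ∀ i l, 0 ≤ z1 j k q i l := by rw [← zB_insert]; exact zB_nonneg hp j _
        have hra : Act o (n + 1) (z1 j k q) := by rw [← zB_insert]; exact zB_act hj _ hact
        rw [zB_insert]
        have e := U_z1 hoI hoL hIL hjL hjI q k
        have hle : ∀ a, U (z1 j k q) I L a ≤ U q I L a := fun a => by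
          rw [e a]
          have := mul_nonneg (hq0 k j) (U_nonneg (del_nonneg (o := o) hq0 k) I L a)
          linarith
        refine ⟨?_, fun a => (hle a).trans (ihB.2 a)⟩
        refine Le_trans (U_nonneg hp _ _) (U_nonneg hr0 _ _) hle ihB.1 ?_
        intro x y hxy
        rw [e x, e y]
        have h1 := S3 _ hr0 hra L hoL hIL k x y hxy
        have : del o (z1 j k q) k = del o q k := by simp [del, z1]
        rw [this] at h1
        have := mul_le_mul_of_nonneg_left h1 (hq0 k j)
        linarith
    rintro p hp hact
    have hact' := hact
    obtain ⟨A, hA, h⟩ := hact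
    have SB : ∀ k ∈ A, ∀ L, o ∉ L → Disjoint I L → Le (U p I L) (sh (U (del o p k) I L)) :=
      fun k hk L hoL hIL => stepB hoI hp k (ih _ (del_nonneg hp k) (del_act hA h hk)) hoL hIL
    refine ⟨fun L hoL hIL => ?_, fun L hoL hIL j hjL hj hjI => ?_, fun L hoL hIL j hjL hj hjI => ?_⟩
    · intro x y hxy
      cases y with
      | zero => simpa [sh] using mul_nonneg (U_nonneg hp _ _ _) (sh_nonneg (U_nonneg hp _ _) _)
      | succ y =>
        cases x with
        | zero => omega
        | succ x =>
          simp only [sh]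
          by_cases h0 : U p I L (x + 1) = 0
          · rw [h0, zero_mul]; exact mul_nonneg (U_nonneg hp _ _ _) (U_nonneg hp _ _ _)
          · have h1 := sum_V_ii p I L (fun _ => 1) (x + 1)
            have h2 : ∑ i, V p I L (fun σ => ii I i σ * 1) (x + 1) ≠ 0 := by
              rw [h1]; exact mul_ne_zero (by positivity) h0
            obtain ⟨k, _, hk⟩ := exists_ne_zero_of_sum_ne_zero h2
            rw [V_ii hoI hoL hIL p k] at hk
            obtain ⟨j, hj, hk⟩ := exists_ne_zero_of_sum_ne_zero hk
            have hkA : k ∈ A := by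
              by_contra hkA
              have hjo : j ≠ o := by rintro rfl; exact hoI hj
              simp [h k hkA, Pi.single_apply, hjo] at hk
            have hpos : 0 < U (del o p k) I L x :=
              lt_of_le_of_ne (U_nonneg (del_nonneg hp k) _ _ _) (Ne.symm (right_ne_zero_of_mul hk))
            have a1 := SB k hkA L hoL hIL (x + 1) (y + 1) hxy
            simp only [sh] at a1
            have a2 := S3 p hp hact' L hoL hIL k x y (by omega)
            have b1 := mul_le_mul_of_nonneg_right a1 (U_nonneg hp I L x)
            have b2 := mul_le_mul_of_nonneg_left a2 (U_nonneg hp I L (x + 1))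
            refine le_of_mul_le_mul_right ?_ hpos
            linarith
    · intro x y hxy
      have := (S3a p hp hact' L hoL hIL j hjL hj hjI univ).1 x y hxy
      rw [U_insert, U_insert]
      linarith
    · have key : ∀ B : Finset ι, Le (U p I L) (sh (fun a => U p I L a - U (zB j B p) I L a)) := by
        intro B
        induction B using Finset.induction_on with
        | empty =>
          have : zB j (∅ : Finset ι) p = p := by ext; simp [zB]
          rw [this]
          intro x y _
          have : ∀ x, sh (fun a => U p I L a - U p I L a) x = 0 := by
            intro x; cases x <;> simp [sh]
          rw [this, this]; simp
        | insert k B hk ihB =>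
          have e := U_z1 hoI hoL hIL hjL hjI (zB j B p) k
          have hd : del o (zB j B p) k = zB j B (del o p k) := by
            ext i l
            by_cases hik : i = k
            · subst hik; simp [del, zB, hk]
            · simp [del, zB, hik]
          have e2 : zB j B p k j = p k j := by simp [zB, hk]
          rw [hd, e2, ← zB_insert] at e
          have hc : Le (U p I L) (fun a => p k j * sh (U (zB j B (del o p k)) I L) a) := by
            by_cases hkA : k ∈ A
            · have hq := (del_act hA h hkA).mono (Nat.le_succ n)
              have s := S3a _ (del_nonneg hp k) hq L hoL hIL j hjL hj hjI B
              have t := Le_trans (U_nonneg hp _ _)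
                (sh_nonneg (U_nonneg (zB_nonneg (del_nonneg hp k) j B) I L)) (sh_le s.2)
                (SB k hkA L hoL hIL) (Le_sh s.1)
              intro x y hxy
              have := mul_le_mul_of_nonneg_left (t x y hxy) (hp k j)
              simp only
              linarith
            · have : p k j = 0 := by rw [h k hkA]; simp [Pi.single_apply, hj]
              rw [this]; intro x y _; simp
          have eq : ∀ x, sh (fun a => U p I L a - U (zB j (insert k B) p) I L a) x
              = sh (fun a => U p I L a - U (zB j B p) I L a) x
                + p k j * sh (U (zB j B (del o p k)) I L) x := by
            intro x
            cases x with
            | zero => simp [sh]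
            | succ x => simp only [sh]; rw [e x]; ring
          intro x y hxy
          have u1 := ihB x y hxy
          have u2 := hc x y hxy
          rw [eq, eq]
          simp only at u2
          linarith
      have : U p I (insert j L) = fun a => U p I L a - U (zB j univ p) I L a := by
        ext a; exact U_insert _ _ _ _ _
      rw [this]; exact key univ

/-- unconditional form -/
lemma lev' {o : α} {I : Finset α} (hoI : o ∉ I) {p : ι → α → ℝ} (hp : ∀ i j, 0 ≤ p i j) :
    Lev o I (Fintype.card ι) p :=
  lev hoI _ p hp ⟨univ, le_rfl, fun i hi => absurd (mem_univ i) hi⟩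

def MonoI (I : Finset α) (Φ : (ι → α) → ℝ) : Prop :=
  ∀ σ i j, σ i ∉ I → Φ σ ≤ Φ (Function.update σ i j)

lemma MonoI.le_all {I : Finset α} {Φ : (ι → α) → ℝ} (h : MonoI I Φ) {σ : ι → α}
    (hσ : ∀ i, σ i ∉ I) (τ : ι → α) : Φ σ ≤ Φ τ := by
  have key : ∀ S : Finset ι, Φ σ ≤ Φ (S.piecewise τ σ) := by
    intro S
    induction S using Finset.induction_on with
    | empty => simp
    | insert k S hk ih =>
      rw [Finset.piecewise_insert]
      refine ih.trans (h _ _ _ ?_)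
      simp [hk, hσ]
  simpa using key univ

lemma MonoI.const {I : Finset α} {Φ : (ι → α) → ℝ} (h : MonoI I Φ) {o : α} (ho : o ∉ I)
    {σ : ι → α} (hσ : ∀ i, σ i ∉ I) : Φ σ = Φ (fun _ => o) :=
  le_antisymm (h.le_all hσ _) (h.le_all (fun _ => ho) _)

lemma MonoI.eq_update {I : Finset α} {Φ : (ι → α) → ℝ} (h : MonoI I Φ) {σ : ι → α} {i : ι} {j : α}
    (hi : σ i ∉ I) (hj : j ∉ I) : Φ (Function.update σ i j) = Φ σ := by
  refine le_antisymm ?_ (h _ _ _ hi)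
  have := h (Function.update σ i j) i (σ i) (by simpa using hj)
  simpa using this

lemma MonoI.avg {I : Finset α} {Φ : (ι → α) → ℝ} (h : MonoI I Φ) (e : ι) (K : Finset α) {w : α → ℝ}
    (hw : ∀ j, 0 ≤ w j) :
    MonoI I (fun σ => ∑ j ∈ K, w j * Φ (Function.update σ e j)) := by
  intro σ i l hi
  refine sum_le_sum fun j _ => mul_le_mul_of_nonneg_left ?_ (hw j)
  by_cases hie : i = e
  · subst hie; simp
  · rw [Function.update_comm hie]
    exact h _ _ _ (by simpa [hie] using hi)

def meas (o : α) (p : ι → α → ℝ) : ℕ :=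
  (univ.filter fun x : ι × α => x.2 ≠ o ∧ p x.1 x.2 ≠ 0).card

lemma meas_del {o : α} {p : ι → α → ℝ} {i : ι} {j : α} (hj : j ≠ o) (h : p i j ≠ 0) :
    meas o (del o p i) < meas o p := by
  refine card_lt_card (Finset.ssubset_iff_of_subset ?_ |>.2 ⟨(i, j), by simp [hj, h], ?_⟩)
  · rintro ⟨k, l⟩ hx
    simp only [mem_filter, mem_univ, true_and] at hx ⊢
    refine ⟨hx.1, ?_⟩
    by_cases hk : k = i
    · subst hk; exact absurd (by simp [del, Pi.single_apply, hx.1]) hx.2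
    · simpa [del, hk] using hx.2
  · rw [mem_filter]; rintro ⟨_, _, h2⟩; exact h2 (by simp [del, Pi.single_apply, hj])

lemma meas_zr {o : α} {I : Finset α} {p : ι → α → ℝ} {i : ι} {j : α} (hj : j ≠ o) (hjI : j ∈ I)
    (h : p i j ≠ 0) : meas o (zr I p i) < meas o p := by
  refine card_lt_card (Finset.ssubset_iff_of_subset ?_ |>.2 ⟨(i, j), by simp [hj, h], ?_⟩)
  · rintro ⟨k, l⟩ hx
    simp only [mem_filter, mem_univ, true_and] at hx ⊢
    refine ⟨hx.1, ?_⟩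
    by_cases hk : k = i
    · subst hk; intro h0; exact hx.2 (by simp [zr, h0])
    · simpa [zr, hk] using hx.2
  · rw [mem_filter]; rintro ⟨_, _, h2⟩; exact h2 (by simp [zr, hjI])

lemma Ex_zr (I : Finset α) (p : ι → α → ℝ) (i : ι) (Φ : (ι → α) → ℝ) :
    Ex p Φ = Ex p (fun σ => ii I i σ * Φ σ) + Ex (zr I p i) Φ := by
  have : Ex (zr I p i) Φ = Ex p (fun σ => (1 - ii I i σ) * Φ σ) := by
    unfold Ex
    refine sum_congr rfl fun σ _ => ?_
    rw [← mul_assoc]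
    congr 1
    unfold ii
    split_ifs with h
    · rw [prod_eq_zero (mem_univ i) (by simp [zr, h])]; simp
    · rw [sub_zero, mul_one]
      refine prod_congr rfl fun k _ => ?_
      by_cases hk : k = i
      · subst hk; simp [zr, h]
      · simp [zr, hk]
  rw [this, ← Ex_add]
  refine Ex_congr fun σ _ => by ring

lemma V_zr (I T : Finset α) (p : ι → α → ℝ) (i : ι) (Φ : (ι → α) → ℝ) (a : ℕ) :
    V p I T Φ a = V p I T (fun σ => ii I i σ * Φ σ) a + V (zr I p i) I T Φ a := by
  unfold V
  rw [Ex_zr I p i]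
  congr 1
  refine Ex_congr fun σ _ => by ring

lemma V_zero {p : ι → α → ℝ} (hp : ∀ i j, 0 ≤ p i j) {I T : Finset α} {a : ℕ}
    (h : U p I T a = 0) (Φ : (ι → α) → ℝ) : V p I T Φ a = 0 := by
  unfold U V at h
  simp only [mul_one] at h
  exact Ex_zero_mul hp (fun σ => mul_nonneg (cv_nonneg _ _) (ct_nonneg _ _ _)) h Φ

lemma pick {s r : ι → ℝ} (hs : ∀ i, 0 ≤ s i) (h0 : ∀ i, s i = 0 → r i = 0)
    (hS : ∑ i, s i ≠ 0) (hR : 0 ≤ ∑ i, r i) : ∃ i, 0 < s i ∧ 0 ≤ r i := by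
  by_contra hcon
  push Not at hcon
  obtain ⟨e, _, he⟩ := exists_ne_zero_of_sum_ne_zero hS
  have he' : 0 < s e := lt_of_le_of_ne (hs e) he.symm
  have : ∑ i, r i < ∑ i : ι, (0 : ℝ) := by
    refine sum_lt_sum (fun i _ => ?_) ⟨e, mem_univ _, hcon e he'⟩
    rcases (hs i).eq_or_lt with h | h
    · exact (h0 i h.symm).le
    · exact (hcon i h).le
  simp at this
  linarith

lemma alg1 {X X' Y Y' XF XF' YF YF' : ℝ} (hX : 0 < X) (hY : 0 ≤ Y) (hX' : 0 ≤ X') (hY' : 0 ≤ Y')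
    (z1 : Y = 0 → YF = 0) (z2 : Y' = 0 → YF' = 0)
    (h1 : XF * X' ≤ XF' * X) (h2 : YF * Y' ≤ YF' * Y) (hP : Y' * X ≤ Y * X')
    (hc : YF * X ≤ XF * Y) : (XF + YF) * (X' + Y') ≤ (XF' + YF') * (X + Y) := by
  rcases hY.eq_or_lt with h | h
  · subst h
    have e1 : Y' = 0 := by
      by_contra hne
      have := mul_pos (lt_of_le_of_ne hY' (Ne.symm hne)) hX
      linarith
    rw [z1 rfl, z2 e1, e1]; linarith
  · have k := mul_nonneg (sub_nonneg.2 hc) (sub_nonneg.2 hP)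
    have m1 := mul_le_mul_of_nonneg_right h1 (mul_nonneg h.le (add_pos hX h).le)
    have m2 := mul_le_mul_of_nonneg_right h2 (mul_nonneg hX.le (add_pos hX h).le)
    refine le_of_mul_le_mul_right ?_ (mul_pos hX h)
    nlinarith

lemma V_ii' {o : α} {I T : Finset α} (hoI : o ∉ I) (hoT : o ∉ T) (hIT : Disjoint I T)
    (p : ι → α → ℝ) (i : ι) (Φ : (ι → α) → ℝ) (a : ℕ) :
    V p I T (fun σ => ii I i σ * Φ σ) a =
      sh (V (del o p i) I T (fun σ => ∑ j ∈ I, p i j * Φ (Function.update σ i j))) a := by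
  rw [V_ii hoI hoT hIT]
  cases a with
  | zero => simp [sh]
  | succ a =>
    simp only [sh, V]
    simp only [← Ex_smul]
    rw [← Ex_sum]
    refine Ex_congr fun σ _ => ?_
    rw [mul_sum]
    refine sum_congr rfl fun j _ => by ring

theorem dom {o : α} {I T : Finset α} (hoI : o ∉ I) (hoT : o ∉ T) (hIT : Disjoint I T) (N : ℕ) :
    ∀ (p : ι → α → ℝ) (Φ : (ι → α) → ℝ), (∀ i j, 0 ≤ p i j) → MonoI I Φ → meas o p < N →
    ∀ x y, y ≤ x → V p I T Φ y * U p I T x ≤ V p I T Φ x * U p I T y := by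
  induction N with
  | zero => intro p Φ _ _ h; omega
  | succ N ih =>
    intro p Φ hp hΦ hN x y hxy
    cases y with
    | zero =>
      set m := Φ (fun _ => o) with hm
      have e1 : V p I T Φ 0 = m * U p I T 0 := by
        unfold U V
        rw [← Ex_smul]
        refine Ex_congr fun σ _ => ?_
        by_cases h : cnt I σ = 0
        · rw [hΦ.const hoI]
          · ring
          · intro i hi
            simp only [cnt, card_eq_zero, filter_eq_empty_iff] at h
            exact h (mem_univ i) hi
        · simp [ct, h]
      have e2 : m * U p I T x ≤ V p I T Φ x := by
        unfold U V
        rw [← Ex_smul]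
        refine Ex_mono hp fun σ _ => ?_
        have := hΦ.le_all (σ := fun _ => o) (fun _ => hoI) σ
        have := mul_le_mul_of_nonneg_left this
          (mul_nonneg (cv_nonneg T σ) (ct_nonneg I x σ))
        rw [hm]
        linarith
      rw [e1]
      have := mul_le_mul_of_nonneg_right e2 (U_nonneg hp I T 0)
      linarith
    | succ y =>
      obtain ⟨x, rfl⟩ : ∃ x', x = x' + 1 := ⟨x - 1, by omega⟩
      by_cases h0 : U p I T (y + 1) = 0
      · rw [h0, V_zero hp h0]; simp
      have hs : ∑ i, V p I T (fun σ => ii I i σ * 1) (y + 1) ≠ 0 := by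
        rw [sum_V_ii]; exact mul_ne_zero (by positivity) h0
      have hii : ∀ (i : ι) (σ : ι → α), 0 ≤ ii I i σ * (1 : ℝ) := fun i σ => by
        unfold ii; split_ifs <;> norm_num
      have hvan : ∀ i, V p I T (fun σ => ii I i σ * 1) (y + 1) = 0 →
          V p I T (fun σ => ii I i σ * Φ σ) (y + 1) = 0 := by
        intro i hi
        unfold V at hi ⊢
        have := Ex_zero_mul hp (fun σ => mul_nonneg (mul_nonneg (cv_nonneg _ _)
          (ct_nonneg _ _ _)) (hii i σ)) hi Φ
        rw [← this]
        refine Ex_congr fun σ _ => by ring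
      obtain ⟨e, he, hr⟩ := pick (s := fun i => V p I T (fun σ => ii I i σ * 1) (y + 1))
        (r := fun i => V p I T (fun σ => ii I i σ * Φ σ) (y + 1) * U p I T (y + 1) -
          V p I T Φ (y + 1) * V p I T (fun σ => ii I i σ * 1) (y + 1))
        (fun i => V_nonneg hp (hii i) _) (fun i hi => by
          rw [hvan i hi, hi]; ring) hs (by
          rw [sum_sub_distrib, ← sum_mul, ← mul_sum, sum_V_ii, sum_V_ii]
          unfold U
          apply le_of_eq; ring)
      have hact : ∃ j ∈ I, p e j ≠ 0 := by
        rw [V_ii hoI hoT hIT] at he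
        obtain ⟨j, hj, h⟩ := exists_ne_zero_of_sum_ne_zero he.ne'
        exact ⟨j, hj, left_ne_zero_of_mul h⟩
      obtain ⟨j, hj, hpj⟩ := hact
      have hjo : j ≠ o := by rintro rfl; exact hoI hj
      have md := meas_del hjo hpj
      have mz := meas_zr hjo hj hpj
      have IH1 := ih (del o p e) _ (del_nonneg hp e) (hΦ.avg e I (hp e)) (by omega) x y (by omega)
      have IH2 := ih (zr I p e) Φ (zr_nonneg hp e) hΦ (by omega) (x + 1) (y + 1) hxy
      have P := stepB hoI (zr_nonneg (I := I) hp e) e (lev' hoI (del_nonneg (zr_nonneg hp e) e))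
        hoT hIT (x + 1) (y + 1) hxy
      rw [del_zr] at P
      have eU : ∀ a, V p I T (fun σ => ii I e σ * 1) (a + 1) =
          (∑ j ∈ I, p e j) * U (del o p e) I T a := by
        intro a
        rw [V_ii hoI hoT hIT, sum_mul]; rfl
      have hc : 0 ≤ ∑ j ∈ I, p e j := sum_nonneg fun j _ => hp e j
      have sF := fun a => V_zr I T p e Φ a
      have sU : ∀ a, U p I T a = V p I T (fun σ => ii I e σ * 1) a + U (zr I p e) I T a :=
        fun a => V_zr I T p e (fun _ => 1) a
      have eF := fun a => V_ii' hoI hoT hIT p e Φ (a + 1)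
      simp only [sh] at eF P hr
      rw [sF, sF, sU, sU]
      refine alg1 he (U_nonneg (zr_nonneg hp e) _ _ _) (V_nonneg hp (hii e) _)
        (U_nonneg (zr_nonneg hp e) _ _ _) (fun h => V_zero (zr_nonneg hp e) h _)
        (fun h => V_zero (zr_nonneg hp e) h _) ?_ IH2 ?_ ?_
      · rw [eU, eU, eF, eF]
        have := mul_le_mul_of_nonneg_left IH1 hc
        linarith
      · rw [eU, eU]
        have := mul_le_mul_of_nonneg_left P hc
        linarith
      · rw [sF, sU] at hr
        linarith

lemma ii_nonneg (I : Finset α) (i : ι) (σ : ι → α) : 0 ≤ ii I i σ := by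
  unfold ii; split_ifs <;> norm_num

/-- weighted expectation restricted to `T` covered -/
def EE (p : ι → α → ℝ) (T : Finset α) (Φ : (ι → α) → ℝ) : ℝ := Ex p (fun σ => cv T σ * Φ σ)

lemma EE_congr {p : ι → α → ℝ} {T : Finset α} {Φ Ψ : (ι → α) → ℝ} (h : ∀ σ, Φ σ = Ψ σ) :
    EE p T Φ = EE p T Ψ := by
  rw [show Φ = Ψ from funext h]

lemma EE_zero {p : ι → α → ℝ} (hp : ∀ i j, 0 ≤ p i j) {T : Finset α} {Θ : (ι → α) → ℝ}
    (hΘ : ∀ σ, 0 ≤ Θ σ) (h : EE p T Θ = 0) (Φ : (ι → α) → ℝ) : EE p T (fun σ => Θ σ * Φ σ) = 0 := by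
  have := Ex_zero_mul hp (fun σ => mul_nonneg (cv_nonneg T σ) (hΘ σ)) h Φ
  unfold EE
  rw [← this]
  refine Ex_congr fun σ _ => by ring

lemma cnt_lt (I : Finset α) (σ : ι → α) : cnt I σ < Fintype.card ι + 1 :=
  Nat.lt_succ_of_le (card_le_univ _)

lemma EE_level (p : ι → α → ℝ) (I T : Finset α) (Φ : (ι → α) → ℝ) (w : ℕ → ℝ) :
    EE p T (fun σ => w (cnt I σ) * Φ σ) =
      ∑ a ∈ range (Fintype.card ι + 1), w a * V p I T Φ a := by
  unfold EE V
  simp only [← Ex_smul]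
  rw [← Ex_sum]
  refine Ex_congr fun σ _ => ?_
  rw [sum_eq_single (cnt I σ)]
  · simp [ct]; ring
  · intro b _ hb
    simp [ct, hb.symm]
  · intro h; exact absurd (mem_range.2 (cnt_lt I σ)) h

lemma cheb (M : ℕ) (v u : ℕ → ℝ) (h : ∀ x y, y ≤ x → v y * u x ≤ v x * u y) :
    (∑ a ∈ range M, 1 * v a) * (∑ a ∈ range M, (a : ℝ) * u a) ≤
      (∑ a ∈ range M, (a : ℝ) * v a) * (∑ a ∈ range M, 1 * u a) := by
  simp only [one_mul]
  rw [sum_mul_sum, sum_mul_sum, ← sub_nonneg, ← sum_sub_distrib]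
  simp only [← sum_sub_distrib]
  set S := ∑ a ∈ range M, ∑ b ∈ range M, ((a : ℝ) * v a * u b - v a * (b * u b)) with hS
  have hS2 : S = ∑ a ∈ range M, ∑ b ∈ range M, ((b : ℝ) * v b * u a - v b * (a * u a)) := by
    rw [hS, sum_comm]
  have : 0 ≤ S + S := by
    nth_rewrite 2 [hS2]
    rw [hS, ← sum_add_distrib]
    refine sum_nonneg fun a _ => ?_
    rw [← sum_add_distrib]
    refine sum_nonneg fun b _ => ?_
    have e : (a : ℝ) * v a * u b - v a * (b * u b) + (b * v b * u a - v b * (a * u a)) =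
      ((a : ℝ) - b) * (v a * u b - v b * u a) := by ring
    rw [e]
    rcases le_total b a with hab | hab
    · exact mul_nonneg (sub_nonneg.2 (by exact_mod_cast hab)) (sub_nonneg.2 (h a b hab))
    · exact mul_nonneg_of_nonpos_of_nonpos (sub_nonpos.2 (by exact_mod_cast hab))
        (by have := h b a hab; linarith)
  linarith

lemma cov_cnt {o : α} {I T : Finset α} (hoI : o ∉ I) (hoT : o ∉ T) (hIT : Disjoint I T)
    {p : ι → α → ℝ} (hp : ∀ i j, 0 ≤ p i j) {Φ : (ι → α) → ℝ} (hΦ : MonoI I Φ) :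
    EE p T Φ * EE p T (fun σ => (cnt I σ : ℝ)) ≤
      EE p T (fun σ => (cnt I σ : ℝ) * Φ σ) * EE p T (fun _ => 1) := by
  have := cheb (Fintype.card ι + 1) (V p I T Φ) (U p I T)
    (dom hoI hoT hIT _ p Φ hp hΦ (Nat.lt_succ_self _))
  have e1 := EE_level p I T Φ (fun _ => 1)
  have e2 := EE_level p I T (fun _ => 1) (fun a => (a : ℝ))
  have e3 := EE_level p I T Φ (fun a => (a : ℝ))
  have e4 := EE_level p I T (fun _ => 1) (fun _ => 1)
  simp only [one_mul, mul_one] at e1 e2 e3 e4 this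
  rw [e1, e2, e3, e4]
  exact this

lemma EE_sum_ii (p : ι → α → ℝ) (I T : Finset α) (Φ : (ι → α) → ℝ) :
    ∑ i, EE p T (fun σ => ii I i σ * Φ σ) = EE p T (fun σ => (cnt I σ : ℝ) * Φ σ) := by
  unfold EE
  rw [← Ex_sum]
  refine Ex_congr fun σ _ => ?_
  rw [← mul_sum, ← sum_mul, sum_ii]

lemma EE_zr (I T : Finset α) (p : ι → α → ℝ) (i : ι) (Φ : (ι → α) → ℝ) :
    EE p T Φ = EE p T (fun σ => ii I i σ * Φ σ) + EE (zr I p i) T Φ := by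
  unfold EE
  rw [Ex_zr I p i]
  congr 1
  refine Ex_congr fun σ _ => by ring

lemma EE_expand {o : α} {T : Finset α} (hoT : o ∉ T) (p : ι → α → ℝ) (i : ι)
    (Φ : (ι → α) → ℝ) :
    EE p T Φ = ∑ j, p i j * EE (del o p i) (T.erase j) (fun σ => Φ (Function.update σ i j)) := by
  unfold EE
  rw [Ex_expand o p i]
  refine sum_congr rfl fun j _ => ?_
  congr 1
  refine del_congr fun σ hσ => ?_
  rw [cv_update hoT hσ]

lemma EE_ii {o : α} {I T : Finset α} (hoT : o ∉ T) (hIT : Disjoint I T)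
    (p : ι → α → ℝ) (i : ι) (Φ : (ι → α) → ℝ) :
    EE p T (fun σ => ii I i σ * Φ σ) =
      EE (del o p i) T (fun σ => ∑ j ∈ I, p i j * Φ (Function.update σ i j)) := by
  rw [EE_expand hoT p i, ← Finset.sum_subset (subset_univ I)]
  · unfold EE
    simp only [← Ex_smul]
    rw [← Ex_sum]
    refine Ex_congr fun σ _ => ?_
    rw [mul_sum]
    refine sum_congr rfl fun j hj => ?_
    rw [erase_eq_of_notMem (Finset.disjoint_left.1 hIT hj)]
    simp [ii, hj]
    ring
  · intro j _ hj
    simp [ii, hj, EE, Ex]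

lemma alg2 {u v uF vF uG vG uFG vFG : ℝ} (hu : 0 < u) (hv : 0 ≤ v)
    (z1 : v = 0 → vF = 0) (z2 : v = 0 → vG = 0) (z3 : v = 0 → vFG = 0)
    (h1 : uFG * u ≤ uF * uG) (h2 : vFG * v ≤ vF * vG) (hN : uG * v ≤ vG * u)
    (hc : vF * u ≤ uF * v) : (uFG + vFG) * (u + v) ≤ (uF + vF) * (uG + vG) := by
  rcases hv.eq_or_lt with h | h
  · rw [z1 h.symm, z2 h.symm, z3 h.symm, ← h]; linarith
  · have k := mul_nonneg (sub_nonneg.2 hc) (sub_nonneg.2 hN)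
    have m1 := mul_le_mul_of_nonneg_right h1 (mul_nonneg h.le (add_pos hu h).le)
    have m2 := mul_le_mul_of_nonneg_right h2 (mul_nonneg hu.le (add_pos hu h).le)
    refine le_of_mul_le_mul_right ?_ (mul_pos hu h)
    nlinarith

def oc (j : α) (σ : ι → α) : ℝ := if ∃ i, σ i = j then 1 else 0

lemma oc_mono (j : α) : MonoI {j} (oc (ι := ι) j) := by
  intro σ i l hi
  unfold oc
  by_cases h : ∃ i, σ i = j
  · obtain ⟨k, hk⟩ := h
    have hki : k ≠ i := by rintro rfl; simp [hk] at hi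
    rw [if_pos ⟨k, hk⟩, if_pos ⟨k, by simpa [hki] using hk⟩]
  · rw [if_neg h]; split_ifs <;> norm_num

lemma cv_erase {T : Finset α} {j : α} (hj : j ∈ T) (σ : ι → α) :
    cv (T.erase j) σ * oc j σ = cv T σ := by
  have : T = insert j (T.erase j) := (insert_erase hj).symm
  conv_rhs => rw [this]
  unfold cv oc
  simp only [forall_mem_insert]
  by_cases h : ∃ i, σ i = j
  · simp [h]
  · simp [h]

theorem na {o : α} (N : ℕ) : ∀ (p : ι → α → ℝ) (I J T : Finset α) (Φ Ψ : (ι → α) → ℝ),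
    (∀ i j, 0 ≤ p i j) → o ∉ I → o ∉ J → o ∉ T → Disjoint I J → Disjoint I T → Disjoint J T →
    MonoI I Φ → MonoI J Ψ → meas o p < N →
    EE p T (fun σ => Φ σ * Ψ σ) * EE p T (fun _ => 1) ≤ EE p T Φ * EE p T Ψ := by
  induction N with
  | zero => intro p I J T Φ Ψ _ _ _ _ _ _ _ _ _ h; omega
  | succ N ih =>
    intro p I J T Φ Ψ hp hoI hoJ hoT hIJ hIT hJT hΦ hΨ hN
    have hcn : ∀ σ : ι → α, (0 : ℝ) ≤ cnt I σ := fun σ => by positivity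
    by_cases h0 : EE p T (fun σ => (cnt I σ : ℝ)) = 0
    · have key : ∀ G : (ι → α) → ℝ, EE p T (fun σ => Φ σ * G σ) = Φ (fun _ => o) * EE p T G := by
        intro G
        have := EE_zero hp hcn h0 (fun σ => (Φ σ - Φ (fun _ => o)) / cnt I σ * G σ)
        rw [← sub_eq_zero, ← this, sub_eq_iff_eq_add]
        unfold EE
        rw [← Ex_smul, ← Ex_add]
        refine Ex_congr fun σ _ => ?_
        beta_reduce
        by_cases h : cnt I σ = 0
        · rw [hΦ.const hoI (σ := σ)]
          · rw [h]; simp; ring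
          · intro i hi
            simp only [cnt, card_eq_zero, filter_eq_empty_iff] at h
            exact h (mem_univ i) hi
        · have : (cnt I σ : ℝ) ≠ 0 := by exact_mod_cast h
          field_simp
          ring
      have k1 := key (fun _ => 1)
      simp only [mul_one] at k1
      rw [key Ψ, k1]
      apply le_of_eq; ring
    have hs : ∑ i, EE p T (fun σ => ii I i σ * 1) ≠ 0 := by
      rw [EE_sum_ii]; simpa using h0
    have hii : ∀ (i : ι) (σ : ι → α), 0 ≤ ii I i σ * (1 : ℝ) := fun i σ => by
      simpa using ii_nonneg I i σ
    obtain ⟨e, he, hr⟩ := pick (s := fun i => EE p T (fun σ => ii I i σ * 1))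
      (r := fun i => EE p T (fun σ => ii I i σ * Φ σ) * EE p T (fun _ => 1) -
        EE p T Φ * EE p T (fun σ => ii I i σ * 1))
      (fun i => Ex_nonneg hp fun σ => mul_nonneg (cv_nonneg _ _) (hii i σ)) (fun i hi => by
        have := EE_zero hp (hii i) hi Φ
        simp only [mul_one] at this
        rw [this, hi]; ring) hs (by
        rw [sum_sub_distrib, ← sum_mul, ← mul_sum, EE_sum_ii, EE_sum_ii]
        have := cov_cnt hoI hoT hIT hp hΦ
        simp only [mul_one]
        linarith)
    have eU : EE p T (fun σ => ii I e σ * 1) = (∑ j ∈ I, p e j) * EE (del o p e) T (fun _ => 1) := by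
      rw [EE_ii hoT hIT p e]
      unfold EE
      rw [← Ex_smul]
      refine Ex_congr fun σ _ => by simp [mul_comm]
    have eF := EE_ii hoT hIT p e Φ
    have eG : EE p T (fun σ => ii I e σ * Ψ σ) = (∑ j ∈ I, p e j) * EE (del o p e) T Ψ := by
      rw [EE_ii hoT hIT p e]
      unfold EE
      rw [← Ex_smul]
      refine del_congr fun σ hσ => ?_
      rw [mul_sum, sum_mul]
      refine sum_congr rfl fun j hj => ?_
      rw [hΨ.eq_update (by rw [hσ]; exact hoJ) (Finset.disjoint_left.1 hIJ hj)]
      ring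
    have eFG : EE p T (fun σ => ii I e σ * (Φ σ * Ψ σ)) =
        EE (del o p e) T (fun σ => (∑ j ∈ I, p e j * Φ (Function.update σ e j)) * Ψ σ) := by
      rw [EE_ii hoT hIT p e]
      unfold EE
      refine del_congr fun σ hσ => ?_
      congr 1
      beta_reduce
      rw [sum_mul]
      refine sum_congr rfl fun j hj => ?_
      rw [hΨ.eq_update (by rw [hσ]; exact hoJ) (Finset.disjoint_left.1 hIJ hj)]
      ring
    have hc : 0 ≤ ∑ j ∈ I, p e j := sum_nonneg fun j _ => hp e j
    have hact : ∃ j ∈ I, p e j ≠ 0 := by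
      rw [eU] at he
      exact exists_ne_zero_of_sum_ne_zero (left_ne_zero_of_mul he.ne')
    obtain ⟨j, hj, hpj⟩ := hact
    have hjo : j ≠ o := by rintro rfl; exact hoI hj
    have md := meas_del hjo hpj
    have mz := meas_zr hjo hj hpj
    have hd := del_nonneg (o := o) hp e
    have hz := zr_nonneg (I := I) hp e
    have IH1 := ih (del o p e) I J T _ Ψ hd hoI hoJ hoT hIJ hIT hJT (hΦ.avg e I (hp e)) hΨ (by omega)
    have IH2 := ih (zr I p e) I J T Φ Ψ hz hoI hoJ hoT hIJ hIT hJT hΦ hΨ (by omega)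
    have NN : EE (del o p e) T Ψ * EE (zr I p e) T (fun _ => 1) ≤
        EE (zr I p e) T Ψ * EE (del o p e) T (fun _ => 1) := by
      rw [EE_expand hoT (zr I p e) e, EE_expand hoT (zr I p e) e Ψ, del_zr, mul_sum, sum_mul]
      refine sum_le_sum fun l _ => ?_
      have hzl := hz e l
      suffices hsuf : EE (del o p e) T Ψ * EE (del o p e) (T.erase l) (fun _ => 1) ≤
          EE (del o p e) (T.erase l) (fun σ => Ψ (Function.update σ e l)) *
            EE (del o p e) T (fun _ => 1) by
        have := mul_le_mul_of_nonneg_left hsuf hzl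
        linarith
      by_cases hl : l ∈ T
      · have hlJ : l ∉ J := Finset.disjoint_right.1 hJT hl
        have hlo : l ≠ o := by rintro rfl; exact hoT hl
        have I3 := ih (del o p e) {l} J (T.erase l) (oc l) Ψ hd (by simpa using hlo.symm) hoJ
          (fun h => hoT (mem_of_mem_erase h)) (by simpa using hlJ) (by simp)
          (hJT.mono_right (erase_subset _ _)) (oc_mono l) hΨ (by omega)
        have c1 : EE (del o p e) (T.erase l) (fun σ => oc l σ * Ψ σ) = EE (del o p e) T Ψ := by
          unfold EE
          refine Ex_congr fun σ _ => ?_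
          rw [← mul_assoc, cv_erase hl]
        have c2 : EE (del o p e) (T.erase l) (oc l) = EE (del o p e) T (fun _ => 1) := by
          unfold EE
          refine Ex_congr fun σ _ => ?_
          rw [cv_erase hl, mul_one]
        have c3 : EE (del o p e) (T.erase l) (fun σ => Ψ (Function.update σ e l)) =
            EE (del o p e) (T.erase l) Ψ := by
          unfold EE
          refine del_congr fun σ hσ => ?_
          beta_reduce
          rw [hΨ.eq_update (by rw [hσ]; exact hoJ) hlJ]
        rw [c1, c2] at I3
        rw [c3]
        linarith
      · rw [erase_eq_of_notMem hl]
        refine mul_le_mul_of_nonneg_right ?_ (Ex_nonneg hd fun σ =>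
          mul_nonneg (cv_nonneg _ _) zero_le_one)
        refine Ex_mono hd fun σ hσ => mul_le_mul_of_nonneg_left ?_ (cv_nonneg _ _)
        exact hΨ _ _ _ (by rw [del_supp hσ]; exact hoJ)
    have hv : 0 ≤ EE (zr I p e) T (fun _ => 1) := Ex_nonneg hz fun σ =>
      mul_nonneg (cv_nonneg _ _) zero_le_one
    have hzz : ∀ G : (ι → α) → ℝ, EE (zr I p e) T (fun _ => 1) = 0 → EE (zr I p e) T G = 0 := by
      intro G h
      have := EE_zero hz (fun _ => zero_le_one) h G
      simpa using this
    have s1 := EE_zr I T p e (fun _ => 1)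
    have s2 := EE_zr I T p e Φ
    have s3 := EE_zr I T p e Ψ
    have s4 := EE_zr I T p e (fun σ => Φ σ * Ψ σ)
    rw [s1, s2, s3, s4]
    refine alg2 he hv (hzz _) (hzz _) (hzz _) ?_ IH2 ?_ ?_
    · rw [eFG, eU, eF, eG]
      have := mul_le_mul_of_nonneg_left IH1 hc
      linarith
    · rw [eG, eU]
      have := mul_le_mul_of_nonneg_left NN hc
      linarith
    · rw [s1, s2] at hr
      linarith

def pt {m n : ℕ} (p : Fin m → Fin n → ℝ) (T : Finset (Fin n)) (b : Fin n → ℕ) :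
    Fin m → Option (Fin n) → ℝ
  | _, none => 0
  | i, some j => if j ∈ T ∧ b j = 0 then 0 else p i j

def T1 {n : ℕ} (T : Finset (Fin n)) (b : Fin n → ℕ) : Finset (Option (Fin n)) :=
  (T.filter fun j => b j = 1).image some

def IA {n : ℕ} (T : Finset (Fin n)) (A : Set (Fin n → ℕ)) : Finset (Option (Fin n)) :=
  (univ.filter fun j => j ∉ T ∧ Affects j A).image some

def xs {m n : ℕ} (T : Finset (Fin n)) (b : Fin n → ℕ) (σ : Fin m → Option (Fin n)) : Fin n → ℕ :=
  fun j => if j ∈ T then b j else if ∃ i, σ i = some j then 1 else 0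

def ind {m n : ℕ} (T : Finset (Fin n)) (b : Fin n → ℕ) (A : Set (Fin n → ℕ))
    (σ : Fin m → Option (Fin n)) : ℝ := if xs T b σ ∈ A then 1 else 0

lemma occ_eq {m n : ℕ} (σ : Fin m → Fin n) (j : Fin n) :
    occVector σ j = if ∃ i, σ i = j then 1 else 0 := by
  unfold occVector ballCount
  congr 1
  apply propext
  rw [Nat.one_le_iff_ne_zero, Ne, card_eq_zero, filter_eq_empty_iff]
  push Not
  simp

lemma transfer {m n : ℕ} (p : Fin m → Fin n → ℝ) (T : Finset (Fin n)) (b : Fin n → ℕ)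
    (hb : ∀ i ∈ T, b i ≤ 1) (E : Set (Fin n → ℕ)) :
    muOcc p (E ∩ {x | ∀ i ∈ T, x i = b i}) = EE (pt p T b) (T1 T b) (ind T b E) := by
  unfold muOcc EE Ex
  refine Fintype.sum_of_injective (fun σ : Fin m → Fin n => fun i => some (σ i)) ?_ _ _ ?_ ?_
  · intro σ τ h
    ext i
    have := congrFun h i
    simp at this
    rw [this]
  · intro σ hσ
    have : ∃ i, σ i = none := by
      by_contra hcon
      push Not at hcon
      apply hσ
      refine ⟨fun i => (σ i).get (Option.isSome_iff_ne_none.2 (hcon i)), ?_⟩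
      ext i; simp
    obtain ⟨i, hi⟩ := this
    rw [prod_eq_zero (mem_univ i) (by simp [hi, pt]), zero_mul]
  · intro σ
    beta_reduce
    by_cases hC : ∀ i ∈ T, occVector σ i = b i
    · have hprod : (∏ i, pt p T b i (some (σ i))) = urnWeight p σ := by
        unfold urnWeight
        refine prod_congr rfl fun i _ => ?_
        simp only [pt]
        rw [if_neg]
        rintro ⟨h1, h2⟩
        have := hC _ h1
        rw [occ_eq, if_pos ⟨i, rfl⟩, h2] at this
        omega
      have hcv : cv (T1 T b) (fun i => some (σ i)) = 1 := by
        unfold cv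
        rw [if_pos]
        intro t ht
        simp only [T1, mem_image, mem_filter] at ht
        obtain ⟨j, ⟨hj, hbj⟩, rfl⟩ := ht
        have := hC _ hj
        rw [occ_eq, hbj] at this
        split_ifs at this with h
        · obtain ⟨i, hi⟩ := h; exact ⟨i, congrArg some hi⟩
      have hx : xs T b (fun i => some (σ i)) = occVector σ := by
        ext j
        unfold xs
        split_ifs with h1 h2
        · exact (hC j h1).symm
        · rw [occ_eq, if_pos]; simpa using h2
        · rw [occ_eq, if_neg]; simpa using h2
      rw [hprod, hcv]
      unfold ind
      rw [hx]
      by_cases hE : occVector σ ∈ E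
      · rw [if_pos ⟨hE, hC⟩, if_pos hE]; ring
      · rw [if_neg (fun h => hE h.1), if_neg hE]; ring
    · rw [if_neg (fun h => hC h.2)]
      push Not at hC
      obtain ⟨t, ht, hne⟩ := hC
      rw [occ_eq] at hne
      have hbt := hb t ht
      by_cases h : ∃ i, σ i = t
      · rw [if_pos h] at hne
        obtain ⟨i, hi⟩ := h
        rw [prod_eq_zero (mem_univ i), zero_mul]
        simp only [pt]
        rw [if_pos]
        rw [hi]; exact ⟨ht, by omega⟩
      · rw [if_neg h] at hne
        have : cv (T1 T b) (fun i => some (σ i)) = 0 := by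
          unfold cv
          rw [if_neg]
          intro hcon
          obtain ⟨i, hi⟩ := hcon (some t) (by
            simp only [T1, mem_image, mem_filter]
            exact ⟨t, ⟨ht, by omega⟩, rfl⟩)
          exact h ⟨i, by simpa using hi⟩
        rw [this]; ring

lemma ind_mono {m n : ℕ} (T : Finset (Fin n)) (b : Fin n → ℕ) (A : Set (Fin n → ℕ))
    (hA : ∀ x ∈ A, ∀ y : Fin n → ℕ, (∀ i, x i ≤ y i) → y ∈ A) :
    MonoI (IA T A) (ind (m := m) T b A) := by
  intro σ i l hi
  unfold ind
  by_cases hx : xs T b σ ∈ A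
  swap
  · rw [if_neg hx]; split_ifs <;> norm_num
  rw [if_pos hx, if_pos]
  have hk : ∀ k, (k ∈ T ∨ σ i ≠ some k) → xs T b σ k ≤ xs T b (Function.update σ i l) k := by
    intro k hk
    unfold xs
    by_cases hkT : k ∈ T
    · simp [hkT]
    · rw [if_neg hkT, if_neg hkT]
      have hk := hk.resolve_left hkT
      by_cases h : ∃ i, σ i = some k
      · obtain ⟨e, he⟩ := h
        have hei : e ≠ i := by rintro rfl; exact hk he
        rw [if_pos ⟨e, he⟩, if_pos ⟨e, by simpa [hei] using he⟩]
      · rw [if_neg h]; exact Nat.zero_le _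
  by_cases hall : ∃ j, j ∉ T ∧ σ i = some j
  · obtain ⟨j, hjT, hj⟩ := hall
    have hna : ¬ Affects j A := by
      intro h
      apply hi
      rw [hj]
      simp [IA, hjT, h]
    have hz : Function.update (xs T b σ) j 0 ∈ A := by
      by_contra hz
      exact hna ⟨_, hx, _, hz, fun k hk => by simp [hk]⟩
    refine hA _ hz _ fun k => ?_
    by_cases hkj : k = j
    · subst hkj; simp
    · rw [Function.update_of_ne hkj]
      exact hk k (Or.inr (by rw [hj]; intro h; exact hkj (by simpa using h.symm)))
  · push Not at hall
    refine hA _ hx _ fun k => hk k ?_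
    by_cases hkT : k ∈ T
    · exact Or.inl hkT
    · exact Or.inr (hall k hkT)

end Urn

theorem occ_CNA (m n : ℕ) (p : Fin m → Fin n → ℝ)
    (hp : ∀ i j, 0 ≤ p i j) (hsum : ∀ i, ∑ j, p i j = 1)
    (T : Finset (Fin n)) (b : Fin n → ℕ) (hb : ∀ i ∈ T, b i ≤ 1)
    (A B : Set (Fin n → ℕ))
    (hA : ∀ x ∈ A, ∀ y : Fin n → ℕ, (∀ i, x i ≤ y i) → y ∈ A)
    (hB : ∀ x ∈ B, ∀ y : Fin n → ℕ, (∀ i, x i ≤ y i) → y ∈ B)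
    (hAB : ∀ j : Fin n, ¬(Affects j A ∧ Affects j B)) :
    muOcc p (A ∩ B ∩ {x | ∀ i ∈ T, x i = b i}) * muOcc p {x | ∀ i ∈ T, x i = b i} ≤
      muOcc p (A ∩ {x | ∀ i ∈ T, x i = b i}) * muOcc p (B ∩ {x | ∀ i ∈ T, x i = b i}) := by
  have h1 := Urn.transfer p T b hb (A ∩ B)
  have h2 := Urn.transfer p T b hb Set.univ
  rw [Set.univ_inter] at h2
  rw [h1, h2, Urn.transfer p T b hb A, Urn.transfer p T b hb B]
  have e1 : Urn.ind (m := m) T b (A ∩ B) = fun σ => Urn.ind T b A σ * Urn.ind T b B σ := by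
    ext σ
    unfold Urn.ind
    by_cases ha : Urn.xs T b σ ∈ A <;> by_cases hb : Urn.xs T b σ ∈ B <;> simp [ha, hb]
  have e2 : Urn.ind (m := m) T b Set.univ = fun _ => 1 := by
    ext σ; simp [Urn.ind]
  rw [e1, e2]
  refine Urn.na (o := none) _ (Urn.pt p T b) (Urn.IA T A) (Urn.IA T B) (Urn.T1 T b) _ _ ?_ ?_ ?_ ?_
    ?_ ?_ ?_ (Urn.ind_mono T b A hA) (Urn.ind_mono T b B hB) (Nat.lt_succ_self _)
  · intro i j
    cases j with
    | none => simp [Urn.pt]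
    | some j => simp only [Urn.pt]; split_ifs <;> simp [hp]
  · simp [Urn.IA]
  · simp [Urn.IA]
  · simp [Urn.T1]
  · rw [Finset.disjoint_left]
    intro x h1 h2
    simp only [Urn.IA, mem_image, mem_filter, mem_univ, true_and] at h1 h2
    obtain ⟨j, hj, rfl⟩ := h1
    obtain ⟨k, hk, he⟩ := h2
    have : k = j := by simpa using he
    subst this
    exact hAB k ⟨hj.2, hk.2⟩
  · rw [Finset.disjoint_left]
    intro x h1 h2
    simp only [Urn.IA, Urn.T1, mem_image, mem_filter, mem_univ, true_and] at h1 h2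
    obtain ⟨j, hj, rfl⟩ := h1
    obtain ⟨k, hk, he⟩ := h2
    have : k = j := by simpa using he
    subst this
    exact hj.1 hk.1
  · rw [Finset.disjoint_left]
    intro x h1 h2
    simp only [Urn.IA, Urn.T1, mem_image, mem_filter, mem_univ, true_and] at h1 h2
    obtain ⟨j, hj, rfl⟩ := h1
    obtain ⟨k, hk, he⟩ := h2
    have : k = j := by simpa using he
    subst this
    exact hj.1 hk.1

end
end

section
/- (Theorem 1.3) The generalized independent urn enumeration measure satisfies conditional negative association: let μ denote the law of (B_1,…,B_n) ∈ ℕ^n. For every subset T ⊆ [n] and every choice of values b_i ∈ ℕ (i ∈ T), writing C = {x ∈ ℕ^n : x_i = b_i for all i ∈ T}, and for all increasing events A, B ⊆ ℕ^n such that no coordinate j ∈ [n] affects both A and B, one has μ(A ∩ B ∩ C) · μ(C) ≤ μ(A ∩ C) · μ(B ∩ C). -/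
/-!
(Theorem 1.3) The generalized independent urn enumeration measure satisfies
conditional negative association.
-/

open Finset
open scoped Classical

noncomputable section

/-- The enumeration vector `(B_1, …, B_n) ∈ ℕ^n`. -/
def countVector {m n : ℕ} (σ : Fin m → Fin n) : Fin n → ℕ :=
  fun j => ballCount σ j

/-- The urn enumeration measure `μ` of an event `E ⊆ ℕ^n`. -/
def muEnum {m n : ℕ} (p : Fin m → Fin n → ℝ) (E : Set (Fin n → ℕ)) : ℝ :=
  ∑ σ : Fin m → Fin n, if countVector σ ∈ E then urnWeight p σ else 0

namespace UrnAux

variable {m n : ℕ}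

lemma ite_iff {p q : Prop} {dp : Decidable p} {dq : Decidable q} (h : p ↔ q) :
    @ite ℕ p dp 1 0 = @ite ℕ q dq 1 0 := by
  by_cases hp : p
  · rw [if_pos hp, if_pos (h.1 hp)]
  · rw [if_neg hp, if_neg (fun h' => hp (h.2 h'))]

def indeg (D : Finset (Fin m)) (l : Fin m → Bool → Fin n) (s : Fin m → Bool) : Fin n → ℕ :=
  fun v => ∑ e ∈ D, if l e (s e) = v then 1 else 0

def ind (T : Finset (Fin n)) (D : Finset (Fin m)) (l : Fin m → Bool → Fin n) (b : Fin n → ℕ)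
    (P : (Fin n → ℕ) → (Fin n → ℕ) → Prop) (s : Fin m → Bool) : ℕ :=
  if (∀ i ∈ T, indeg D l s i = b i ∧ indeg D l (fun e => !s e) i = b i) ∧
    P (indeg D l s) (indeg D l (fun e => !s e)) then 1 else 0

def N (T : Finset (Fin n)) (D : Finset (Fin m)) (l : Fin m → Bool → Fin n) (b : Fin n → ℕ)
    (P : (Fin n → ℕ) → (Fin n → ℕ) → Prop) : ℕ :=
  ∑ s : Fin m → Bool, ind T D l b P s

def flip (e : Fin m) (s : Fin m → Bool) : Fin m → Bool := Function.update s e (!s e)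

lemma flip_flip (e : Fin m) (s : Fin m → Bool) : flip e (flip e s) = s := by
  funext i
  by_cases h : i = e
  · subst h; simp [flip]
  · simp [flip, h]

lemma sum_flip {M : Type*} [AddCommMonoid M] (e : Fin m) (G : (Fin m → Bool) → M) :
    ∑ s, G (flip e s) = ∑ s, G s :=
  Fintype.sum_equiv ⟨flip e, flip e, flip_flip e, flip_flip e⟩ _ _ (fun _ => rfl)

lemma half_sum (e : Fin m) (f : (Fin m → Bool) → Bool) (G : (Fin m → Bool) → ℕ)
    (hf : ∀ s, f (flip e s) = f s) (hG : ∀ s, G (flip e s) = G s) :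
    2 * ∑ s, (if s e = f s then G s else 0) = ∑ s, G s := by
  rw [two_mul]
  nth_rewrite 1 [← sum_flip e]
  rw [← Finset.sum_add_distrib]
  refine Finset.sum_congr rfl fun s _ => ?_
  rw [hf, hG]
  have : flip e s e = !s e := by simp [flip]
  rw [this]
  cases s e <;> cases f s <;> simp

lemma indeg_erase {D : Finset (Fin m)} {e : Fin m} (he : e ∈ D) (l : Fin m → Bool → Fin n)
    (s : Fin m → Bool) :
    indeg D l s = indeg (D.erase e) l s + Pi.single (l e (s e)) 1 := by
  funext v
  simp only [indeg, Pi.add_apply]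
  rw [← Finset.sum_erase_add _ _ he]
  congr 1
  by_cases h : l e (s e) = v
  · subst h; simp
  · rw [if_neg h, Pi.single_eq_of_ne (fun h' => h h'.symm)]

lemma indeg_congr {D : Finset (Fin m)} {l l' : Fin m → Bool → Fin n} {s s' : Fin m → Bool}
    (h : ∀ e ∈ D, l e (s e) = l' e (s' e)) : indeg D l s = indeg D l' s' := by
  funext v
  exact Finset.sum_congr rfl fun e he => by rw [h e he]

/-- reducing `b` and degrees by one at `v` -/
lemma ind_shift (T : Finset (Fin n)) (D D' : Finset (Fin m)) (l l' : Fin m → Bool → Fin n)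
    (b : Fin n → ℕ) (P : (Fin n → ℕ) → (Fin n → ℕ) → Prop) (s : Fin m → Bool) (v : Fin n)
    (hb : 1 ≤ b v)
    (hP : ∀ x y, P (x + Pi.single v 1) (y + Pi.single v 1) ↔ P x y)
    (h1 : indeg D l s = indeg D' l' s + Pi.single v 1)
    (h2 : indeg D l (fun e => !s e) = indeg D' l' (fun e => !s e) + Pi.single v 1) :
    ind T D l b P s = ind T D' l' (b - Pi.single v 1) P s := by
  unfold ind
  rw [h1, h2, hP]
  have key : ∀ (x : Fin n → ℕ) i, (x + Pi.single v 1 : Fin n → ℕ) i = b i ↔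
      x i = (b - Pi.single v 1 : Fin n → ℕ) i := by
    intro x i
    by_cases h : i = v
    · subst h; simp; omega
    · simp [h]
  simp only [key]

lemma step (T : Finset (Fin n)) (D : Finset (Fin m)) (l : Fin m → Bool → Fin n)
    (b : Fin n → ℕ) (e0 : Fin m) (a : Bool) (v : Fin n) (he0 : e0 ∈ D) (hv : l e0 a = v)
    (hb : 1 ≤ b v) (e : Fin m) (he : e ∈ D) (c : Bool) (hc : l e c = v) :
    ∃ (k : ℕ) (l' : Fin m → Bool → Fin n),
      ∀ P : (Fin n → ℕ) → (Fin n → ℕ) → Prop,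
        (∀ x y, P (x + Pi.single v 1) (y + Pi.single v 1) ↔ P x y) →
        2 * ∑ s : Fin m → Bool, (if (s e = c ↔ s e0 = !a) then ind T D l b P s else 0)
          = k * N T (D.erase e0) l' (b - Pi.single v 1) P := by
  by_cases hee : e = e0
  · subst hee
    by_cases hca : c = a
    · subst hca
      refine ⟨0, l, fun P hP => ?_⟩
      have hF : ∀ s : Fin m → Bool, ¬ (s e = c ↔ s e = !c) := by
        intro s; cases s e <;> cases c <;> simp
      simp only [hF, if_false, Finset.sum_const_zero, mul_zero, zero_mul]
    · have hca' : c = !a := by cases a <;> cases c <;> simp_all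
      refine ⟨2, l, fun P hP => ?_⟩
      subst hca'
      simp only [if_true]
      congr 1
      refine Finset.sum_congr rfl fun s _ => ?_
      have hl : ∀ d, l e d = v := by
        intro d; cases d <;> cases a <;> simp_all
      apply ind_shift _ _ _ _ _ _ _ _ v hb hP
      · rw [indeg_erase he, hl]
      · rw [indeg_erase he, hl]
  · let l' : Fin m → Bool → Fin n := Function.update l e (Function.update (l e) c (l e0 (!a)))
    refine ⟨1, l', fun P hP => ?_⟩
    rw [one_mul]
    unfold N
    refine Eq.trans ?_ (half_sum e0 (fun s => if s e = c then !a else a)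
      (fun s => ind T (D.erase e0) l' (b - Pi.single v 1) P s) ?_ ?_)
    · congr 1
      refine Finset.sum_congr rfl fun s _ => ?_
      have hiff : (s e = c ↔ s e0 = !a) ↔ (s e0 = if s e = c then !a else a) := by
        by_cases h : s e = c
        · simp [h]
        · simp only [h, if_false, false_iff]
          cases s e0 <;> cases a <;> simp
      by_cases h : s e0 = if s e = c then !a else a
      · rw [if_pos (hiff.2 h)]
        simp only [if_pos h]
        have hmem : e ∈ D.erase e0 := Finset.mem_erase.2 ⟨hee, he⟩
        have hrest : ∀ s : Fin m → Bool, indeg ((D.erase e0).erase e) l s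
            = indeg ((D.erase e0).erase e) l' s := by
          intro s
          apply indeg_congr
          intro i hi
          have : i ≠ e := (Finset.mem_erase.1 hi).1
          simp [l', this]
        have hl'c : l' e c = l e0 (!a) := by simp [l']
        have hl'n : l' e (!c) = l e (!c) := by simp [l']
        have main : ∀ s : Fin m → Bool, (s e0 = if s e = c then !a else a) →
            indeg D l s = indeg (D.erase e0) l' s + Pi.single v 1 := by
          intro s h
          rw [indeg_erase he0, indeg_erase hmem l, indeg_erase hmem l', hrest]
          by_cases h' : s e = c
          · rw [if_pos h'] at h
            rw [h, h', hl'c, hc]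
            abel
          · rw [if_neg h'] at h
            have h'' : s e = !c := by cases h3 : s e <;> cases c <;> simp_all
            rw [h, h'', hl'n, hv]
        apply ind_shift _ _ _ _ _ _ _ _ v hb hP
        · exact main s h
        · apply main
          revert h
          cases s e0 <;> cases s e <;> cases a <;> cases c <;> simp
      · rw [if_neg (fun h' => h (hiff.1 h'))]
        simp only [if_neg h]
    · intro s
      simp [flip, hee]
    · intro s
      have : ∀ g : Bool → Bool, indeg (D.erase e0) l' (fun e => g (flip e0 s e))
          = indeg (D.erase e0) l' (fun e => g (s e)) := by
        intro g
        apply indeg_congr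
        intro i hi
        have : i ≠ e0 := (Finset.mem_erase.1 hi).1
        simp [flip, this]
      unfold ind
      have h1 := this id
      have h2 := this not
      change indeg (D.erase e0) l' (flip e0 s) = indeg (D.erase e0) l' s at h1
      change indeg (D.erase e0) l' (fun e => !flip e0 s e) =
        indeg (D.erase e0) l' (fun e => !s e) at h2
      rw [h1, h2]

lemma dirsum (D : Finset (Fin m)) (l : Fin m → Bool → Fin n) (s : Fin m → Bool) (v : Fin n)
    (k : ℕ) (h1 : indeg D l s v = k) (h2 : indeg D l (fun e => !s e) v = k) (d : Bool)
    (g : Prop) (hg : g ∨ ¬ g) :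
    ∑ e ∈ D, ∑ c : Bool, (if l e c = v ∧ (s e = c ↔ g) then 1 else 0) = k := by
  by_cases hg : g
  · rw [← h1]
    refine Finset.sum_congr rfl fun e _ => ?_
    rw [Fintype.sum_bool]
    cases hs : s e <;> simp [hg]
  · rw [← h2]
    refine Finset.sum_congr rfl fun e _ => ?_
    rw [Fintype.sum_bool]
    cases hs : s e <;> simp [hg, hs]

lemma mulN (T : Finset (Fin n)) (D : Finset (Fin m)) (l : Fin m → Bool → Fin n)
    (b : Fin n → ℕ) (e0 : Fin m) (a : Bool) (v : Fin n) (hvT : v ∈ T)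
    (P : (Fin n → ℕ) → (Fin n → ℕ) → Prop) :
    b v * N T D l b P = ∑ e ∈ D, ∑ c : Bool, if l e c = v then
      ∑ s : Fin m → Bool, (if (s e = c ↔ s e0 = !a) then ind T D l b P s else 0) else 0 := by
  have h1 : b v * N T D l b P = ∑ s : Fin m → Bool, ∑ e ∈ D, ∑ c : Bool,
      if l e c = v ∧ (s e = c ↔ s e0 = !a) then ind T D l b P s else 0 := by
    unfold N
    rw [Finset.mul_sum]
    refine Finset.sum_congr rfl fun s _ => ?_
    by_cases h : ∀ i ∈ T, indeg D l s i = b i ∧ indeg D l (fun e => !s e) i = b i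
    · nth_rewrite 1 [← dirsum D l s v (b v) (h v hvT).1 (h v hvT).2 true (s e0 = !a) (em _)]
      simp only [Finset.sum_mul, ite_mul, one_mul, zero_mul]
    · have : ind T D l b P s = 0 := by unfold ind; rw [if_neg (fun h' => h h'.1)]
      simp [this]
  rw [h1, Finset.sum_comm]
  refine Finset.sum_congr rfl fun e _ => ?_
  rw [Finset.sum_comm]
  refine Finset.sum_congr rfl fun c _ => ?_
  by_cases h : l e c = v <;> simp [h]

/-- reversal on a set of edges -/
def rev (R : Finset (Fin m)) (s : Fin m → Bool) : Fin m → Bool :=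
  fun e => if e ∈ R then !s e else s e

lemma indeg_flip_le {D : Finset (Fin m)} {l : Fin m → Bool → Fin n} {s : Fin m → Bool}
    {e : Fin m} {j : Fin n} (hj : l e (s e) ≠ j) : indeg D l s j ≤ indeg D l (flip e s) j := by
  unfold indeg
  refine Finset.sum_le_sum fun i _ => ?_
  by_cases h : i = e
  · subst h; simp [hj]
  · simp [flip, h]

lemma rev_flip (R : Finset (Fin m)) (e : Fin m) (s : Fin m → Bool) :
    rev R (flip e s) = flip e (rev R s) := by
  funext i
  by_cases h : i = e
  · subst h; simp only [rev, flip, Function.update_self]; split_ifs <;> rfl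
  · simp [rev, flip, h]

lemma rev_insert {R : Finset (Fin m)} {e : Fin m} (he : e ∉ R) (s : Fin m → Bool) :
    rev (insert e R) s = flip e (rev R s) := by
  funext i
  by_cases h : i = e
  · subst h; simp [rev, flip, he]
  · simp [rev, flip, h]

lemma hybrid (D : Finset (Fin m)) (l : Fin m → Bool → Fin n) (J K : Set (Fin n))
    (hJK : ∀ j, j ∈ J → j ∉ K) (A B : Set (Fin n → ℕ))
    (hA : ∀ x y, (∀ j ∈ J, x j ≤ y j) → x ∈ A → y ∈ A)
    (hB : ∀ x y, (∀ j ∈ K, x j ≤ y j) → x ∈ B → y ∈ B) (R : Finset (Fin m)) :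
    ∑ s : Fin m → Bool, (if indeg D l s ∈ A ∧ indeg D l s ∈ B then 1 else 0 : ℕ) ≤
    ∑ s : Fin m → Bool, (if indeg D l s ∈ A ∧ indeg D l (rev R s) ∈ B then 1 else 0 : ℕ) := by
  induction R using Finset.induction_on with
  | empty =>
    have : ∀ s : Fin m → Bool, rev ∅ s = s := by intro s; funext e; simp [rev]
    simp only [this]
    exact le_rfl
  | insert e R he ih =>
    refine ih.trans ?_
    suffices h : 2 * ∑ s : Fin m → Bool,
        (if indeg D l s ∈ A ∧ indeg D l (rev R s) ∈ B then 1 else 0 : ℕ) ≤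
        2 * ∑ s : Fin m → Bool,
        (if indeg D l s ∈ A ∧ indeg D l (rev (insert e R) s) ∈ B then 1 else 0 : ℕ) by omega
    rw [two_mul, two_mul]
    nth_rewrite 1 [← sum_flip e]
    nth_rewrite 3 [← sum_flip e]
    rw [← Finset.sum_add_distrib, ← Finset.sum_add_distrib]
    refine Finset.sum_le_sum fun s _ => ?_
    simp only [rev_insert he, rev_flip, flip_flip]
    have hr : rev R s e = s e := by simp [rev, he]
    have hne : flip e s e = !s e := by simp [flip]
    have hne' : flip e (rev R s) e = !s e := by simp [flip, hr]
    have a1 : l e (s e) ∉ J → indeg D l s ∈ A → indeg D l (flip e s) ∈ A := fun h =>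
      hA _ _ fun j hj => indeg_flip_le (fun h' => h (h' ▸ hj))
    have b1 : l e (s e) ∉ K → indeg D l (rev R s) ∈ B → indeg D l (flip e (rev R s)) ∈ B :=
      fun h => hB _ _ fun j hj => indeg_flip_le (fun h' => h (by rw [hr] at h'; exact h' ▸ hj))
    have a2 : l e (!s e) ∉ J → indeg D l (flip e s) ∈ A → indeg D l s ∈ A := fun h =>
      hA _ _ fun j hj => by
        have := indeg_flip_le (D := D) (l := l) (s := flip e s) (e := e) (j := j)
          (fun h' => h (by rw [hne] at h'; exact h' ▸ hj))
        rwa [flip_flip] at this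
    have b2 : l e (!s e) ∉ K → indeg D l (flip e (rev R s)) ∈ B → indeg D l (rev R s) ∈ B :=
      fun h => hB _ _ fun j hj => by
        have := indeg_flip_le (D := D) (l := l) (s := flip e (rev R s)) (e := e) (j := j)
          (fun h' => h (by rw [hne'] at h'; exact h' ▸ hj))
        rwa [flip_flip] at this
    have k1 := hJK (l e (s e))
    have k2 := hJK (l e (!s e))
    generalize (indeg D l s ∈ A) = p1 at *
    generalize (indeg D l (flip e s) ∈ A) = p2 at *
    generalize (indeg D l (rev R s) ∈ B) = q1 at *
    generalize (indeg D l (flip e (rev R s)) ∈ B) = q2 at *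
    by_cases p1 <;> by_cases p2 <;> by_cases q1 <;> by_cases q2 <;> simp_all

lemma N_le (T : Finset (Fin n)) (J K : Set (Fin n))
    (hJK : ∀ j, j ∈ J → j ∉ K) (hJT : ∀ j ∈ T, j ∉ J) (hKT : ∀ j ∈ T, j ∉ K)
    (A B : Set (Fin n → ℕ))
    (hA : ∀ x y, (∀ j ∈ J, x j ≤ y j) → x ∈ A → y ∈ A)
    (hB : ∀ x y, (∀ j ∈ K, x j ≤ y j) → x ∈ B → y ∈ B) :
    ∀ (d : ℕ) (D : Finset (Fin m)) (l : Fin m → Bool → Fin n) (b : Fin n → ℕ), D.card = d →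
    N T D l b (fun x _ => x ∈ A ∧ x ∈ B) ≤ N T D l b (fun x y => x ∈ A ∧ y ∈ B) := by
  intro d
  induction d with
  | zero =>
    intro D l b hD
    rw [Finset.card_eq_zero] at hD
    subst hD
    have : ∀ s s' : Fin m → Bool, indeg ∅ l s = indeg ∅ l s' :=
      fun s s' => indeg_congr (by simp)
    unfold N ind
    refine Finset.sum_le_sum fun s _ => ?_
    simp only [this (fun e => !s e) s]
    exact le_rfl
  | succ d ih =>
    intro D l b hD
    by_cases hex : ∃ e0 ∈ D, ∃ a, l e0 a ∈ T
    · obtain ⟨e0, he0, a, hv⟩ := hex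
      obtain ⟨v, hv'⟩ : ∃ v, l e0 a = v := ⟨_, rfl⟩
      rw [hv'] at hv
      by_cases hb : b v = 0
      · have : N T D l b (fun x _ => x ∈ A ∧ x ∈ B) = 0 := by
          unfold N
          refine Finset.sum_eq_zero fun s _ => ?_
          unfold ind
          rw [if_neg]
          rintro ⟨h, -⟩
          obtain ⟨h1, h2⟩ := h v hv
          rw [indeg_erase he0] at h1 h2
          rw [hb] at h1 h2
          simp only [Pi.add_apply] at h1 h2
          cases hs : s e0 <;> cases a <;> simp_all
        rw [this]; exact Nat.zero_le _
      · have hb1 : 1 ≤ b v := Nat.one_le_iff_ne_zero.2 hb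
        have hAv : ∀ x : Fin n → ℕ, x + Pi.single v 1 ∈ A ↔ x ∈ A := by
          intro x
          have hx : ∀ j ∈ J, (x + Pi.single v 1 : Fin n → ℕ) j = x j := by
            intro j hj
            have : j ≠ v := fun h => hJT v hv (h ▸ hj)
            simp [this]
          exact ⟨hA _ _ fun j hj => (hx j hj).le, hA _ _ fun j hj => (hx j hj).ge⟩
        have hBv : ∀ x : Fin n → ℕ, x + Pi.single v 1 ∈ B ↔ x ∈ B := by
          intro x
          have hx : ∀ j ∈ K, (x + Pi.single v 1 : Fin n → ℕ) j = x j := by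
            intro j hj
            have : j ≠ v := fun h => hKT v hv (h ▸ hj)
            simp [this]
          exact ⟨hB _ _ fun j hj => (hx j hj).le, hB _ _ fun j hj => (hx j hj).ge⟩
        refine Nat.le_of_mul_le_mul_left (c := b v) ?_ hb1
        rw [mulN T D l b e0 a v hv, mulN T D l b e0 a v hv]
        refine Finset.sum_le_sum fun e he => Finset.sum_le_sum fun c _ => ?_
        by_cases hc : l e c = v
        · rw [if_pos hc, if_pos hc]
          obtain ⟨k, l', hk⟩ := step T D l b e0 a v he0 hv' hb1 e he c hc
          have e1 := hk (fun x _ => x ∈ A ∧ x ∈ B) (by intro x y; simp only [hAv, hBv])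
          have e2 := hk (fun x y => x ∈ A ∧ y ∈ B) (by intro x y; simp only [hAv, hBv])
          have := Nat.mul_le_mul_left k (ih (D.erase e0) l' (b - Pi.single v 1)
            (by rw [Finset.card_erase_of_mem he0, hD]; rfl))
          omega
        · rw [if_neg hc, if_neg hc]
    · push Not at hex
      have hz : ∀ s, ∀ i ∈ T, indeg D l s i = 0 := by
        intro s i hi
        unfold indeg
        refine Finset.sum_eq_zero fun e he => if_neg fun h => ?_
        exact hex e he (s e) (by rw [h]; exact hi)
      unfold N ind
      by_cases hb : ∀ i ∈ T, b i = 0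
      · have hC : ∀ s, (∀ i ∈ T, indeg D l s i = b i ∧ indeg D l (fun e => !s e) i = b i) :=
          fun s i hi => ⟨by rw [hz s i hi, hb i hi], by rw [hz _ i hi, hb i hi]⟩
        have := hybrid D l J K hJK A B hA hB Finset.univ
        have hrev : ∀ s : Fin m → Bool, rev Finset.univ s = fun e => !s e := by
          intro s; funext e; simp [rev]
        simp only [hrev] at this
        refine le_trans (le_of_eq ?_) (le_trans this (le_of_eq ?_))
        · exact Finset.sum_congr rfl fun s _ => ite_iff ⟨fun h => h.2, fun h => ⟨hC s, h⟩⟩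
        · exact Finset.sum_congr rfl fun s _ => ite_iff ⟨fun h => ⟨hC s, h⟩, fun h => h.2⟩
      · have hC : ∀ s, ¬ (∀ i ∈ T, indeg D l s i = b i ∧ indeg D l (fun e => !s e) i = b i) :=
          fun s h => hb fun i hi => by rw [← (h i hi).1, hz s i hi]
        simp only [hC, false_and, if_false]
        exact le_rfl

/-! ### Reduction of the measure inequality -/

def pairEquiv : (Fin m → Bool → Fin n) ≃ (Fin m → Fin n) × (Fin m → Fin n) where
  toFun l := (fun i => l i true, fun i => l i false)
  invFun q := fun i c => if c then q.1 i else q.2 i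
  left_inv l := by funext i c; cases c <;> rfl
  right_inv q := rfl

def swapEquiv (s : Fin m → Bool) : (Fin m → Bool → Fin n) ≃ (Fin m → Bool → Fin n) where
  toFun l := fun i c => l i (if c then s i else !s i)
  invFun l := fun i c => l i (if c then s i else !s i)
  left_inv l := by funext i c; cases c <;> cases h : s i <;> simp [h]
  right_inv l := by funext i c; cases c <;> cases h : s i <;> simp [h]

def wt (p : Fin m → Fin n → ℝ) (l : Fin m → Bool → Fin n) : ℝ :=
  ∏ i, (p i (l i true) * p i (l i false))

lemma wt_swap (p : Fin m → Fin n → ℝ) (s : Fin m → Bool) (l : Fin m → Bool → Fin n) :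
    wt p (swapEquiv s l) = wt p l := by
  unfold wt
  refine Finset.prod_congr rfl fun i _ => ?_
  cases h : s i <;> simp [swapEquiv, h, mul_comm]

lemma countVector_eq (l : Fin m → Bool → Fin n) (s : Fin m → Bool) :
    countVector (fun i => l i (s i)) = indeg Finset.univ l s := by
  funext v
  simp only [countVector, ballCount, indeg]
  rw [Finset.card_filter]

lemma mu_mul (p : Fin m → Fin n → ℝ) (E F : Set (Fin n → ℕ)) :
    2 ^ m * (muEnum p E * muEnum p F) = ∑ l : Fin m → Bool → Fin n, wt p l *
      ((∑ s : Fin m → Bool, if indeg Finset.univ l s ∈ E ∧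
        indeg Finset.univ l (fun e => !s e) ∈ F then 1 else 0 : ℕ) : ℝ) := by
  have h0 : muEnum p E * muEnum p F = ∑ l : Fin m → Bool → Fin n, wt p l *
      (if countVector (fun i => l i true) ∈ E ∧ countVector (fun i => l i false) ∈ F
        then 1 else 0) := by
    unfold muEnum
    rw [Finset.sum_mul_sum, ← Fintype.sum_prod_type', ← pairEquiv.sum_comp]
    refine Finset.sum_congr rfl fun l _ => ?_
    simp only [pairEquiv, Equiv.coe_fn_mk, urnWeight, wt, Finset.prod_mul_distrib]
    by_cases h1 : countVector (fun i => l i true) ∈ E <;>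
      by_cases h2 : countVector (fun i => l i false) ∈ F <;> simp [h1, h2]
  have h1 : ∀ s : Fin m → Bool, muEnum p E * muEnum p F = ∑ l : Fin m → Bool → Fin n, wt p l *
      (if indeg Finset.univ l s ∈ E ∧ indeg Finset.univ l (fun e => !s e) ∈ F
        then 1 else 0) := by
    intro s
    rw [h0, ← (swapEquiv s).sum_comp]
    refine Finset.sum_congr rfl fun l _ => ?_
    rw [wt_swap, ← countVector_eq, ← countVector_eq]
    simp [swapEquiv]
  have h2 : (2 : ℝ) ^ m * (muEnum p E * muEnum p F)
      = ∑ s : Fin m → Bool, muEnum p E * muEnum p F := by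
    simp
  rw [h2, Finset.sum_congr rfl fun s _ => h1 s, Finset.sum_comm]
  refine Finset.sum_congr rfl fun l _ => ?_
  rw [← Finset.mul_sum]
  push_cast
  rfl

lemma dep (A : Set (Fin n → ℕ)) (x y : Fin n → ℕ) (h : ∀ j, Affects j A → x j = y j)
    (hx : x ∈ A) : y ∈ A := by
  have : ∀ S : Finset (Fin n), S.piecewise y x ∈ A := by
    intro S
    induction S using Finset.induction_on with
    | empty => simpa using hx
    | insert j S hj ih =>
      by_contra hc
      have haff : Affects j A := ⟨_, ih, _, hc, fun i hi => by
        simp [Finset.piecewise, hi]⟩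
      apply hc
      convert ih using 1
      funext i
      by_cases hi : i = j
      · subst hi; simp [Finset.piecewise, hj, h i haff]
      · simp [Finset.piecewise, hi]
  simpa using this Finset.univ

lemma dep_mono (A : Set (Fin n → ℕ))
    (hA : ∀ x ∈ A, ∀ y : Fin n → ℕ, (∀ i, x i ≤ y i) → y ∈ A) (x y : Fin n → ℕ)
    (h : ∀ j, Affects j A → x j ≤ y j) (hx : x ∈ A) : y ∈ A := by
  refine dep A (fun j => if Affects j A then y j else x j) y (fun j hj => by simp [hj]) ?_
  refine hA x hx _ fun i => ?_
  by_cases hi : Affects i A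
  · simpa [hi] using h i hi
  · simp [hi]

def ovr (T : Finset (Fin n)) (b : Fin n → ℕ) (x : Fin n → ℕ) : Fin n → ℕ :=
  fun i => if i ∈ T then b i else x i

lemma ovr_mono (T : Finset (Fin n)) (b : Fin n → ℕ) (A : Set (Fin n → ℕ))
    (hA : ∀ x ∈ A, ∀ y : Fin n → ℕ, (∀ i, x i ≤ y i) → y ∈ A) (x y : Fin n → ℕ)
    (h : ∀ j ∈ {j | Affects j A ∧ j ∉ T}, x j ≤ y j) (hx : x ∈ {x | ovr T b x ∈ A}) :
    y ∈ {x | ovr T b x ∈ A} := by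
  refine dep_mono A hA _ _ (fun j hj => ?_) hx
  unfold ovr
  by_cases hT : j ∈ T
  · simp [hT]
  · simpa [hT] using h j ⟨hj, hT⟩

lemma ovr_eq (T : Finset (Fin n)) (b x : Fin n → ℕ) (h : ∀ i ∈ T, x i = b i) :
    ovr T b x = x := by
  funext i
  unfold ovr
  split_ifs with hi
  · exact (h i hi).symm
  · rfl

end UrnAux

open UrnAux in
theorem enum_CNA (m n : ℕ) (p : Fin m → Fin n → ℝ)
    (hp : ∀ i j, 0 ≤ p i j) (hsum : ∀ i, ∑ j, p i j = 1)
    (T : Finset (Fin n)) (b : Fin n → ℕ)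
    (A B : Set (Fin n → ℕ))
    (hA : ∀ x ∈ A, ∀ y : Fin n → ℕ, (∀ i, x i ≤ y i) → y ∈ A)
    (hB : ∀ x ∈ B, ∀ y : Fin n → ℕ, (∀ i, x i ≤ y i) → y ∈ B)
    (hAB : ∀ j : Fin n, ¬(Affects j A ∧ Affects j B)) :
    muEnum p (A ∩ B ∩ {x | ∀ i ∈ T, x i = b i}) * muEnum p {x | ∀ i ∈ T, x i = b i} ≤
      muEnum p (A ∩ {x | ∀ i ∈ T, x i = b i}) * muEnum p (B ∩ {x | ∀ i ∈ T, x i = b i}) := by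
  have main : (2 : ℝ) ^ m * (muEnum p (A ∩ B ∩ {x | ∀ i ∈ T, x i = b i}) *
      muEnum p {x | ∀ i ∈ T, x i = b i}) ≤
      2 ^ m * (muEnum p (A ∩ {x | ∀ i ∈ T, x i = b i}) *
        muEnum p (B ∩ {x | ∀ i ∈ T, x i = b i})) := by
    rw [mu_mul, mu_mul]
    refine Finset.sum_le_sum fun l _ => mul_le_mul_of_nonneg_left ?_
      (Finset.prod_nonneg fun i _ => mul_nonneg (hp _ _) (hp _ _))
    have key := N_le T {j | Affects j A ∧ j ∉ T} {j | Affects j B ∧ j ∉ T}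
      (fun j h1 h2 => hAB j ⟨h1.1, h2.1⟩) (fun j hj h => h.2 hj) (fun j hj h => h.2 hj)
      {x | ovr T b x ∈ A} {x | ovr T b x ∈ B} (ovr_mono T b A hA) (ovr_mono T b B hB)
      _ Finset.univ l b rfl
    unfold N ind at key
    refine Nat.cast_le.2 (le_trans (le_of_eq ?_) (le_trans key (le_of_eq (Eq.symm ?_))))
    all_goals
      refine Finset.sum_congr rfl fun s _ => ite_iff ?_
      simp only [Set.mem_inter_iff, Set.mem_setOf_eq]
      constructor
      · intro h
        have c1 : ∀ i ∈ T, indeg Finset.univ l s i = b i := by tauto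
        have c2 : ∀ i ∈ T, indeg Finset.univ l (fun e => !s e) i = b i := by tauto
        rw [ovr_eq T b _ c1]
        try rw [ovr_eq T b _ c2]
        exact ⟨fun i hi => ⟨c1 i hi, c2 i hi⟩, by tauto⟩
      · rintro ⟨h, h'⟩
        have c1 : ∀ i ∈ T, indeg Finset.univ l s i = b i := fun i hi => (h i hi).1
        have c2 : ∀ i ∈ T, indeg Finset.univ l (fun e => !s e) i = b i := fun i hi => (h i hi).2
        rw [ovr_eq T b _ c1] at h'
        try rw [ovr_eq T b _ c2] at h'
        tauto
  exact le_of_mul_le_mul_left main (by positivity)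

end
end

section
/- (Theorem 1.4) The measure ν_d^occ satisfies the normalized matching property: fix d ∈ {0,1,…,n−1}. Then for every increasing family A ⊆ 2^{[m]} (i.e., S ∈ A and S ⊆ T ⊆ [m] imply T ∈ A) and every integer k ≥ 0, (Σ_{Z ∈ A, |Z| = k} w_d^occ(Z)) · (Σ_{Z ⊆ [m], |Z| = k+1} w_d^occ(Z)) ≤ (Σ_{Z ∈ A, |Z| = k+1} w_d^occ(Z)) · (Σ_{Z ⊆ [m], |Z| = k} w_d^occ(Z)); equivalently, the conditional law ν_d^occ( · | |Z| = k+1) stochastically dominates ν_d^occ( · | |Z| = k) whenever both conditionings have positive probability. -/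
/-!
(Theorem 1.4) The measure `ν_d^occ` satisfies the normalized matching property.
The urn model has `n+1` urns (so `d` ranges over `{0,…,n}`), the distinguished
urn being the last one, `Fin.last n`.
-/

open Finset
open scoped Classical

noncomputable section

/-- `w_d^occ(Z)`: total weight of assignments `σ` with `σ⁻¹(last urn) = Z` and with
each of the first `d` urns nonempty.  (Urn indices are `0`-based: urn number `t`
is index `t-1`, so the first `d` urns are the indices `j` with `(j : ℕ) < d`.) -/
def wOcc {m n : ℕ} (p : Fin m → Fin (n+1) → ℝ) (d : ℕ) (Z : Finset (Fin m)) : ℝ :=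
  ∑ σ : Fin m → Fin (n+1),
    if (∀ i : Fin m, σ i = Fin.last n ↔ i ∈ Z) ∧
        (∀ j : Fin (n+1), (j : ℕ) < d → 1 ≤ ballCount σ j) then urnWeight p σ else 0

namespace UrnAux

set_option linter.unusedSectionVars false

open Polynomial

/-- likelihood ratio order on coefficient sequences -/
def LR (f g : ℝ[X]) : Prop := ∀ k, f.coeff (k+1) * g.coeff k ≤ f.coeff k * g.coeff (k+1)

def NN (f : ℝ[X]) : Prop := ∀ k, 0 ≤ f.coeff k

def SP (N : ℕ) (f : ℝ[X]) : Prop := (∀ k ≤ N, 0 < f.coeff k) ∧ ∀ k, N < k → f.coeff k = 0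

lemma SP.nn {N : ℕ} {f : ℝ[X]} (h : SP N f) : NN f := fun k => by
  rcases le_or_gt k N with hk | hk
  · exact (h.1 k hk).le
  · exact (h.2 k hk).ge

lemma NN.shift {f : ℝ[X]} (h : NN f) : NN (X * f) := fun k => by
  cases k with
  | zero => simp
  | succ k => rw [coeff_X_mul]; exact h k

lemma LR.refl (f : ℝ[X]) : LR f f := fun k => by rw [mul_comm]

lemma LR.add_right {f g h : ℝ[X]} (h1 : LR f g) (h2 : LR f h) : LR f (g + h) := fun k => by
  have := h1 k; have := h2 k; simp only [coeff_add]; linarith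

lemma LR.add_left {f g h : ℝ[X]} (h1 : LR f h) (h2 : LR g h) : LR (f + g) h := fun k => by
  have := h1 k; have := h2 k; simp only [coeff_add]; linarith

lemma LR.smul_right {f g : ℝ[X]} {r : ℝ} (hr : 0 ≤ r) (h1 : LR f g) : LR f (C r * g) := fun k => by
  have := mul_le_mul_of_nonneg_left (h1 k) hr; simp only [coeff_C_mul]; linarith

lemma LR.smul_left {f g : ℝ[X]} {r : ℝ} (hr : 0 ≤ r) (h1 : LR f g) : LR (C r * f) g := fun k => by
  have := mul_le_mul_of_nonneg_left (h1 k) hr; simp only [coeff_C_mul]; linarith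

lemma LR.zero_right (f : ℝ[X]) : LR f 0 := fun k => by simp
lemma LR.zero_left (f : ℝ[X]) : LR 0 f := fun k => by simp

lemma LR.sum_right {ι : Type*} {f : ℝ[X]} (s : Finset ι) (g : ι → ℝ[X])
    (h : ∀ i ∈ s, LR f (g i)) : LR f (∑ i ∈ s, g i) := fun k => by
  simp only [finsetSum_coeff, Finset.mul_sum]
  exact Finset.sum_le_sum fun i hi => h i hi k

lemma LR.sum_left {ι : Type*} {f : ℝ[X]} (s : Finset ι) (g : ι → ℝ[X])
    (h : ∀ i ∈ s, LR (g i) f) : LR (∑ i ∈ s, g i) f := fun k => by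
  simp only [finsetSum_coeff, Finset.sum_mul]
  exact Finset.sum_le_sum fun i hi => h i hi k

lemma LR.shift {f g : ℝ[X]} (h : LR f g) : LR (X * f) (X * g) := fun k => by
  cases k with
  | zero => simp
  | succ k => simp only [coeff_X_mul]; exact h k

lemma LR.trans' {f g h : ℝ[X]} (hf : NN f) (hg : NN g) (hh : NN h)
    (hs : ∀ k, g.coeff k = 0 → g.coeff (k+1) = 0 → f.coeff (k+1) = 0)
    (h1 : LR f g) (h2 : LR g h) : LR f h := fun k => by
  have a := h1 k
  have b := h2 k
  rcases (hg k).eq_or_lt with h0 | h0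
  · rcases (hg (k+1)).eq_or_lt with h3 | h3
    · rw [hs k h0.symm h3.symm, zero_mul]
      exact mul_nonneg (hf _) (hh _)
    · rw [← h0, zero_mul] at b
      have : h.coeff k = 0 := by
        have := hh k
        by_contra hne
        have : 0 < h.coeff k := lt_of_le_of_ne this (Ne.symm hne)
        have := mul_pos h3 this
        linarith
      rw [this, mul_zero]
      exact mul_nonneg (hf _) (hh _)
  · rcases (hg (k+1)).eq_or_lt with h3 | h3
    · rw [← h3, mul_zero] at a
      have : f.coeff (k+1) = 0 := by
        have := hf (k+1)
        by_contra hne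
        have : 0 < f.coeff (k+1) := lt_of_le_of_ne this (Ne.symm hne)
        have := mul_pos this h0
        linarith
      rw [this, zero_mul]
      exact mul_nonneg (hf _) (hh _)
    · have e := mul_le_mul a b (mul_nonneg (hg _) (hh _)) (mul_nonneg (hf _) (hg _))
      have hp := mul_pos h0 h3
      refine le_of_mul_le_mul_left ?_ hp
      linarith

lemma LR.trans1 {N : ℕ} {f g h : ℝ[X]} (hf : SP N f) (hg : SP N g) (hh : NN h)
    (h1 : LR f g) (h2 : LR g h) : LR f h := by
  refine LR.trans' hf.nn hg.nn hh (fun k hk _ => hf.2 _ ?_) h1 h2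
  by_contra hlt
  exact (hg.1 k (by omega)).ne' hk

lemma LR.trans2 {N N' : ℕ} {f g h : ℝ[X]} (hf : SP N' f) (hN : N' ≤ N + 1) (hg : SP N g) (hh : NN h)
    (h1 : LR f (X * g)) (h2 : LR (X * g) h) : LR f h := by
  refine LR.trans' hf.nn hg.nn.shift hh (fun k _ hk => hf.2 _ ?_) h1 h2
  by_contra hlt
  rw [coeff_X_mul] at hk
  exact (hg.1 k (by omega)).ne' hk

section
variable {α ι : Type*} [DecidableEq α] [DecidableEq ι]

def G (x : α → ℝ) (a : α → ι → ℝ) (θ : ℝ) (M : Finset α) (S : Finset ι) (c : α → ℝ) : ℝ[X] :=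
  ∑ U ∈ S.powerset, C ((-θ) ^ U.card) * ∏ i ∈ M, (C (x i) * X + C (c i - ∑ j ∈ U, a i j))

lemma G_congr {x x' : α → ℝ} {a a' : α → ι → ℝ} (θ : ℝ) {M : Finset α} (S : Finset ι)
    {c c' : α → ℝ} (hx : ∀ i ∈ M, x i = x' i) (ha : ∀ i ∈ M, a i = a' i)
    (hc : ∀ i ∈ M, c i = c' i) : G x a θ M S c = G x' a' θ M S c' := by
  unfold G
  refine Finset.sum_congr rfl fun U _ => ?_
  congr 1
  refine Finset.prod_congr rfl fun i hi => ?_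
  rw [hx i hi, ha i hi, hc i hi]

variable (x : α → ℝ) (a : α → ι → ℝ) (θ : ℝ)

lemma G_R {i : α} {M : Finset α} (hi : i ∉ M) (S : Finset ι) (c : α → ℝ) :
    G x a θ (insert i M) S c =
      C (x i) * (X * G x a θ M S c) + C (c i - ∑ j ∈ S, a i j) * G x a θ M S c
      + ∑ j ∈ S, C (a i j) * G x a θ M (S.erase j) c := by
  have key : ∑ j ∈ S, C (a i j) * G x a θ M (S.erase j) c =
      ∑ U ∈ S.powerset, (∑ j ∈ S \ U, C (a i j)) *
        (C ((-θ) ^ U.card) * ∏ i ∈ M, (C (x i) * X + C (c i - ∑ j ∈ U, a i j))) := by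
    unfold G
    simp only [Finset.mul_sum, Finset.sum_mul]
    refine Finset.sum_comm' ?_
    intro j U
    simp only [Finset.mem_powerset, Finset.mem_sdiff, Finset.subset_erase]
    tauto
  rw [key]
  unfold G
  simp only [Finset.mul_sum]
  rw [← Finset.sum_add_distrib, ← Finset.sum_add_distrib]
  refine Finset.sum_congr rfl fun U hU => ?_
  rw [Finset.prod_insert hi]
  have h2 := Finset.sum_sdiff (f := fun j => a i j) (Finset.mem_powerset.1 hU)
  rw [← h2, ← map_sum]
  simp only [map_sub, map_add]
  ring

lemma G_E {j : ι} {S : Finset ι} (hj : j ∉ S) (M : Finset α) (c : α → ℝ) :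
    G x a θ M (insert j S) c = G x a θ M S c - C θ * G x a θ M S (fun i => c i - a i j) := by
  unfold G
  rw [Finset.sum_powerset_insert hj, sub_eq_add_neg, Finset.mul_sum, ← Finset.sum_neg_distrib]
  congr 1
  refine Finset.sum_congr rfl fun U hU => ?_
  have hjU : j ∉ U := fun h => hj (Finset.mem_powerset.1 hU h)
  rw [Finset.card_insert_of_notMem hjU, pow_succ]
  have : ∀ i, c i - ∑ j ∈ insert j U, a i j = c i - a i j - ∑ j ∈ U, a i j := by
    intro i; rw [Finset.sum_insert hjU]; ring
  simp only [this, map_mul, map_neg]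
  ring

lemma G_upd {i : α} {M : Finset α} (hi : i ∉ M) (S : Finset ι) {c c' : α → ℝ}
    (h : ∀ l, l ≠ i → c l = c' l) :
    G x a θ (insert i M) S c = G x a θ (insert i M) S c' + C (c i - c' i) * G x a θ M S c := by
  have : G x a θ M S c' = G x a θ M S c := G_congr θ S (fun _ _ => rfl) (fun _ _ => rfl)
    (fun l hl => (h l (by rintro rfl; exact hi hl)).symm)
  have h3 : ∀ j, G x a θ M (S.erase j) c' = G x a θ M (S.erase j) c := fun j =>
    G_congr θ _ (fun _ _ => rfl) (fun _ _ => rfl)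
    (fun l hl => (h l (by rintro rfl; exact hi hl)).symm)
  rw [G_R x a θ hi, G_R x a θ hi, this]
  simp only [h3, map_sub]
  ring

lemma G_empty (S : Finset ι) (c : α → ℝ) : G x a θ ∅ S c = C ((1 - θ) ^ S.card) := by
  unfold G
  simp only [Finset.prod_empty, mul_one]
  rw [← map_sum]
  congr 1
  have := Finset.sum_pow_mul_eq_add_pow (-θ) 1 S
  simp only [one_pow, mul_one] at this
  rw [this]; ring

/-- validity -/
def V (S : Finset ι) (c : α → ℝ) : Prop := ∀ i, ∑ j ∈ S, a i j < c i

variable {x a θ}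

lemma V.mono {S T : Finset ι} {c : α → ℝ} (ha : ∀ i j, 0 ≤ a i j) (h : V a S c) (hT : T ⊆ S) :
    V a T c := fun i =>
  lt_of_le_of_lt (Finset.sum_le_sum_of_subset_of_nonneg hT fun _ _ _ => ha _ _) (h i)

lemma V.le {S : Finset ι} {c c' : α → ℝ} (h : V a S c) (hc : c ≤ c') : V a S c' :=
  fun i => (h i).trans_le (hc i)

lemma G_SP (hx : ∀ i, 0 < x i) (ha : ∀ i j, 0 ≤ a i j) (hθ : θ < 1) (M : Finset α) :
    ∀ (S : Finset ι) (c : α → ℝ), V a S c → SP M.card (G x a θ M S c) := by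
  induction M using Finset.induction_on with
  | empty =>
    intro S c _
    rw [G_empty]
    refine ⟨fun k hk => ?_, fun k hk => ?_⟩
    · simp at hk; subst hk; rw [coeff_C_zero]; exact pow_pos (sub_pos.2 hθ) _
    · simp at hk; rw [coeff_C, if_neg (by omega)]
  | insert i M hi ih =>
    intro S c hV
    rw [G_R x a θ hi, Finset.card_insert_of_notMem hi]
    have h1 := ih S c hV
    have h2 : ∀ j, SP M.card (G x a θ M (S.erase j) c) := fun j =>
      ih _ c (hV.mono ha (Finset.erase_subset _ _))
    have he : 0 < c i - ∑ j ∈ S, a i j := sub_pos.2 (hV i)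
    refine ⟨fun k hk => ?_, fun k hk => ?_⟩
    · simp only [coeff_add, coeff_C_mul, finsetSum_coeff]
      have hs : 0 ≤ ∑ j ∈ S, a i j * (G x a θ M (S.erase j) c).coeff k :=
        Finset.sum_nonneg fun j _ => mul_nonneg (ha _ _) ((h2 j).nn k)
      cases k with
      | zero =>
        have := mul_pos he (h1.1 0 (by omega))
        simp only [coeff_X_mul_zero]
        linarith
      | succ k =>
        have := mul_nonneg he.le (h1.nn (k+1))
        have := mul_pos (hx i) (h1.1 k (by omega))
        simp only [coeff_X_mul]
        linarith
    · obtain ⟨k, rfl⟩ : ∃ l, k = l + 1 := ⟨k - 1, by omega⟩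
      simp only [coeff_add, coeff_C_mul, finsetSum_coeff, coeff_X_mul]
      have hs : ∑ j ∈ S, a i j * (G x a θ M (S.erase j) c).coeff (k+1) = 0 :=
        Finset.sum_eq_zero (fun j _ => by rw [(h2 j).2 (k+1) (by omega), mul_zero])
      rw [h1.2 k (by omega), h1.2 (k+1) (by omega), hs]
      ring

variable (x a θ)

def PL (M : Finset α) : Prop := ∀ (S : Finset ι) c, V a S c → LR (G x a θ M S c) (X * G x a θ M S c)
def PC (M : Finset α) : Prop := ∀ (S : Finset ι) c, V a S c → ∀ j ∈ S,
  LR (G x a θ M (S.erase j) c) (X * G x a θ M S c)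
def PD (M : Finset α) : Prop := ∀ (S : Finset ι) c, V a S c → ∀ j ∈ S,
  LR (G x a θ M S c) (G x a θ M (S.erase j) c)
def PA (M : Finset α) : Prop := ∀ (S : Finset ι) c c', V a S c' → c' ≤ c →
  LR (G x a θ M S c) (G x a θ M S c')

variable {x a θ}


lemma beta (hx : ∀ i, 0 < x i) (ha : ∀ i j, 0 ≤ a i j) {i : α} {M : Finset α} (hi : i ∉ M)
    (hL : PL x a θ M) (hC : PC x a θ M) (S : Finset ι) (c : α → ℝ) (hV : V a S c) :
    LR (G x a θ (insert i M) S c) (X * G x a θ M S c) := by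
  rw [G_R x a θ hi]
  refine LR.add_left (LR.add_left ?_ ?_) ?_
  · exact (LR.refl _).smul_left (hx i).le
  · exact (hL S c hV).smul_left (sub_pos.2 (hV i)).le
  · exact LR.sum_left _ _ fun j hj => (hC S c hV j hj).smul_left (ha i j)

lemma alpha1 (hx : ∀ i, 0 < x i) (ha : ∀ i j, 0 ≤ a i j) {i : α} {M : Finset α} (hi : i ∉ M)
    (hL : PL x a θ M) (hD : PD x a θ M) (S : Finset ι) (c c' : α → ℝ) (hV : V a S c')
    (hcc : c' ≤ c) (h : ∀ l, l ≠ i → c l = c' l) :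
    LR (G x a θ (insert i M) S c) (G x a θ (insert i M) S c') := by
  rw [G_upd x a θ hi S h]
  refine LR.add_left (LR.refl _) (LR.smul_left (sub_nonneg.2 (hcc i)) ?_)
  have : G x a θ M S c = G x a θ M S c' := G_congr θ S (fun _ _ => rfl) (fun _ _ => rfl)
    (fun l hl => (h l (by rintro rfl; exact hi hl)))
  rw [this, G_R x a θ hi]
  refine LR.add_right (LR.add_right ?_ ?_) ?_
  · exact (hL S c' hV).smul_right (hx i).le
  · exact (LR.refl _).smul_right (sub_pos.2 (hV i)).le
  · exact LR.sum_right _ _ fun j hj => (hD S c' hV j hj).smul_right (ha i j)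

lemma stepA (hx : ∀ i, 0 < x i) (ha : ∀ i j, 0 ≤ a i j) (hθ : θ < 1) (M : Finset α)
    (hL : ∀ i ∈ M, PL x a θ (M.erase i)) (hD : ∀ i ∈ M, PD x a θ (M.erase i)) :
    PA x a θ M := by
  intro S c c' hV hcc
  have key : ∀ T : Finset α, T ⊆ M →
      LR (G x a θ M S c) (G x a θ M S (fun l => if l ∈ T then c' l else c l)) := by
    intro T
    induction T using Finset.induction_on with
    | empty => intro _; simpa using LR.refl _
    | insert i T hi ih =>
      intro hT
      have hiM : i ∈ M := hT (Finset.mem_insert_self _ _)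
      have h1 := ih ((Finset.subset_insert _ _).trans hT)
      have hle : ∀ T : Finset α, c' ≤ fun l => if l ∈ T then c' l else c l := by
        intro T l; dsimp only; split_ifs
        · exact le_rfl
        · exact hcc l
      refine LR.trans1 (G_SP hx ha hθ M S c (hV.le hcc)) (G_SP hx ha hθ M S _ (hV.le (hle T)))
        (G_SP hx ha hθ M S _ (hV.le (hle (insert i T)))).nn h1 ?_
      have := alpha1 (S := S) hx ha (Finset.notMem_erase i M) (hL i hiM) (hD i hiM)
        (fun l => if l ∈ T then c' l else c l) (fun l => if l ∈ insert i T then c' l else c l)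
        (hV.le (hle (insert i T))) ?_ ?_
      · rwa [Finset.insert_erase hiM] at this
      · intro l
        dsimp only
        by_cases h : l = i
        · subst h; simp [hi, hcc l]
        · simp [h]
      · intro l h
        simp [h]
  have := key M subset_rfl
  rwa [G_congr (c := fun l => if l ∈ M then c' l else c l) (c' := c') θ S (fun _ _ => rfl)
    (fun _ _ => rfl) (fun l hl => by simp [hl])] at this

lemma stepD (hθ0 : 0 ≤ θ) (M : Finset α) (hA : PA x a θ M) (ha : ∀ i j, 0 ≤ a i j) :
    PD x a θ M := by
  intro S c hV j hj
  have hV' : V a (S.erase j) (fun i => c i - a i j) := fun i => by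
    have := hV i
    rw [← Finset.add_sum_erase _ _ hj] at this
    dsimp only
    linarith
  have h := hA (S.erase j) c (fun i => c i - a i j) hV' (fun i => by
    have := ha i j; dsimp only; linarith)
  have e := G_E x a θ (Finset.notMem_erase j S) M c
  rw [Finset.insert_erase hj] at e
  rw [e]
  intro k
  have := mul_le_mul_of_nonneg_left (h k) hθ0
  simp only [coeff_sub, coeff_C_mul]
  linarith

lemma stepL (hx : ∀ i, 0 < x i) (ha : ∀ i j, 0 ≤ a i j) (hθ : θ < 1) {i : α} {M : Finset α}
    (hi : i ∉ M) (hL : PL x a θ M) (hC : PC x a θ M) (hD : PD x a θ M) :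
    PL x a θ (insert i M) := by
  intro S c hV
  have hVj : ∀ j, V a (S.erase j) c := fun j => hV.mono ha (Finset.erase_subset _ _)
  have s0 := G_SP hx ha hθ M S c hV
  have sj := fun j => G_SP hx ha hθ M (S.erase j) c (hVj j)
  have l0 := hL S c hV
  have lj := fun j => hL (S.erase j) c (hVj j)
  have he := (sub_pos.2 (hV i)).le
  rw [G_R x a θ hi]
  simp only [mul_add, Finset.mul_sum, mul_left_comm (X : ℝ[X]) (C _)]
  refine LR.add_left (LR.add_left ?_ ?_) ?_
  · refine LR.smul_left (hx i).le ?_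
    refine LR.add_right (LR.add_right ?_ ?_) ?_
    · exact l0.shift.smul_right (hx i).le
    · exact (LR.refl _).smul_right he
    · exact LR.sum_right _ _ fun j hj => (hD S c hV j hj).shift.smul_right (ha i j)
  · refine LR.smul_left he ?_
    refine LR.add_right (LR.add_right ?_ ?_) ?_
    · exact (LR.trans2 s0 (by omega) s0 s0.nn.shift.shift l0 l0.shift).smul_right (hx i).le
    · exact l0.smul_right he
    · exact LR.sum_right _ _ fun j hj =>
        (LR.trans1 s0 (sj j) (sj j).nn.shift (hD S c hV j hj) (lj j)).smul_right (ha i j)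
  · refine LR.sum_left _ _ fun j hj => LR.smul_left (ha i j) ?_
    refine LR.add_right (LR.add_right ?_ ?_) ?_
    · exact (LR.trans2 (sj j) (by omega) s0 s0.nn.shift.shift (hC S c hV j hj) l0.shift).smul_right (hx i).le
    · exact (hC S c hV j hj).smul_right he
    · refine LR.sum_right _ _ fun j' hj' => LR.smul_right (ha i j') ?_
      by_cases hjj : j = j'
      · subst hjj; exact lj j
      · have h1 := hD (S.erase j) c (hVj j) j' (Finset.mem_erase.2 ⟨Ne.symm hjj, hj'⟩)
        have h2 := hC (S.erase j') c (hVj j') j (Finset.mem_erase.2 ⟨hjj, hj⟩)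
        rw [Finset.erase_right_comm] at h1
        exact LR.trans1 (sj j) (G_SP hx ha hθ M _ c ((hVj j').mono ha (Finset.erase_subset _ _)))
          (sj j').nn.shift h1 h2

lemma stepC (hx : ∀ i, 0 < x i) (ha : ∀ i j, 0 ≤ a i j) (hθ0 : 0 ≤ θ) (hθ : θ < 1) (M : Finset α)
    (hL : ∀ i ∈ M, PL x a θ (M.erase i)) (hC : ∀ i ∈ M, PC x a θ (M.erase i))
    (hA : ∀ i ∈ M, PA x a θ (M.erase i)) (hLM : PL x a θ M) : PC x a θ M := by
  have key : ∀ (S : Finset ι) (c c' : α → ℝ), V a S c' → c' ≤ c → ∀ T : Finset α, T ⊆ M →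
      LR (G x a θ M S c) (X * (G x a θ M S c -
        G x a θ M S (fun l => if l ∈ T then c' l else c l))) := by
    intro S c c' hV hcc T
    induction T using Finset.induction_on with
    | empty => intro _; simpa using LR.zero_right _
    | insert i T hi ih =>
      intro hT
      have hiM : i ∈ M := hT (Finset.mem_insert_self _ _)
      have h1 := ih ((Finset.subset_insert _ _).trans hT)
      have hle : ∀ T : Finset α, c' ≤ fun l => if l ∈ T then c' l else c l := by
        intro T l; dsimp only; split_ifs
        · exact le_rfl
        · exact hcc l
      have hle2 : (fun l => if l ∈ T then c' l else c l) ≤ c := by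
        intro l; dsimp only; split_ifs
        · exact hcc l
        · exact le_rfl
      have hu := G_upd x a θ (Finset.notMem_erase i M) S
        (c := fun l => if l ∈ T then c' l else c l)
        (c' := fun l => if l ∈ insert i T then c' l else c l) (by intro l h; simp [h])
      rw [Finset.insert_erase hiM] at hu
      have e : X * (G x a θ M S c - G x a θ M S (fun l => if l ∈ insert i T then c' l else c l)) =
        X * (G x a θ M S c - G x a θ M S (fun l => if l ∈ T then c' l else c l)) +
        C (c i - c' i) * (X * G x a θ (M.erase i) S (fun l => if l ∈ T then c' l else c l)) := by
        rw [hu]; simp only [hi, if_false, Finset.mem_insert_self, if_true]; ring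
      rw [e]
      refine LR.add_right h1 (LR.smul_right (sub_nonneg.2 (hcc i)) ?_)
      have b := beta hx ha (Finset.notMem_erase i M) (hL i hiM) (hC i hiM) S c (hV.le hcc)
      rw [Finset.insert_erase hiM] at b
      refine LR.trans2 (G_SP hx ha hθ M S c (hV.le hcc)) ?_
        (G_SP hx ha hθ (M.erase i) S c (hV.le hcc))
        (G_SP hx ha hθ _ S _ (hV.le (hle T))).nn.shift b
        (hA i hiM S c _ (hV.le (hle T)) hle2).shift
      rw [Finset.card_erase_of_mem hiM]; omega
  intro S c hV j hj
  have hV' : V a (S.erase j) (fun i => c i - a i j) := fun i => by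
    have := hV i
    rw [← Finset.add_sum_erase _ _ hj] at this
    dsimp only
    linarith
  have e := G_E x a θ (Finset.notMem_erase j S) M c
  rw [Finset.insert_erase hj] at e
  have k1 := key (S.erase j) c (fun i => c i - a i j) hV' (fun i => by
    have := ha i j; dsimp only; linarith) M subset_rfl
  rw [G_congr (c := fun l => if l ∈ M then c l - a l j else c l) (c' := fun i => c i - a i j)
    θ _ (fun _ _ => rfl) (fun _ _ => rfl) (fun l hl => by simp [hl])] at k1
  have k2 := hLM (S.erase j) c (hV.mono ha (Finset.erase_subset _ _))
  have e2 : X * G x a θ M S c = C (1 - θ) * (X * G x a θ M (S.erase j) c) +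
     C θ * (X * (G x a θ M (S.erase j) c - G x a θ M (S.erase j) (fun i => c i - a i j))) := by
    rw [e]; simp only [map_sub, map_one]; ring
  rw [e2]
  exact (k2.smul_right (by linarith)).add_right (k1.smul_right hθ0)

lemma main_pos (hx : ∀ i, 0 < x i) (ha : ∀ i j, 0 ≤ a i j) (hθ0 : 0 ≤ θ) (hθ : θ < 1)
    (M : Finset α) : PL x a θ M ∧ PC x a θ M ∧ PD x a θ M ∧ PA x a θ M := by
  induction M using Finset.strongInduction with
  | H M ih =>
    have ih' := fun i (hi : i ∈ M) => ih (M.erase i) (Finset.erase_ssubset hi)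
    have hA : PA x a θ M := stepA hx ha hθ M (fun i hi => (ih' i hi).1) (fun i hi => (ih' i hi).2.2.1)
    have hD : PD x a θ M := stepD hθ0 M hA ha
    have hL : PL x a θ M := by
      rcases M.eq_empty_or_nonempty with rfl | ⟨i, hi⟩
      · intro S c hV k
        have hnn := (G_SP hx ha hθ ∅ S c hV)
        rw [hnn.2 (k+1) (by simp), zero_mul]
        exact mul_nonneg (hnn.nn _) (hnn.nn.shift _)
      · have h := ih' i hi
        have := stepL hx ha hθ (Finset.notMem_erase i M) h.1 h.2.1 h.2.2.1
        rwa [Finset.insert_erase hi] at this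
    have hC : PC x a θ M := stepC hx ha hθ0 hθ M (fun i hi => (ih' i hi).1)
      (fun i hi => (ih' i hi).2.1) (fun i hi => (ih' i hi).2.2.2) hL
    exact ⟨hL, hC, hD, hA⟩

end

def CC (P : ℝ → ℝ[X]) : Prop := ∀ k, Continuous fun ε => (P ε).coeff k

lemma CC.mul {P Q : ℝ → ℝ[X]} (hP : CC P) (hQ : CC Q) : CC (fun ε => P ε * Q ε) := fun k => by
  simp only [coeff_mul]
  exact continuous_finsetSum _ fun z _ => (hP _).mul (hQ _)

lemma CC.add {P Q : ℝ → ℝ[X]} (hP : CC P) (hQ : CC Q) : CC (fun ε => P ε + Q ε) := fun k => by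
  simp only [coeff_add]
  exact (hP k).add (hQ k)

lemma CC.const (P : ℝ[X]) : CC (fun _ => P) := fun k => continuous_const

lemma CC.C {f : ℝ → ℝ} (hf : Continuous f) : CC (fun ε => C (f ε)) := fun k => by
  simp only [coeff_C]
  split_ifs
  · exact hf
  · exact continuous_const

lemma CC.sum {β : Type*} (s : Finset β) {P : β → ℝ → ℝ[X]} (h : ∀ b ∈ s, CC (P b)) :
    CC (fun ε => ∑ b ∈ s, P b ε) := fun k => by
  simp only [finsetSum_coeff]
  exact continuous_finsetSum _ fun z hz => h z hz k

lemma CC.prod {β : Type*} (s : Finset β) {P : β → ℝ → ℝ[X]} (h : ∀ b, CC (P b)) :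
    CC (fun ε => ∏ b ∈ s, P b ε) := by
  classical
  induction s using Finset.induction_on with
  | empty => simpa using CC.const 1
  | insert i s hi ih =>
    simp only [Finset.prod_insert hi]
    exact (h i).mul ih

lemma LR_lim {F H : ℝ → ℝ[X]} (hF : CC F) (hH : CC H)
    (h : ∀ ε, 0 < ε → ε < 1 → LR (F ε) (H ε)) : LR (F 0) (H 0) := fun k => by
  have h1 : Continuous fun ε => (F ε).coeff (k+1) * (H ε).coeff k := (hF _).mul (hH _)
  have h2 : Continuous fun ε => (F ε).coeff k * (H ε).coeff (k+1) := (hF _).mul (hH _)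
  refine le_of_tendsto_of_tendsto (b := nhdsWithin (0:ℝ) (Set.Ioi 0))
    (h1.continuousAt.tendsto.mono_left nhdsWithin_le_nhds)
    (h2.continuousAt.tendsto.mono_left nhdsWithin_le_nhds) ?_
  filter_upwards [Ioo_mem_nhdsGT (zero_lt_one' ℝ)] with ε hε
  exact h ε hε.1 hε.2 k

section
variable {α ι : Type*} [DecidableEq α] [DecidableEq ι]

lemma G_CC (x : α → ℝ) (a : α → ι → ℝ) (M : Finset α) (S : Finset ι) (c : α → ℝ) :
    CC (fun ε => G (fun i => x i + ε) a (1 - ε) M S (fun i => c i + ε)) := by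
  unfold G
  refine CC.sum _ fun U _ => CC.mul (CC.C (by fun_prop)) (CC.prod _ fun i => ?_)
  exact CC.add (CC.mul (CC.C (by fun_prop)) (CC.const X)) (CC.C (by fun_prop))

lemma lim_L {x : α → ℝ} {a : α → ι → ℝ} (hx : ∀ i, 0 ≤ x i) (ha : ∀ i j, 0 ≤ a i j)
    (M : Finset α) (S : Finset ι) (c : α → ℝ) (hc : ∀ i, ∑ j ∈ S, a i j ≤ c i) :
    LR (G x a 1 M S c) (X * G x a 1 M S c) := by
  have := LR_lim (G_CC x a M S c) ((CC.const X).mul (G_CC x a M S c)) (fun ε h0 h1 =>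
    (main_pos (x := fun i => x i + ε) (fun i => by have := hx i; positivity) ha
      (by linarith) (by linarith) M).1 S _ (fun i => by have := hc i; linarith))
  simpa using this

lemma lim_C {x : α → ℝ} {a : α → ι → ℝ} (hx : ∀ i, 0 ≤ x i) (ha : ∀ i j, 0 ≤ a i j)
    (M : Finset α) (S : Finset ι) (c : α → ℝ) (hc : ∀ i, ∑ j ∈ S, a i j ≤ c i) (j : ι)
    (hj : j ∈ S) :
    LR (G x a 1 M (S.erase j) c) (X * G x a 1 M S c) := by
  have := LR_lim (G_CC x a M (S.erase j) c) ((CC.const X).mul (G_CC x a M S c)) (fun ε h0 h1 =>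
    (main_pos (x := fun i => x i + ε) (fun i => by have := hx i; positivity) ha
      (by linarith) (by linarith) M).2.1 S _ (fun i => by have := hc i; linarith) j hj)
  simpa using this

end

lemma occ_indicator {m n : ℕ} (σ : Fin m → Fin (n+1)) (d : ℕ) :
    (if (∀ j : Fin (n+1), (j : ℕ) < d → 1 ≤ ballCount σ j) then (1 : ℝ[X]) else 0) =
    ∑ U ∈ (Finset.univ.filter fun j : Fin (n+1) => (j : ℕ) < d).powerset,
      C ((-1 : ℝ) ^ U.card) * ∏ i, (if σ i ∉ U then (1 : ℝ[X]) else 0) := by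
  set S := Finset.univ.filter fun j : Fin (n+1) => (j : ℕ) < d with hS
  have h1 : ∀ U : Finset (Fin (n+1)), (∏ i, (if σ i ∉ U then (1 : ℝ[X]) else 0)) =
      if (∀ i, σ i ∉ U) then 1 else 0 := by
    intro U
    rw [Finset.prod_ite_zero]
    simp
  simp only [h1, mul_ite, mul_one, mul_zero]
  rw [← Finset.sum_filter]
  have h2 : S.powerset.filter (fun U => ∀ i, σ i ∉ U) =
      (S.filter fun j => ∀ i, σ i ≠ j).powerset := by
    ext U
    simp only [Finset.mem_filter, Finset.mem_powerset, Finset.subset_iff]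
    constructor
    · rintro ⟨h, h'⟩ j hj
      exact ⟨h hj, fun i hi => h' i (hi ▸ hj)⟩
    · intro h
      exact ⟨fun j hj => (h hj).1, fun i hi => (h hi).2 i rfl⟩
  rw [h2, ← map_sum]
  have h3 := Finset.sum_pow_mul_eq_add_pow (-1 : ℝ) 1 (S.filter fun j => ∀ i, σ i ≠ j)
  simp only [one_pow, mul_one] at h3
  rw [h3, neg_add_cancel]
  have h4 : (∀ j : Fin (n+1), (j : ℕ) < d → 1 ≤ ballCount σ j) ↔
      (S.filter fun j => ∀ i, σ i ≠ j).card = 0 := by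
    rw [Finset.card_eq_zero, Finset.filter_eq_empty_iff]
    simp only [hS, Finset.mem_filter, Finset.mem_univ, true_and, ballCount, Nat.one_le_iff_ne_zero,
      Finset.card_ne_zero, Finset.Nonempty]
    push Not
    rfl
  by_cases h : (S.filter fun j => ∀ i, σ i ≠ j).card = 0
  · rw [if_pos (h4.2 h), h]; simp
  · rw [if_neg (fun h' => h (h4.1 h')), zero_pow h]; simp

def W {m n : ℕ} (p : Fin m → Fin (n+1) → ℝ) (d : ℕ) : ℝ[X] :=
  ∑ Z : Finset (Fin m), C (wOcc p d Z) * X ^ Z.card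

lemma W_coeff {m n : ℕ} (p : Fin m → Fin (n+1) → ℝ) (d k : ℕ) :
    (W p d).coeff k = ∑ Z ∈ Finset.univ.filter (fun Z : Finset (Fin m) => Z.card = k), wOcc p d Z := by
  unfold W
  simp only [finsetSum_coeff, coeff_C_mul, coeff_X_pow, mul_ite, mul_one, mul_zero]
  rw [Finset.sum_filter]
  refine Finset.sum_congr rfl fun Z _ => ?_
  simp only [eq_comm]

lemma W_eq {m n : ℕ} (p : Fin m → Fin (n+1) → ℝ) (d : ℕ) (hd : d ≤ n) :
    W p d = G (fun i => p i (Fin.last n)) p 1 Finset.univ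
      (Finset.univ.filter fun j : Fin (n+1) => (j : ℕ) < d)
      (fun i => ∑ j ∈ Finset.univ.erase (Fin.last n), p i j) := by
  have h1 : W p d = ∑ σ : Fin m → Fin (n+1),
      (∏ i, (C (p i (σ i)) * (if σ i = Fin.last n then X else 1))) *
      (if (∀ j : Fin (n+1), (j : ℕ) < d → 1 ≤ ballCount σ j) then (1 : ℝ[X]) else 0) := by
    unfold W wOcc
    simp only [map_sum, Finset.sum_mul]
    rw [Finset.sum_comm]
    refine Finset.sum_congr rfl fun σ _ => ?_
    rw [Finset.sum_eq_single (Finset.univ.filter fun i => σ i = Fin.last n)]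
    · rw [Finset.prod_mul_distrib, Finset.prod_ite]
      simp only [Finset.mem_filter, Finset.mem_univ, true_and, implies_true, Finset.prod_const,
        one_pow, mul_one, urnWeight]
      split_ifs <;> simp [map_prod]
    · intro Z _ hZ
      rw [if_neg]
      · simp
      · rintro ⟨h, _⟩
        apply hZ
        ext i
        simp [h i]
    · simp
  rw [h1]
  simp only [occ_indicator, Finset.mul_sum]
  rw [Finset.sum_comm]
  unfold G
  refine Finset.sum_congr rfl fun U hU => ?_
  have hlast : Fin.last n ∉ U := fun h => by
    have := Finset.mem_powerset.1 hU h
    simp at this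
    omega
  have h2 : ∀ i, C (p i (Fin.last n)) * X +
      C (∑ j ∈ Finset.univ.erase (Fin.last n), p i j - ∑ j ∈ U, p i j) =
      ∑ j : Fin (n+1), C (p i j) * (if j = Fin.last n then X else 1) *
        (if j ∉ U then (1 : ℝ[X]) else 0) := by
    intro i
    rw [← Finset.add_sum_erase _ _ (Finset.mem_univ (Fin.last n))]
    simp only [if_true, hlast, not_false_eq_true, mul_one]
    congr 1
    have hsub : U ⊆ Finset.univ.erase (Fin.last n) := fun j hj =>
      Finset.mem_erase.2 ⟨fun h => hlast (h ▸ hj), Finset.mem_univ _⟩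
    rw [← Finset.sum_sdiff hsub, add_sub_cancel_right, map_sum, ← Finset.sum_sdiff hsub]
    rw [Finset.sum_eq_zero (s := U), add_zero]
    · refine Finset.sum_congr rfl fun j hj => ?_
      simp only [Finset.mem_sdiff, Finset.mem_erase] at hj
      simp [hj.2, hj.1.1]
    · intro j hj; simp [hj]
  simp only [h2]
  rw [Finset.prod_univ_sum, Finset.mul_sum]
  simp only [Fintype.piFinset_univ]
  refine Finset.sum_congr rfl fun σ _ => ?_
  simp only [Finset.prod_mul_distrib]
  ring

def p0 {m n : ℕ} (p : Fin m → Fin (n+1) → ℝ) (i : Fin m) : Fin m → Fin (n+1) → ℝ :=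
  fun l j => if l = i ∧ j = Fin.last n then 0 else p l j

def p1 {m n : ℕ} (p : Fin m → Fin (n+1) → ℝ) (i : Fin m) : Fin m → Fin (n+1) → ℝ :=
  fun l j => if l = i ∧ j ≠ Fin.last n then 0 else p l j

lemma LR_W {m n : ℕ} (p : Fin m → Fin (n+1) → ℝ) (hp : ∀ i j, 0 ≤ p i j) (d : ℕ) (hd : d ≤ n)
    (i : Fin m) : LR (W (p0 p i) d) (W (p1 p i) d) := by
  rw [W_eq _ d hd, W_eq _ d hd]
  set S := Finset.univ.filter fun j : Fin (n+1) => (j : ℕ) < d with hS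
  have hSl : ∀ j ∈ S, j ≠ Fin.last n := by
    rintro j hj rfl
    simp [hS] at hj
    omega
  set M := Finset.univ.erase i with hM
  have hi : i ∉ M := Finset.notMem_erase _ _
  have hu : (Finset.univ : Finset (Fin m)) = insert i M := (Finset.insert_erase (Finset.mem_univ i)).symm
  have hMi : ∀ l ∈ M, l ≠ i := fun l hl h => hi (h ▸ hl)
  have e0 : ∀ S, G (fun i_1 => p0 p i i_1 (Fin.last n)) (p0 p i) 1 M S
      (fun l => ∑ j ∈ Finset.univ.erase (Fin.last n), p0 p i l j) =
      G (fun l => p l (Fin.last n)) p 1 M S (fun l => ∑ j ∈ Finset.univ.erase (Fin.last n), p l j) := by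
    intro S
    refine G_congr _ _ ?_ ?_ ?_ <;> intro l hl
    · simp [p0, hMi l hl]
    · funext j; simp [p0, hMi l hl]
    · simp [p0, hMi l hl]
  have e1 : ∀ S, G (fun i_1 => p1 p i i_1 (Fin.last n)) (p1 p i) 1 M S
      (fun l => ∑ j ∈ Finset.univ.erase (Fin.last n), p1 p i l j) =
      G (fun l => p l (Fin.last n)) p 1 M S (fun l => ∑ j ∈ Finset.univ.erase (Fin.last n), p l j) := by
    intro S
    refine G_congr _ _ ?_ ?_ ?_ <;> intro l hl
    · simp [p1, hMi l hl]
    · funext j; simp [p1, hMi l hl]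
    · simp [p1, hMi l hl]
  have hc : ∀ l, ∑ j ∈ S, p l j ≤ ∑ j ∈ Finset.univ.erase (Fin.last n), p l j := fun l =>
    Finset.sum_le_sum_of_subset_of_nonneg
      (fun j hj => Finset.mem_erase.2 ⟨hSl j hj, Finset.mem_univ _⟩) (fun _ _ _ => hp _ _)
  have hL := lim_L (fun l => hp l (Fin.last n)) hp M S _ hc
  have hC := lim_C (fun l => hp l (Fin.last n)) hp M S _ hc
  rw [hu, G_R _ _ _ hi, G_R _ _ _ hi, e0, e1]
  simp only [e0, e1]
  have z0 : p0 p i i (Fin.last n) = 0 := by simp [p0]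
  have z1 : p1 p i i (Fin.last n) = p i (Fin.last n) := by simp [p1]
  have z2 : ∀ j ∈ S, p0 p i i j = p i j := fun j hj => by simp [p0, hSl j hj]
  have z3 : ∀ j ∈ S, p1 p i i j = 0 := fun j hj => by simp [p1, hSl j hj]
  have z4 : ∑ j ∈ Finset.univ.erase (Fin.last n), p1 p i i j = 0 :=
    Finset.sum_eq_zero fun j hj => by simp [p1, (Finset.mem_erase.1 hj).1]
  have z5 : ∑ j ∈ Finset.univ.erase (Fin.last n), p0 p i i j =
      ∑ j ∈ Finset.univ.erase (Fin.last n), p i j :=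
    Finset.sum_congr rfl fun j hj => by simp [p0, (Finset.mem_erase.1 hj).1]
  have z6 : ∑ j ∈ S, p1 p i i j = 0 := Finset.sum_eq_zero z3
  have z7 : ∑ j ∈ S, p0 p i i j = ∑ j ∈ S, p i j := Finset.sum_congr rfl z2
  rw [z0, z1, z4, z5, z6, z7]
  have y : ∀ H : Fin (n+1) → ℝ[X], ∑ j ∈ S, C (p1 p i i j) * H j = 0 := fun H =>
    Finset.sum_eq_zero fun j hj => by rw [z3 j hj]; simp
  rw [y, sub_zero, map_zero, zero_mul, zero_mul, add_zero, add_zero, zero_add]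
  refine LR.smul_right (hp _ _) (LR.add_left ?_ ?_)
  · exact hL.smul_left (sub_nonneg.2 (hc i))
  · refine LR.sum_left _ _ fun j hj => ?_
    rw [z2 j hj]
    exact (hC j hj).smul_left (hp i j)

lemma wOcc_p0 {m n : ℕ} (p : Fin m → Fin (n+1) → ℝ) (d : ℕ) (i : Fin m) (Z : Finset (Fin m)) :
    wOcc (p0 p i) d Z = if i ∈ Z then 0 else wOcc p d Z := by
  unfold wOcc
  split_ifs with h
  · refine Finset.sum_eq_zero fun σ _ => ?_
    split_ifs with h'
    · refine Finset.prod_eq_zero (Finset.mem_univ i) ?_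
      simp [p0, (h'.1 i).2 h]
    · rfl
  · refine Finset.sum_congr rfl fun σ _ => ?_
    split_ifs with h'
    · refine Finset.prod_congr rfl fun l _ => ?_
      unfold p0
      rw [if_neg]
      rintro ⟨rfl, h2⟩
      exact h ((h'.1 _).1 h2)
    · rfl

lemma wOcc_p1 {m n : ℕ} (p : Fin m → Fin (n+1) → ℝ) (d : ℕ) (i : Fin m) (Z : Finset (Fin m)) :
    wOcc (p1 p i) d Z = if i ∈ Z then wOcc p d Z else 0 := by
  unfold wOcc
  split_ifs with h
  · refine Finset.sum_congr rfl fun σ _ => ?_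
    split_ifs with h'
    · refine Finset.prod_congr rfl fun l _ => ?_
      unfold p1
      rw [if_neg]
      rintro ⟨rfl, h2⟩
      exact h2 ((h'.1 _).2 h)
    · rfl
  · refine Finset.sum_eq_zero fun σ _ => ?_
    split_ifs with h'
    · refine Finset.prod_eq_zero (Finset.mem_univ i) ?_
      have : σ i ≠ Fin.last n := fun h2 => h ((h'.1 i).1 h2)
      simp [p1, this]
    · rfl

lemma wOcc_nonneg {m n : ℕ} (p : Fin m → Fin (n+1) → ℝ) (hp : ∀ i j, 0 ≤ p i j) (d : ℕ)
    (Z : Finset (Fin m)) : 0 ≤ wOcc p d Z := by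
  unfold wOcc
  refine Finset.sum_nonneg fun σ _ => ?_
  split_ifs
  · exact Finset.prod_nonneg fun _ _ => hp _ _
  · exact le_rfl

/-- level sums -/
def sA {m : ℕ} (w : Finset (Fin m) → ℝ) (A : Set (Finset (Fin m))) (k : ℕ) : ℝ :=
  ∑ Z ∈ Finset.univ.filter (fun Z : Finset (Fin m) => Z ∈ A ∧ Z.card = k), w Z

def sU {m : ℕ} (w : Finset (Fin m) → ℝ) (k : ℕ) : ℝ :=
  ∑ Z ∈ Finset.univ.filter (fun Z : Finset (Fin m) => Z.card = k), w Z

def w1 {m : ℕ} (w : Finset (Fin m) → ℝ) (i : Fin m) (Z : Finset (Fin m)) : ℝ :=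
  if i ∈ Z then w Z else 0
def w0 {m : ℕ} (w : Finset (Fin m) → ℝ) (i : Fin m) (Z : Finset (Fin m)) : ℝ :=
  if i ∈ Z then 0 else w Z

lemma sum_w10 {m : ℕ} (w : Finset (Fin m) → ℝ) (i : Fin m) (s : Finset (Finset (Fin m))) :
    ∑ Z ∈ s, w Z = ∑ Z ∈ s, w1 w i Z + ∑ Z ∈ s, w0 w i Z := by
  rw [← Finset.sum_add_distrib]
  refine Finset.sum_congr rfl fun Z _ => ?_
  unfold w1 w0; split_ifs <;> simp

lemma sum_w1 {m : ℕ} (w : Finset (Fin m) → ℝ) (s : Finset (Finset (Fin m))) (k : ℕ)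
    (hs : ∀ Z ∈ s, Z.card = k) : ∑ i, ∑ Z ∈ s, w1 w i Z = k * ∑ Z ∈ s, w Z := by
  rw [Finset.sum_comm, Finset.mul_sum]
  refine Finset.sum_congr rfl fun Z hZ => ?_
  unfold w1
  rw [← Finset.sum_filter]
  simp [hs Z hZ]

lemma fm {m : ℕ} (w : Finset (Fin m) → ℝ) (hw : ∀ Z, 0 ≤ w Z) (A : Set (Finset (Fin m)))
    (hA : ∀ S ∈ A, ∀ T : Finset (Fin m), S ⊆ T → T ∈ A) (k : ℕ)
    (h2 : ∀ i, sU (w1 w i) k * sU (w0 w i) (k+1) ≤ sU (w1 w i) (k+1) * sU (w0 w i) k)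
    (hind : ∀ i, 0 < sU (w1 w i) k → 0 < sU (w0 w i) k →
      sA (w1 w i) A k * sU (w1 w i) (k+1) ≤ sA (w1 w i) A (k+1) * sU (w1 w i) k ∧
      sA (w0 w i) A k * sU (w0 w i) (k+1) ≤ sA (w0 w i) A (k+1) * sU (w0 w i) k) :
    sA w A k * sU w (k+1) ≤ sA w A (k+1) * sU w k := by
  have hw1 : ∀ i Z, 0 ≤ w1 w i Z := fun i Z => by unfold w1; split_ifs <;> simp [hw]
  have hw0 : ∀ i Z, 0 ≤ w0 w i Z := fun i Z => by unfold w0; split_ifs <;> simp [hw]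
  have dA : ∀ i k, sA w A k = sA (w1 w i) A k + sA (w0 w i) A k := fun i k => sum_w10 w i _
  have dU : ∀ i k, sU w k = sU (w1 w i) k + sU (w0 w i) k := fun i k => sum_w10 w i _
  have nA : ∀ (v : Finset (Fin m) → ℝ) k, (∀ Z, 0 ≤ v Z) → 0 ≤ sA v A k := fun v k h =>
    Finset.sum_nonneg fun _ _ => h _
  have nU : ∀ (v : Finset (Fin m) → ℝ) k, (∀ Z, 0 ≤ v Z) → 0 ≤ sU v k := fun v k h =>
    Finset.sum_nonneg fun _ _ => h _
  have leAU : ∀ (v : Finset (Fin m) → ℝ) k, (∀ Z, 0 ≤ v Z) → sA v A k ≤ sU v k := fun v k h => by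
    refine Finset.sum_le_sum_of_subset_of_nonneg ?_ fun _ _ _ => h _
    intro Z; simp
  by_cases hex : ∃ i, 0 < sU (w1 w i) k ∧ 0 < sU (w0 w i) k ∧
      sA (w0 w i) A k * sU (w1 w i) k ≤ sA (w1 w i) A k * sU (w0 w i) k
  · obtain ⟨i, ht1, ht0, hcov⟩ := hex
    obtain ⟨g1, g0⟩ := hind i ht1 ht0
    have g2 := h2 i
    rw [dA i k, dA i (k+1), dU i k, dU i (k+1)]
    have hp := mul_pos ht1 ht0
    refine le_of_mul_le_mul_left ?_ hp
    have q1 := mul_nonneg (sub_nonneg.2 hcov) (sub_nonneg.2 g2)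
    have q2 := mul_le_mul_of_nonneg_left g1 (mul_pos ht0 (add_pos ht1 ht0)).le
    have q3 := mul_le_mul_of_nonneg_left g0 (mul_pos ht1 (add_pos ht1 ht0)).le
    nlinarith
  · push Not at hex
    have hdeg : ∀ i, 0 < sU (w1 w i) k → sU (w0 w i) k = 0 := by
      have hz : ∑ i, (sA (w1 w i) A k * sU (w0 w i) k - sA (w0 w i) A k * sU (w1 w i) k) = 0 := by
        have : ∀ i, sA (w1 w i) A k * sU (w0 w i) k - sA (w0 w i) A k * sU (w1 w i) k =
            sA (w1 w i) A k * sU w k - sA w A k * sU (w1 w i) k := fun i => by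
          rw [dA i k, dU i k]; ring
        simp only [this]
        rw [Finset.sum_sub_distrib, ← Finset.sum_mul, ← Finset.mul_sum]
        have a1 : ∑ i, sA (w1 w i) A k = k * sA w A k := sum_w1 w _ k (by simp)
        have a2 : ∑ i, sU (w1 w i) k = k * sU w k := sum_w1 w _ k (by simp)
        rw [a1, a2]; ring
      have hle : ∀ i ∈ Finset.univ,
          sA (w1 w i) A k * sU (w0 w i) k - sA (w0 w i) A k * sU (w1 w i) k ≤ 0 := by
        intro i _
        rcases (nU _ k (hw1 i)).eq_or_lt with h | h
        · have := leAU _ k (hw1 i)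
          have := nA _ k (hw1 i)
          have : sA (w1 w i) A k = 0 := by linarith
          rw [this, ← h]; simp
        · rcases (nU _ k (hw0 i)).eq_or_lt with h' | h'
          · have := leAU _ k (hw0 i)
            have := nA _ k (hw0 i)
            have : sA (w0 w i) A k = 0 := by linarith
            rw [this, ← h']; simp
          · linarith [hex i h h']
      intro i hi
      by_contra hne
      have h' : 0 < sU (w0 w i) k := lt_of_le_of_ne (nU _ k (hw0 i)) (Ne.symm hne)
      have := (Finset.sum_eq_zero_iff_of_nonpos hle).1 hz i (Finset.mem_univ _)
      linarith [hex i hi h']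
    by_cases hne : ∃ Z ∈ A, Z.card = k ∧ 0 < w Z
    · obtain ⟨Z, hZA, hZk, hZw⟩ := hne
      have hall : ∀ Z' : Finset (Fin m), Z'.card = k + 1 → w Z' ≠ 0 → Z' ∈ A := by
        intro Z' hc hne
        refine hA Z hZA Z' fun i hi => ?_
        have h1 : 0 < sU (w1 w i) k := by
          refine lt_of_lt_of_le hZw ?_
          have : w1 w i Z ≤ sU (w1 w i) k :=
            Finset.single_le_sum (f := w1 w i) (fun Z _ => hw1 i Z) (by simp [hZk])
          simpa [w1, hi] using this
        have h3 := hdeg i h1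
        have h4 := h2 i
        rw [h3, mul_zero] at h4
        have h5 : sU (w0 w i) (k+1) = 0 := by
          have := nU _ (k+1) (hw0 i)
          by_contra h
          have := mul_pos h1 (lt_of_le_of_ne this (Ne.symm h))
          linarith
        by_contra hiZ
        have := (Finset.sum_eq_zero_iff_of_nonneg (fun Z _ => hw0 i Z)).1 h5 Z' (by simp [hc])
        simp [w0, hiZ] at this
        exact hne this
      have : sA w A (k+1) = sU w (k+1) := by
        unfold sA sU
        refine Finset.sum_subset (by intro Z; simp) ?_
        intro Z' h1 h3
        by_contra h
        simp only [Finset.mem_filter, Finset.mem_univ, true_and] at h1 h3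
        exact h3 ⟨hall Z' h1 h, h1⟩
      rw [this, mul_comm]
      exact mul_le_mul_of_nonneg_left (leAU w k hw) (nU w _ hw)
    · have : sA w A k = 0 := by
        refine Finset.sum_eq_zero fun Z hZ => ?_
        simp only [Finset.mem_filter, Finset.mem_univ, true_and] at hZ
        by_contra h
        exact hne ⟨Z, hZ.1, hZ.2, lt_of_le_of_ne (hw Z) (Ne.symm h)⟩
      rw [this, zero_mul]
      exact mul_nonneg (nA w _ hw) (nU w _ hw)

def free {m n : ℕ} (p : Fin m → Fin (n+1) → ℝ) : Finset (Fin m) :=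
  Finset.univ.filter fun i => p i (Fin.last n) ≠ 0 ∧ ∃ j, j ≠ Fin.last n ∧ p i j ≠ 0

lemma w1_eq {m n : ℕ} (p : Fin m → Fin (n+1) → ℝ) (d : ℕ) (i : Fin m) :
    w1 (wOcc p d) i = wOcc (p1 p i) d := by
  funext Z; rw [wOcc_p1]; rfl

lemma w0_eq {m n : ℕ} (p : Fin m → Fin (n+1) → ℝ) (d : ℕ) (i : Fin m) :
    w0 (wOcc p d) i = wOcc (p0 p i) d := by
  funext Z; rw [wOcc_p0]; rfl

lemma nmp {m n : ℕ} (d : ℕ) (hd : d ≤ n) (A : Set (Finset (Fin m)))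
    (hA : ∀ S ∈ A, ∀ T : Finset (Fin m), S ⊆ T → T ∈ A) (k : ℕ) (N : ℕ) :
    ∀ (p : Fin m → Fin (n+1) → ℝ), (∀ i j, 0 ≤ p i j) → (free p).card = N →
    sA (wOcc p d) A k * sU (wOcc p d) (k+1) ≤ sA (wOcc p d) A (k+1) * sU (wOcc p d) k := by
  induction N using Nat.strong_induction_on with
  | _ N ih =>
    intro p hp hN
    have hp0 : ∀ i l j, 0 ≤ p0 p i l j := fun i l j => by unfold p0; split_ifs <;> simp [hp]
    have hp1 : ∀ i l j, 0 ≤ p1 p i l j := fun i l j => by unfold p1; split_ifs <;> simp [hp]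
    refine fm _ (wOcc_nonneg p hp d) A hA k ?_ ?_
    · intro i
      have := LR_W p hp d hd i k
      rw [w1_eq, w0_eq]
      simp only [W_coeff] at this
      unfold sU
      linarith
    · intro i h1 h0
      have hpi : i ∈ free p := by
        simp only [free, Finset.mem_filter, Finset.mem_univ, true_and]
        constructor
        · intro h
          have : p1 p i i = 0 := by
            funext j; unfold p1
            by_cases hj : j = Fin.last n
            · simp [hj, h]
            · simp [hj]
          rw [w1_eq] at h1
          have : sU (wOcc (p1 p i) d) k = 0 := by
            refine Finset.sum_eq_zero fun Z _ => Finset.sum_eq_zero fun σ _ => ?_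
            split_ifs
            · exact Finset.prod_eq_zero (Finset.mem_univ i) (by rw [this]; rfl)
            · rfl
          linarith
        · by_contra h
          push Not at h
          have : p0 p i i = 0 := by
            funext j; unfold p0
            by_cases hj : j = Fin.last n
            · simp [hj]
            · simp [hj, h j hj]
          rw [w0_eq] at h0
          have : sU (wOcc (p0 p i) d) k = 0 := by
            refine Finset.sum_eq_zero fun Z _ => Finset.sum_eq_zero fun σ _ => ?_
            split_ifs
            · exact Finset.prod_eq_zero (Finset.mem_univ i) (by rw [this]; rfl)
            · rfl
          linarith
      have f1 : free (p1 p i) ⊂ free p := by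
        refine (Finset.ssubset_iff_of_subset ?_).2 ⟨i, hpi, ?_⟩
        · intro l
          simp only [free, Finset.mem_filter, Finset.mem_univ, true_and]
          rintro ⟨a, j, hj, b⟩
          refine ⟨fun h => a (by simp [p1, h]), j, hj, fun h => b (by simp [p1, h])⟩
        · simp only [free, Finset.mem_filter, Finset.mem_univ, true_and]
          rintro ⟨a, j, hj, b⟩
          exact b (by simp [p1, hj])
      have f0 : free (p0 p i) ⊂ free p := by
        refine (Finset.ssubset_iff_of_subset ?_).2 ⟨i, hpi, ?_⟩
        · intro l
          simp only [free, Finset.mem_filter, Finset.mem_univ, true_and]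
          rintro ⟨a, j, hj, b⟩
          refine ⟨fun h => a (by simp [p0, h]), j, hj, fun h => b (by simp [p0, h])⟩
        · simp only [free, Finset.mem_filter, Finset.mem_univ, true_and]
          rintro ⟨a, _⟩
          exact a (by simp [p0])
      rw [w1_eq, w0_eq]
      exact ⟨ih _ (hN ▸ Finset.card_lt_card f1) _ (hp1 i) rfl,
        ih _ (hN ▸ Finset.card_lt_card f0) _ (hp0 i) rfl⟩

end UrnAux

theorem nuOcc_NMP (m n : ℕ) (p : Fin m → Fin (n+1) → ℝ)
    (hp : ∀ i j, 0 ≤ p i j) (hsum : ∀ i, ∑ j, p i j = 1)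
    (d : ℕ) (hd : d ≤ n)
    (A : Set (Finset (Fin m)))
    (hA : ∀ S ∈ A, ∀ T : Finset (Fin m), S ⊆ T → T ∈ A)
    (k : ℕ) :
    (∑ Z ∈ Finset.univ.filter (fun Z : Finset (Fin m) => Z ∈ A ∧ Z.card = k), wOcc p d Z) *
      (∑ Z ∈ Finset.univ.filter (fun Z : Finset (Fin m) => Z.card = k + 1), wOcc p d Z) ≤
    (∑ Z ∈ Finset.univ.filter (fun Z : Finset (Fin m) => Z ∈ A ∧ Z.card = k + 1), wOcc p d Z) *
      (∑ Z ∈ Finset.univ.filter (fun Z : Finset (Fin m) => Z.card = k), wOcc p d Z) := by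
  exact UrnAux.nmp d hd A hA k _ p hp rfl

end
end

section
/- (Theorem 1.5) The measure ν_a satisfies the normalized matching property: fix d ∈ {0,1,…,n−1} and a = (a_1,…,a_d) ∈ ℕ^d. Then for every increasing family A ⊆ 2^{[m]} (i.e., S ∈ A and S ⊆ T ⊆ [m] imply T ∈ A) and every integer k ≥ 0, (Σ_{Z ∈ A, |Z| = k} w_a(Z)) · (Σ_{Z ⊆ [m], |Z| = k+1} w_a(Z)) ≤ (Σ_{Z ∈ A, |Z| = k+1} w_a(Z)) · (Σ_{Z ⊆ [m], |Z| = k} w_a(Z)); equivalently, the conditional law ν_a( · | |Z| = k+1) stochastically dominates ν_a( · | |Z| = k) whenever both conditionings have positive probability. -/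
/-!
(Theorem 1.5) The measure `ν_a` satisfies the normalized matching property.
The urn model has `n+1` urns (so `d` ranges over `{0,…,n}`), the distinguished
urn being the last one, `Fin.last n`.
-/

open Finset
open scoped Classical

noncomputable section

/-- `w_a(Z)`: total weight of assignments `σ` with `σ⁻¹(last urn) = Z` and with
urn `j` containing exactly `a_j` balls for each of the first `d` urns.  (Urn
indices are `0`-based: the first `d` urns are the indices `j` with `(j : ℕ) < d`.) -/
def wBall {m n : ℕ} (p : Fin m → Fin (n+1) → ℝ) {d : ℕ} (a : Fin d → ℕ)
    (Z : Finset (Fin m)) : ℝ :=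
  ∑ σ : Fin m → Fin (n+1),
    if (∀ i : Fin m, σ i = Fin.last n ↔ i ∈ Z) ∧
        (∀ j : Fin (n+1), ∀ h : (j : ℕ) < d, ballCount σ j = a ⟨(j : ℕ), h⟩) then
      urnWeight p σ else 0


theorem fm_arith (a1 a0 u1 u0 b1 b0 v1 v0 : ℝ) (ha1 : 0 ≤ a1) (ha0 : 0 ≤ a0) (hu1 : 0 < u1) (hu0 : 0 ≤ u0)
  (hb1 : 0 ≤ b1) (hb0 : 0 ≤ b0) (hv1 : 0 ≤ v1) (hv0 : 0 ≤ v0) (hau0 : a0 ≤ u0)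
  (h1 : a1 * v1 ≤ b1 * u1) (h0 : a0 * v0 ≤ b0 * u0) (hp : u1 * v0 ≤ v1 * u0)
  (hc : a0 * u1 ≤ a1 * u0) : (a1+a0)*(v1+v0) ≤ (b1+b0)*(u1+u0) := by
  rcases hu0.eq_or_lt with h | h
  · subst h
    have : a0 = 0 := by linarith
    have hv : v0 = 0 := by nlinarith
    subst this hv
    nlinarith [mul_nonneg hb0 hu1.le]
  · have hpos : 0 < u1 * u0 := mul_pos hu1 h
    have e1 : a1 * v1 / u1 ≤ b1 := by rw [div_le_iff₀ hu1]; exact h1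
    have e0 : a0 * v0 / u0 ≤ b0 := by rw [div_le_iff₀ h]; exact h0
    refine le_trans ?_ (mul_le_mul_of_nonneg_right (add_le_add e1 e0) (by positivity))
    have : (a1 * v1 / u1 + a0 * v0 / u0) * (u1 + u0) - (a1+a0)*(v1+v0)
      = (a1 * u0 - a0 * u1) * (v1 * u0 - u1 * v0) / (u1 * u0) := by
      field_simp; ring
    have h2 : 0 ≤ (a1 * u0 - a0 * u1) * (v1 * u0 - u1 * v0) / (u1 * u0) :=
      div_nonneg (mul_nonneg (by linarith) (by linarith)) hpos.le
    linarith

/-- level sum -/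
def lev {m : ℕ} (w : Finset (Fin m) → ℝ) (A : Set (Finset (Fin m))) (k : ℕ) : ℝ :=
  ∑ Z : Finset (Fin m), if Z ∈ A ∧ Z.card = k then w Z else 0

def rin {m : ℕ} (f : Fin m) (w : Finset (Fin m) → ℝ) : Finset (Fin m) → ℝ :=
  fun Z => if f ∈ Z then w Z else 0
def rout {m : ℕ} (f : Fin m) (w : Finset (Fin m) → ℝ) : Finset (Fin m) → ℝ :=
  fun Z => if f ∈ Z then 0 else w Z

theorem lev_split {m : ℕ} (f : Fin m) (w : Finset (Fin m) → ℝ) (A : Set (Finset (Fin m))) (k : ℕ) :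
    lev w A k = lev (rin f w) A k + lev (rout f w) A k := by
  unfold lev rin rout
  rw [← Finset.sum_add_distrib]
  refine Finset.sum_congr rfl fun Z _ => ?_
  split_ifs <;> simp

theorem lev_nonneg {m : ℕ} {w : Finset (Fin m) → ℝ} (hw : ∀ Z, 0 ≤ w Z) (A : Set (Finset (Fin m))) (k : ℕ) :
    0 ≤ lev w A k := by
  unfold lev
  refine Finset.sum_nonneg fun Z _ => ?_
  split_ifs <;> simp [hw]

theorem lev_mono {m : ℕ} {w : Finset (Fin m) → ℝ} (hw : ∀ Z, 0 ≤ w Z) (A : Set (Finset (Fin m))) (k : ℕ) :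
    lev w A k ≤ lev w Set.univ k := by
  unfold lev
  refine Finset.sum_le_sum fun Z _ => ?_
  by_cases h1 : Z ∈ A <;> by_cases h2 : Z.card = k <;> simp [h1, h2, hw]

theorem lev_rin_sum {m : ℕ} (w : Finset (Fin m) → ℝ) (A : Set (Finset (Fin m))) (k : ℕ) :
    ∑ f, lev (rin f w) A k = k * lev w A k := by
  unfold lev rin
  rw [Finset.sum_comm, Finset.mul_sum]
  refine Finset.sum_congr rfl fun Z _ => ?_
  by_cases h : Z ∈ A ∧ Z.card = k
  · simp [h]
  · simp [h]

def freeSet {m : ℕ} (w : Finset (Fin m) → ℝ) : Finset (Fin m) :=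
  univ.filter fun f => (∃ Z, f ∈ Z ∧ w Z ≠ 0) ∧ (∃ Z, f ∉ Z ∧ w Z ≠ 0)

theorem mem_freeSet {m : ℕ} (w : Finset (Fin m) → ℝ) (f : Fin m) :
    f ∈ freeSet w ↔ (∃ Z, f ∈ Z ∧ w Z ≠ 0) ∧ (∃ Z, f ∉ Z ∧ w Z ≠ 0) := by
  simp [freeSet]

theorem feder_mihail {m : ℕ} (C : Set (Finset (Fin m) → ℝ))
    (hpos : ∀ w ∈ C, ∀ Z, 0 ≤ w Z)
    (hin : ∀ w ∈ C, ∀ f, rin f w ∈ C) (hout : ∀ w ∈ C, ∀ f, rout f w ∈ C)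
    (hpair : ∀ w ∈ C, ∀ f k, lev (rin f w) Set.univ k * lev w Set.univ (k+1)
      ≤ lev (rin f w) Set.univ (k+1) * lev w Set.univ k)
    (A : Set (Finset (Fin m))) (hA : ∀ S ∈ A, ∀ T : Finset (Fin m), S ⊆ T → T ∈ A) (k : ℕ) :
    ∀ (N : ℕ), ∀ w ∈ C, (freeSet w).card = N →
     lev w A k * lev w Set.univ (k+1) ≤ lev w A (k+1) * lev w Set.univ k := by
  intro N
  induction N using Nat.strong_induction_on with
  | _ N ih =>
  intro w hw hN
  have wp := hpos w hw
  by_cases h0 : lev w A k = 0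
  · rw [h0, zero_mul]; exact mul_nonneg (lev_nonneg wp _ _) (lev_nonneg wp _ _)
  obtain ⟨Z0, -, hZ0⟩ := Finset.exists_ne_zero_of_sum_ne_zero h0
  have hZ0' : (Z0 ∈ A ∧ Z0.card = k) ∧ w Z0 ≠ 0 := by
    by_cases h : Z0 ∈ A ∧ Z0.card = k
    · rw [if_pos h] at hZ0; exact ⟨h, hZ0⟩
    · simp [h] at hZ0
  obtain ⟨⟨hZA, hZk⟩, hZw⟩ := hZ0'
  have upos : ∀ f ∈ Z0, 0 < lev (rin f w) Set.univ k := by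
    intro f hf
    refine Finset.sum_pos' (fun Z _ => ?_) ⟨Z0, mem_univ _, ?_⟩
    · have := wp Z
      unfold rin; split_ifs <;> simp [this]
    · have := lt_of_le_of_ne (wp Z0) hZw.symm
      simp [rin, hZk, hf, this]
  by_cases hfr : ∀ f ∈ Z0, f ∉ freeSet w
  · have hall : ∀ Z, w Z ≠ 0 → Z0 ⊆ Z := by
      intro Z hZ f hf
      by_contra hfZ
      exact hfr f hf (by simp only [mem_freeSet]; exact ⟨⟨Z0, hf, hZw⟩, ⟨Z, hfZ, hZ⟩⟩)
    have e : lev w A (k+1) = lev w Set.univ (k+1) := by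
      unfold lev
      refine Finset.sum_congr rfl fun Z _ => ?_
      by_cases hz : w Z = 0
      · simp [hz]
      · have := hA Z0 hZA Z (hall Z hz)
        simp [this]
    rw [e, mul_comm]
    exact mul_le_mul_of_nonneg_left (lev_mono wp _ _) (lev_nonneg wp _ _)
  · push Not at hfr
    obtain ⟨f0, hf0, hf0'⟩ := hfr
    let t : Fin m → ℝ := fun f => lev (rin f w) A k * lev w Set.univ k - lev w A k * lev (rin f w) Set.univ k
    have hts : ∑ f, t f = 0 := by
      simp only [t, Finset.sum_sub_distrib, ← Finset.sum_mul, ← Finset.mul_sum, lev_rin_sum]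
      ring
    have rinpos : ∀ f Z, 0 ≤ rin f w Z := fun f => hpos _ (hin w hw f)
    have routpos : ∀ f Z, 0 ≤ rout f w Z := fun f => hpos _ (hout w hw f)
    let F := univ.filter fun f => f ∈ freeSet w ∧ 0 < lev (rin f w) Set.univ k
    have hFs : ∑ f ∈ F, t f = 0 := by
      rw [← hts]
      refine Finset.sum_subset (subset_univ _) fun f _ hf => ?_
      by_cases hu : 0 < lev (rin f w) Set.univ k
      · have hnf : f ∉ freeSet w := fun h => hf (by simp [F, h, hu])
        have e : rin f w = w := by
          obtain ⟨Z1, -, hZ1⟩ := Finset.exists_ne_zero_of_sum_ne_zero hu.ne'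
          have hZ1' : f ∈ Z1 ∧ w Z1 ≠ 0 := by
            unfold rin at hZ1
            by_cases h : f ∈ Z1
            · refine ⟨h, fun h' => hZ1 (by simp [h'])⟩
            · simp [h] at hZ1
          funext Z
          unfold rin
          split_ifs with h
          · rfl
          · by_contra h'
            exact hnf (by simp only [mem_freeSet]; exact ⟨⟨Z1, hZ1'⟩, ⟨Z, h, fun h2 => h' h2.symm⟩⟩)
        simp only [t, e]; ring
      · have e1 : lev (rin f w) Set.univ k = 0 := le_antisymm (not_lt.mp hu) (lev_nonneg (rinpos f) _ _)
        have e2 : lev (rin f w) A k = 0 := le_antisymm (e1 ▸ lev_mono (rinpos f) _ _) (lev_nonneg (rinpos f) _ _)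
        simp [t, e1, e2]
    have hFne : F.Nonempty := ⟨f0, by simp [F, hf0', upos f0 hf0]⟩
    obtain ⟨f, hfF, hft⟩ := Finset.exists_le_of_sum_le hFne (f := fun _ => (0:ℝ)) (g := t) (by simp [hFs])
    have hfF' : f ∈ freeSet w ∧ 0 < lev (rin f w) Set.univ k := by simpa [F] using hfF
    obtain ⟨hfree, hfu⟩ := hfF'
    have c1 : (freeSet (rin f w)).card < N := by
      rw [← hN]
      refine Finset.card_lt_card ⟨fun g hg => ?_, fun h => ?_⟩
      · simp only [mem_freeSet, rin] at hg ⊢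
        obtain ⟨⟨Z, h1, h2⟩, ⟨Z', h3, h4⟩⟩ := hg
        exact ⟨⟨Z, h1, fun h => h2 (by simp [h])⟩, ⟨Z', h3, fun h => h4 (by simp [h])⟩⟩
      · have := h hfree
        simp only [mem_freeSet, rin] at this
        obtain ⟨-, ⟨Z', h3, h4⟩⟩ := this
        exact h4 (by simp [h3])
    have c0 : (freeSet (rout f w)).card < N := by
      rw [← hN]
      refine Finset.card_lt_card ⟨fun g hg => ?_, fun h => ?_⟩
      · simp only [mem_freeSet, rout] at hg ⊢
        obtain ⟨⟨Z, h1, h2⟩, ⟨Z', h3, h4⟩⟩ := hg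
        exact ⟨⟨Z, h1, fun h => h2 (by simp [h])⟩, ⟨Z', h3, fun h => h4 (by simp [h])⟩⟩
      · have := h hfree
        simp only [mem_freeSet, rout] at this
        obtain ⟨⟨Z', h3, h4⟩, -⟩ := this
        exact h4 (by simp [h3])
    have i1 := ih _ c1 _ (hin w hw f) rfl
    have i0 := ih _ c0 _ (hout w hw f) rfl
    have pr := hpair w hw f k
    simp only [t] at hft
    rw [lev_split f w A k, lev_split f w Set.univ k] at hft
    rw [lev_split f w Set.univ k, lev_split f w Set.univ (k+1)] at pr
    rw [lev_split f w A k, lev_split f w Set.univ k, lev_split f w A (k+1), lev_split f w Set.univ (k+1)]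
    refine fm_arith _ _ _ _ _ _ _ _ (lev_nonneg (rinpos f) _ _) (lev_nonneg (routpos f) _ _) hfu
      (lev_nonneg (routpos f) _ _) (lev_nonneg (rinpos f) _ _) (lev_nonneg (routpos f) _ _)
      (lev_nonneg (rinpos f) _ _) (lev_nonneg (routpos f) _ _) (lev_mono (routpos f) _ _) i1 i0 ?_ ?_
    · linarith
    · linarith

open MvPolynomial in
/-- normalized coefficient -/
def nco {J : Type} [Fintype J] (α : J →₀ ℕ) (G : MvPolynomial J ℝ) : ℝ :=
  (∏ s, ((α s).factorial : ℝ)) * coeff α G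

theorem fact_succ {J : Type} [Fintype J] (α : J →₀ ℕ) (s : J) :
    (∏ t, (((α + Finsupp.single s 1 : J →₀ ℕ) t).factorial : ℝ)) = (α s + 1) * ∏ t, ((α t).factorial : ℝ) := by
  rw [← Finset.mul_prod_erase _ _ (mem_univ s), ← Finset.mul_prod_erase univ (fun t => ((α t).factorial : ℝ)) (mem_univ s)]
  have : ∏ t ∈ univ.erase s, (((α + Finsupp.single s 1 : J →₀ ℕ) t).factorial : ℝ) = ∏ t ∈ univ.erase s, ((α t).factorial : ℝ) := by
    refine Finset.prod_congr rfl fun t ht => ?_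
    have : s ≠ t := (Finset.ne_of_mem_erase ht).symm
    simp [Finsupp.single_apply, this]
  rw [this]
  simp [Nat.factorial_succ]
  ring

open MvPolynomial in
theorem nco_pderiv {J : Type} [Fintype J] (α : J →₀ ℕ) (s : J) (G : MvPolynomial J ℝ) :
    nco (α + Finsupp.single s 1) G = nco α (pderiv s G) := by
  unfold nco
  rw [fact_succ, coeff_pderiv]
  push_cast
  ring

open MvPolynomial in
def lin {J : Type} [Fintype J] (c : ℝ) (x : J → ℝ) : MvPolynomial J ℝ :=
  C c + ∑ s, C (x s) * X s

open MvPolynomial in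
theorem nco_lin_mul {J : Type} [Fintype J] (c : ℝ) (x : J → ℝ) (α : J →₀ ℕ) (G : MvPolynomial J ℝ) :
    nco α (lin c x * G) = c * nco α G + ∑ s, (α s : ℝ) * x s * nco (α - Finsupp.single s 1) G := by
  unfold lin
  have key : ∀ s, (∏ t, ((α t).factorial : ℝ)) * coeff α (C (x s) * X s * G) =
      (α s : ℝ) * x s * nco (α - Finsupp.single s 1) G := by
    intro s
    rw [mul_assoc, coeff_C_mul, coeff_X_mul']
    by_cases h : s ∈ α.support
    · rw [if_pos h]
      have hle : Finsupp.single s 1 ≤ α := by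
        rw [Finsupp.single_le_iff]
        exact Nat.one_le_iff_ne_zero.mpr (Finsupp.mem_support_iff.mp h)
      obtain ⟨β, rfl⟩ := exists_add_of_le hle
      rw [add_comm (Finsupp.single s 1) β]
      simp only [add_tsub_cancel_right]
      unfold nco
      rw [fact_succ]
      simp
      ring
    · rw [if_neg h]
      have : α s = 0 := by simpa using h
      simp [this]
  rw [add_mul, Finset.sum_mul]
  unfold nco at key ⊢
  rw [coeff_add, coeff_sum, coeff_C_mul, mul_add, Finset.mul_sum]
  rw [Finset.sum_congr rfl fun s _ => key s]
  ring

open MvPolynomial in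
def linProd {m : ℕ} {J : Type} [Fintype J] (c : Fin m → ℝ) (x : Fin m → J → ℝ) (N : Finset (Fin m)) : MvPolynomial J ℝ :=
  ∏ i ∈ N, lin (c i) (x i)

open MvPolynomial in
theorem pderiv_lin {J : Type} [Fintype J] (c : ℝ) (x : J → ℝ) (s : J) :
    pderiv s (lin c x) = C (x s) := by
  unfold lin
  simp [pderiv_X, Pi.single_apply]

open MvPolynomial in
theorem pderiv_linProd {m : ℕ} {J : Type} [Fintype J] (c : Fin m → ℝ) (x : Fin m → J → ℝ) (N : Finset (Fin m)) (s : J) :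
    pderiv s (linProd c x N) = ∑ b ∈ N, C (x b s) * linProd c x (N.erase b) := by
  unfold linProd
  induction N using Finset.induction_on with
  | empty => simp
  | insert b N hb ih =>
    rw [Finset.prod_insert hb, pderiv_mul, pderiv_lin, ih, Finset.sum_insert hb, Finset.erase_insert hb,
      Finset.mul_sum]
    congr 1
    refine Finset.sum_congr rfl fun b' hb' => ?_
    have hne : b ≠ b' := fun h => hb (h ▸ hb')
    rw [Finset.erase_insert_of_ne hne, Finset.prod_insert (fun h => hb (Finset.mem_of_mem_erase h))]
    ring

theorem nco_succ {m : ℕ} {J : Type} [Fintype J] (c : Fin m → ℝ) (x : Fin m → J → ℝ) (N : Finset (Fin m)) (s : J) (α : J →₀ ℕ) :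
    nco (α + Finsupp.single s 1) (linProd c x N) = ∑ b ∈ N, x b s * nco α (linProd c x (N.erase b)) := by
  rw [nco_pderiv, pderiv_linProd]
  unfold nco
  rw [MvPolynomial.coeff_sum, Finset.mul_sum]
  refine Finset.sum_congr rfl fun b _ => ?_
  rw [MvPolynomial.coeff_C_mul]; ring

theorem nco_ball {m : ℕ} {J : Type} [Fintype J] (c : Fin m → ℝ) (x : Fin m → J → ℝ) (N : Finset (Fin m)) (b : Fin m) (hb : b ∈ N) (α : J →₀ ℕ) :
    nco α (linProd c x N) = c b * nco α (linProd c x (N.erase b)) +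
      ∑ s, (α s : ℝ) * x b s * nco (α - Finsupp.single s 1) (linProd c x (N.erase b)) := by
  rw [← nco_lin_mul]
  unfold linProd
  rw [Finset.mul_prod_erase N (fun i => lin (c i) (x i)) hb]

theorem nco_nonneg {m : ℕ} {J : Type} [Fintype J] (c : Fin m → ℝ) (x : Fin m → J → ℝ) (hc : ∀ i, 0 ≤ c i)
    (hx : ∀ i s, 0 ≤ x i s) (N : Finset (Fin m)) : ∀ (α : J →₀ ℕ), 0 ≤ nco α (linProd c x N) := by
  induction N using Finset.induction_on with
  | empty =>
    intro α
    unfold nco linProd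
    rw [Finset.prod_empty, MvPolynomial.coeff_one]
    split_ifs <;> positivity
  | insert b N hb ih =>
    intro α
    rw [nco_ball c x _ b (mem_insert_self _ _), Finset.erase_insert hb]
    refine add_nonneg (mul_nonneg (hc b) (ih _)) (Finset.sum_nonneg fun s _ => mul_nonneg (mul_nonneg (by positivity) (hx b s)) (ih _))

def propC {m : ℕ} {J : Type} [Fintype J] (c : Fin m → ℝ) (x : Fin m → J → ℝ) (N : Finset (Fin m)) : Prop :=
  ∀ (α : J →₀ ℕ) (i j : J), nco (α + Finsupp.single i 1 + Finsupp.single j 1) (linProd c x N) * nco α (linProd c x N) ≤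
    nco (α + Finsupp.single i 1) (linProd c x N) * nco (α + Finsupp.single j 1) (linProd c x N)

theorem propD_of_C {m : ℕ} {J : Type} [Fintype J] (c : Fin m → ℝ) (x : Fin m → J → ℝ) (hc : ∀ i, 0 ≤ c i)
    (hx : ∀ i s, 0 ≤ x i s) (N : Finset (Fin m)) (b : Fin m) (hb : b ∈ N) (hC : propC c x (N.erase b))
    (α : J →₀ ℕ) (i : J) :
    nco (α + Finsupp.single i 1) (linProd c x (N.erase b)) * nco α (linProd c x N) ≤
    nco α (linProd c x (N.erase b)) * nco (α + Finsupp.single i 1) (linProd c x N) := by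
  rw [nco_ball c x N b hb α, nco_ball c x N b hb (α + Finsupp.single i 1)]
  rw [mul_add, mul_add, Finset.mul_sum, Finset.mul_sum]
  refine add_le_add (le_of_eq (by ring)) (Finset.sum_le_sum fun s _ => ?_)
  have nn := nco_nonneg c x hc hx (N.erase b)
  by_cases h : α s = 0
  · rw [h]
    simp only [Nat.cast_zero, zero_mul, mul_zero]
    exact mul_nonneg (nn _) (mul_nonneg (mul_nonneg (by positivity) (hx b s)) (nn _))
  · have hle : Finsupp.single s 1 ≤ α := by
      rw [Finsupp.single_le_iff]
      exact Nat.one_le_iff_ne_zero.mpr h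
    obtain ⟨β, rfl⟩ := exists_add_of_le hle
    have e1 : Finsupp.single s 1 + β - Finsupp.single s 1 = β := by simp
    have e2 : Finsupp.single s 1 + β + Finsupp.single i 1 - Finsupp.single s 1 = β + Finsupp.single i 1 := by
      rw [add_assoc]; simp
    rw [e1, e2]
    have hk := hC β s i
    rw [add_comm β (Finsupp.single s 1)] at hk
    set P := nco (Finsupp.single s 1 + β + Finsupp.single i 1) (linProd c x (N.erase b))
    set Q := nco β (linProd c x (N.erase b))
    set R := nco (Finsupp.single s 1 + β) (linProd c x (N.erase b)) with hR
    set S := nco (β + Finsupp.single i 1) (linProd c x (N.erase b)) with hS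
    have hR0 : 0 ≤ R := nn _
    have hS0 : 0 ≤ S := nn _
    have hle' : (((Finsupp.single s 1 + β : J →₀ ℕ) s : ℕ) : ℝ) ≤ (((Finsupp.single s 1 + β + Finsupp.single i 1 : J →₀ ℕ) s : ℕ) : ℝ) := by
      rw [Finsupp.add_apply (Finsupp.single s 1 + β)]
      exact_mod_cast Nat.le_add_right _ _
    calc _ = (((Finsupp.single s 1 + β : J →₀ ℕ) s : ℕ) : ℝ) * x b s * (P * Q) := by ring
      _ ≤ (((Finsupp.single s 1 + β : J →₀ ℕ) s : ℕ) : ℝ) * x b s * (R * S) :=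
        mul_le_mul_of_nonneg_left hk (mul_nonneg (by positivity) (hx b s))
      _ ≤ (((Finsupp.single s 1 + β + Finsupp.single i 1 : J →₀ ℕ) s : ℕ) : ℝ) * x b s * (R * S) := by
        refine mul_le_mul_of_nonneg_right (mul_le_mul_of_nonneg_right hle' (hx b s)) (mul_nonneg hR0 hS0)
      _ = _ := by ring

theorem propC_all {m : ℕ} {J : Type} [Fintype J] (c : Fin m → ℝ) (x : Fin m → J → ℝ) (hc : ∀ i, 0 ≤ c i)
    (hx : ∀ i s, 0 ≤ x i s) (N : Finset (Fin m)) : propC c x N := by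
  induction N using Finset.strongInduction with
  | _ N ih =>
  intro α i j
  rw [nco_succ c x N j (α + Finsupp.single i 1), nco_succ c x N j α, Finset.sum_mul, Finset.mul_sum]
  refine Finset.sum_le_sum fun b hb => ?_
  have := propD_of_C c x hc hx N b hb (ih _ (Finset.erase_ssubset hb)) α i
  have := mul_le_mul_of_nonneg_left this (hx b j)
  linarith

theorem coeffD {m : ℕ} {J : Type} [Fintype J] (c : Fin m → ℝ) (x : Fin m → J → ℝ) (hc : ∀ i, 0 ≤ c i)
    (hx : ∀ i s, 0 ≤ x i s) (N : Finset (Fin m)) (b : Fin m) (hb : b ∈ N)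
    (α : J →₀ ℕ) (i : J) :
    MvPolynomial.coeff (α + Finsupp.single i 1) (linProd c x (N.erase b)) * MvPolynomial.coeff α (linProd c x N) ≤
    MvPolynomial.coeff α (linProd c x (N.erase b)) * MvPolynomial.coeff (α + Finsupp.single i 1) (linProd c x N) := by
  have := propD_of_C c x hc hx N b hb (propC_all c x hc hx _) α i
  unfold nco at this
  have h1 : 0 < ∏ s, (((α + Finsupp.single i 1 : J →₀ ℕ) s).factorial : ℝ) := Finset.prod_pos fun s _ => by positivity
  have h2 : 0 < ∏ s, ((α s).factorial : ℝ) := Finset.prod_pos fun s _ => by positivity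
  have h3 := mul_pos h1 h2
  refine le_of_mul_le_mul_left ?_ h3
  linarith

theorem sum_ite_aux {ι : Type} [Fintype ι] (P : Prop) [Decidable P] (g : ι → ℝ) :
    (if P then ∑ i, g i else 0) = ∑ i, if P then g i else 0 := by
  split_ifs <;> simp

def rowIn {m n : ℕ} (f : Fin m) (p : Fin m → Fin (n+1) → ℝ) : Fin m → Fin (n+1) → ℝ :=
  fun i j => if i = f ∧ j ≠ Fin.last n then 0 else p i j
def rowOut {m n : ℕ} (f : Fin m) (p : Fin m → Fin (n+1) → ℝ) : Fin m → Fin (n+1) → ℝ :=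
  fun i j => if i = f ∧ j = Fin.last n then 0 else p i j

theorem wBall_rowIn {m n d : ℕ} (f : Fin m) (p : Fin m → Fin (n+1) → ℝ) (a : Fin d → ℕ) :
    wBall (rowIn f p) a = rin f (wBall p a) := by
  funext Z
  unfold rin wBall
  by_cases hf : f ∈ Z
  · rw [if_pos hf]
    refine Finset.sum_congr rfl fun σ _ => ?_
    split_ifs with h
    · unfold urnWeight
      refine Finset.prod_congr rfl fun i _ => ?_
      unfold rowIn
      rw [if_neg]
      rintro ⟨rfl, h2⟩
      exact h2 ((h.1 i).2 hf)
    · rfl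
  · rw [if_neg hf]
    refine Finset.sum_eq_zero fun σ _ => ?_
    split_ifs with h
    · refine Finset.prod_eq_zero (mem_univ f) ?_
      unfold rowIn
      rw [if_pos ⟨rfl, fun h2 => hf ((h.1 f).1 h2)⟩]
    · rfl

theorem wBall_rowOut {m n d : ℕ} (f : Fin m) (p : Fin m → Fin (n+1) → ℝ) (a : Fin d → ℕ) :
    wBall (rowOut f p) a = rout f (wBall p a) := by
  funext Z
  unfold rout wBall
  by_cases hf : f ∈ Z
  · rw [if_pos hf]
    refine Finset.sum_eq_zero fun σ _ => ?_
    split_ifs with h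
    · refine Finset.prod_eq_zero (mem_univ f) ?_
      unfold rowOut
      rw [if_pos ⟨rfl, (h.1 f).2 hf⟩]
    · rfl
  · rw [if_neg hf]
    refine Finset.sum_congr rfl fun σ _ => ?_
    split_ifs with h
    · unfold urnWeight
      refine Finset.prod_congr rfl fun i _ => ?_
      unfold rowOut
      rw [if_neg]
      rintro ⟨rfl, h2⟩
      exact hf ((h.1 i).1 h2)
    · rfl

theorem lev_wBall {m n d : ℕ} (p : Fin m → Fin (n+1) → ℝ) (a : Fin d → ℕ) (k : ℕ) :
    lev (wBall p a) Set.univ k = ∑ σ : Fin m → Fin (n+1),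
      if ballCount σ (Fin.last n) = k ∧
        (∀ j : Fin (n+1), ∀ h : (j : ℕ) < d, ballCount σ j = a ⟨(j : ℕ), h⟩) then
      urnWeight p σ else 0 := by
  unfold lev wBall
  trans ∑ Z : Finset (Fin m), ∑ σ : Fin m → Fin (n+1), if Z = univ.filter (fun i => σ i = Fin.last n) then
        (if ballCount σ (Fin.last n) = k ∧
        (∀ j : Fin (n+1), ∀ h : (j : ℕ) < d, ballCount σ j = a ⟨(j : ℕ), h⟩) then
      urnWeight p σ else 0) else 0
  · refine Finset.sum_congr rfl fun Z _ => ?_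
    rw [sum_ite_aux]
    refine Finset.sum_congr rfl fun σ _ => ?_
    have e : (∀ i : Fin m, σ i = Fin.last n ↔ i ∈ Z) ↔ Z = univ.filter (fun i => σ i = Fin.last n) := by
      constructor
      · intro h; ext i; simp [h i]
      · rintro rfl i; simp
    by_cases hZ : Z = univ.filter (fun i => σ i = Fin.last n)
    · have hc : Z.card = ballCount σ (Fin.last n) := by rw [hZ]; rfl
      have hu : Z ∈ (Set.univ : Set (Finset (Fin m))) := Set.mem_univ _
      have hi := e.2 hZ
      rw [if_pos hZ]
      split_ifs <;> first | rfl | (exfalso; rw [hc] at *; tauto)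
    · have hi := fun h => hZ (e.1 h)
      rw [if_neg hZ]
      split_ifs <;> first | rfl | (exfalso; tauto)
  rw [Finset.sum_comm]
  refine Finset.sum_congr rfl fun σ _ => ?_
  rw [Finset.sum_ite_eq']
  simp

def urnIdx {n : ℕ} (d : ℕ) (j : Fin (n+1)) : Option (Fin d) :=
  if h : (j : ℕ) < d then some ⟨j, h⟩ else none

def urnE {n : ℕ} (d : ℕ) (j : Fin (n+1)) : Option (Fin d) →₀ ℕ :=
  if j = Fin.last n then 0 else Finsupp.single (urnIdx d j) 1

def urnX {m n : ℕ} (d : ℕ) (p : Fin m → Fin (n+1) → ℝ) (i : Fin m) (s : Option (Fin d)) : ℝ :=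
  ∑ j : Fin (n+1), if j ≠ Fin.last n ∧ urnIdx d j = s then p i j else 0

open MvPolynomial in
theorem lin_urn {m n : ℕ} (d : ℕ) (p : Fin m → Fin (n+1) → ℝ) (i : Fin m) :
    lin (p i (Fin.last n)) (urnX d p i) = ∑ j, monomial (urnE d j) (p i j) := by
  unfold lin urnX
  simp only [map_sum, Finset.sum_mul]
  rw [Finset.sum_comm]
  have : ∀ j : Fin (n+1), ∑ s, C (if j ≠ Fin.last n ∧ urnIdx d j = s then p i j else 0) * X s =
      if j = Fin.last n then (0 : MvPolynomial (Option (Fin d)) ℝ) else monomial (urnE d j) (p i j) := by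
    intro j
    by_cases hj : j = Fin.last n
    · simp [hj]
    · simp only [hj, if_false, ne_eq, not_false_eq_true, true_and]
      rw [Finset.sum_eq_single (urnIdx d j)]
      · simp [urnE, hj, C_mul_X_eq_monomial]
      · intro s _ hs; simp [hs.symm]
      · simp
  rw [Finset.sum_congr rfl fun j _ => this j]
  rw [Fin.sum_univ_castSucc, Fin.sum_univ_castSucc]
  simp only [if_true, add_zero, Fin.castSucc_ne_last, if_false]
  rw [add_comm]
  simp [urnE]

open MvPolynomial in
theorem coeff_urn {m n : ℕ} (d : ℕ) (p : Fin m → Fin (n+1) → ℝ) (α : Option (Fin d) →₀ ℕ) :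
    coeff α (linProd (fun i => p i (Fin.last n)) (urnX d p) univ) =
      ∑ σ : Fin m → Fin (n+1), if ∑ i, urnE d (σ i) = α then urnWeight p σ else 0 := by
  unfold linProd
  rw [Finset.prod_congr rfl fun i _ => lin_urn d p i, Finset.prod_univ_sum, coeff_sum,
    Fintype.piFinset_univ]
  refine Finset.sum_congr rfl fun σ _ => ?_
  rw [← monomial_sum_prod, coeff_monomial]
  rfl

theorem urnE_some {m n d : ℕ} (hd : d ≤ n) (σ : Fin m → Fin (n+1)) (j : Fin (n+1)) (h : (j : ℕ) < d) :
    (∑ i, urnE d (σ i)) (some ⟨j, h⟩) = ballCount σ j := by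
  rw [Finsupp.finset_sum_apply]
  unfold ballCount
  rw [Finset.card_filter]
  refine Finset.sum_congr rfl fun i _ => ?_
  unfold urnE urnIdx
  by_cases hl : σ i = Fin.last n
  · have : ¬ (Fin.last n = j) := by
      rintro rfl
      simp at h; omega
    simp [hl, this]
  · rw [if_neg hl, Finsupp.single_apply]
    congr 1
    by_cases h2 : (σ i : ℕ) < d
    · simp [h2, Fin.ext_iff]
    · simp only [h2, dite_false]
      simp
      rintro rfl; exact h2 h

theorem urnE_degree {m n d : ℕ} (σ : Fin m → Fin (n+1)) :
    (∑ i, urnE d (σ i)).degree + ballCount σ (Fin.last n) = m := by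
  rw [map_sum]
  unfold ballCount
  rw [Finset.card_filter, ← Finset.sum_add_distrib]
  have : ∀ i, (urnE d (σ i)).degree + (if σ i = Fin.last n then 1 else 0) = 1 := by
    intro i
    unfold urnE
    by_cases hl : σ i = Fin.last n <;> simp [hl]
  simp [this]

def gam {d : ℕ} (a : Fin d → ℕ) (c : ℕ) : Option (Fin d) →₀ ℕ :=
  Finsupp.equivFunOnFinite.symm (fun s => s.elim c a)

theorem gam_succ {d : ℕ} (a : Fin d → ℕ) (c : ℕ) : gam a (c+1) = gam a c + Finsupp.single none 1 := by
  ext s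
  cases s <;> simp [gam]

theorem gam_iff {m n d : ℕ} (hd : d ≤ n) (a : Fin d → ℕ) (c k : ℕ) (hk : k + ∑ j, a j + c = m) (σ : Fin m → Fin (n+1)) :
    (ballCount σ (Fin.last n) = k ∧
        (∀ j : Fin (n+1), ∀ h : (j : ℕ) < d, ballCount σ j = a ⟨(j : ℕ), h⟩)) ↔ ∑ i, urnE d (σ i) = gam a c := by
  have hdeg := urnE_degree (d := d) σ
  rw [Finsupp.degree_eq_sum, Fintype.sum_option] at hdeg
  constructor
  · rintro ⟨h1, h2⟩
    have hs : ∀ j : Fin d, (∑ i, urnE d (σ i)) (some j) = a j := by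
      intro j
      have hj : (j : ℕ) < n + 1 := by omega
      have := urnE_some hd σ ⟨j, hj⟩ j.2
      rw [h2 ⟨j, hj⟩ j.2] at this
      simpa using this
    ext s
    cases s with
    | none =>
      simp only [hs] at hdeg
      simp only [gam, Finsupp.equivFunOnFinite_symm_apply_apply, Option.elim]
      omega
    | some j => rw [hs]; simp [gam]
  · intro h
    have hs : ∀ j : Fin d, (∑ i, urnE d (σ i)) (some j) = a j := by
      intro j; rw [h]; simp [gam]
    refine ⟨?_, fun j hj => ?_⟩
    · simp only [hs] at hdeg
      have : (∑ i, urnE d (σ i)) none = c := by rw [h]; simp [gam]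
      omega
    · rw [← urnE_some hd σ j hj, hs]

theorem lev_coeff {m n d : ℕ} (hd : d ≤ n) (p : Fin m → Fin (n+1) → ℝ) (a : Fin d → ℕ) (c k : ℕ) (hk : k + ∑ j, a j + c = m) :
    lev (wBall p a) Set.univ k = MvPolynomial.coeff (gam a c) (linProd (fun i => p i (Fin.last n)) (urnX d p) univ) := by
  rw [lev_wBall, coeff_urn]
  refine Finset.sum_congr rfl fun σ _ => ?_
  simp only [gam_iff hd a c k hk σ]

theorem lev_big {m n d : ℕ} (hd : d ≤ n) (p : Fin m → Fin (n+1) → ℝ) (a : Fin d → ℕ) (k : ℕ) (hk : m < k + ∑ j, a j) :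
    lev (wBall p a) Set.univ k = 0 := by
  rw [lev_wBall]
  refine Finset.sum_eq_zero fun σ _ => ?_
  rw [if_neg]
  rintro ⟨h1, h2⟩
  have hdeg := urnE_degree (d := d) σ
  rw [Finsupp.degree_eq_sum, Fintype.sum_option] at hdeg
  have hs : ∀ j : Fin d, (∑ i, urnE d (σ i)) (some j) = a j := by
    intro j
    have hj : (j : ℕ) < n + 1 := by omega
    have := urnE_some hd σ ⟨j, hj⟩ j.2
    rw [h2 ⟨j, hj⟩ j.2] at this
    simpa using this
  simp only [hs] at hdeg
  omega

theorem rowIn_linProd {m n : ℕ} (d : ℕ) (f : Fin m) (p : Fin m → Fin (n+1) → ℝ) :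
    linProd (fun i => rowIn f p i (Fin.last n)) (urnX d (rowIn f p)) univ =
      MvPolynomial.C (p f (Fin.last n)) * linProd (fun i => p i (Fin.last n)) (urnX d p) (univ.erase f) := by
  unfold linProd
  rw [← Finset.mul_prod_erase univ _ (mem_univ f)]
  congr 1
  · have h0 : urnX d (rowIn f p) f = 0 := by
      funext s
      unfold urnX rowIn
      refine Finset.sum_eq_zero fun j _ => ?_
      by_cases hj : j = Fin.last n <;> simp [hj]
    rw [h0]
    simp [lin, rowIn]
  · refine Finset.prod_congr rfl fun i hi => ?_
    have hne := Finset.ne_of_mem_erase hi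
    have h0 : rowIn f p i = p i := by
      funext j; simp [rowIn, hne]
    have h1 : urnX d (rowIn f p) i = urnX d p i := by
      funext s; unfold urnX; rw [h0]
    simp only [h0, h1]

theorem urn_pair {m n d : ℕ} (hd : d ≤ n) (p : Fin m → Fin (n+1) → ℝ) (hp : ∀ i j, 0 ≤ p i j) (a : Fin d → ℕ)
    (f : Fin m) (k : ℕ) :
    lev (rin f (wBall p a)) Set.univ k * lev (wBall p a) Set.univ (k+1)
      ≤ lev (rin f (wBall p a)) Set.univ (k+1) * lev (wBall p a) Set.univ k := by
  rw [← wBall_rowIn]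
  by_cases hk : m < k + 1 + ∑ j, a j
  · rw [lev_big hd p a (k+1) hk, lev_big hd (rowIn f p) a (k+1) hk]; simp
  · obtain ⟨c, hc⟩ := Nat.exists_eq_add_of_le (not_lt.mp hk)
    rw [lev_coeff hd p a c (k+1) hc.symm, lev_coeff hd (rowIn f p) a c (k+1) hc.symm,
      lev_coeff hd p a (c+1) k (by omega), lev_coeff hd (rowIn f p) a (c+1) k (by omega),
      rowIn_linProd, MvPolynomial.coeff_C_mul, MvPolynomial.coeff_C_mul, gam_succ]
    have := coeffD (fun i => p i (Fin.last n)) (urnX d p) (fun i => hp i _)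
      (fun i s => Finset.sum_nonneg fun j _ => by split_ifs <;> simp [hp]) univ f (mem_univ f) (gam a c) none
    have := mul_le_mul_of_nonneg_left this (hp f (Fin.last n))
    linarith

theorem lev_eq_filter {m : ℕ} (w : Finset (Fin m) → ℝ) (A : Set (Finset (Fin m))) (k : ℕ) :
    lev w A k = ∑ Z ∈ Finset.univ.filter (fun Z : Finset (Fin m) => Z ∈ A ∧ Z.card = k), w Z := by
  unfold lev
  rw [Finset.sum_filter]

theorem lev_eq_filter' {m : ℕ} (w : Finset (Fin m) → ℝ) (k : ℕ) :
    lev w Set.univ k = ∑ Z ∈ Finset.univ.filter (fun Z : Finset (Fin m) => Z.card = k), w Z := by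
  unfold lev
  rw [Finset.sum_filter]
  simp

theorem nuBall_NMP (m n : ℕ) (p : Fin m → Fin (n+1) → ℝ)
    (hp : ∀ i j, 0 ≤ p i j) (hsum : ∀ i, ∑ j, p i j = 1)
    (d : ℕ) (hd : d ≤ n) (a : Fin d → ℕ)
    (A : Set (Finset (Fin m)))
    (hA : ∀ S ∈ A, ∀ T : Finset (Fin m), S ⊆ T → T ∈ A)
    (k : ℕ) :
    (∑ Z ∈ Finset.univ.filter (fun Z : Finset (Fin m) => Z ∈ A ∧ Z.card = k), wBall p a Z) *
      (∑ Z ∈ Finset.univ.filter (fun Z : Finset (Fin m) => Z.card = k + 1), wBall p a Z) ≤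
    (∑ Z ∈ Finset.univ.filter (fun Z : Finset (Fin m) => Z ∈ A ∧ Z.card = k + 1), wBall p a Z) *
      (∑ Z ∈ Finset.univ.filter (fun Z : Finset (Fin m) => Z.card = k), wBall p a Z) := by
  have main := feder_mihail (m := m) {w | ∃ q : Fin m → Fin (n+1) → ℝ, (∀ i j, 0 ≤ q i j) ∧ w = wBall q a}
    (by
      rintro w ⟨q, hq, rfl⟩ Z
      refine Finset.sum_nonneg fun σ _ => ?_
      split_ifs
      · exact Finset.prod_nonneg fun i _ => hq _ _
      · exact le_rfl)
    (by
      rintro w ⟨q, hq, rfl⟩ f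
      refine ⟨rowIn f q, fun i j => ?_, (wBall_rowIn f q a).symm⟩
      unfold rowIn; split_ifs <;> simp [hq])
    (by
      rintro w ⟨q, hq, rfl⟩ f
      refine ⟨rowOut f q, fun i j => ?_, (wBall_rowOut f q a).symm⟩
      unfold rowOut; split_ifs <;> simp [hq])
    (by
      rintro w ⟨q, hq, rfl⟩ f k
      exact urn_pair hd q hq a f k)
    A hA k _ (wBall p a) ⟨p, hp, rfl⟩ rfl
  rw [lev_eq_filter', lev_eq_filter', lev_eq_filter, lev_eq_filter] at main
  exact main

end
end
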